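/- Let μ > 0 and λ ∈ (0,1]. There exist constants C > 0, δ > 0 and a nonnegative function A ∈ L¹((0,∞)) with ‖A‖_{L¹} independent of K, ε, t, such that: if ψ is a solution as in the context with E_N(ψ)(0) ≤ ε², satisfying the bootstrap bound E_N(ψ)(t) ≤ K²ε² for all t ≥ 0, and Kε ≤ δ, then for all t > 0, Σ_{|a|≤N} ∫_{ℝ³}((1+t)^{2λ}|∂∂^aψ|² + ψ²) dx + C Σ_{|a|≤N} ∫₀^t ∫_{ℝ³} (1+τ)^λ |∂∂^aψ|² dx dτ ≤ Cε² + C(1+Kε) ∫₀^t A(τ) Σ_{|a|≤N} ∫_{ℝ³}((1+τ)^{2λ}|∂∂^aψ|² + ψ²) dx dτ, where ∂^a runs over compositions of the derivatives ∂ = (∂_t, ∇_x) only. -/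

import Mathlib

noncomputable section
open MeasureTheory Real Set

/-- Euclidean space ℝ³. -/
abbrev E3 : Type := EuclideanSpace ℝ (Fin 3)
/-- A space-time point (t, x) ∈ ℝ × ℝ³. -/
abbrev Pt : Type := ℝ × E3

/-- Time derivative ∂ₜ. -/
def dt (f : Pt → ℝ) (p : Pt) : ℝ := fderiv ℝ f p (1, 0)
/-- Spatial derivative ∂ᵢ. -/
def dxi (i : Fin 3) (f : Pt → ℝ) (p : Pt) : ℝ := fderiv ℝ f p (0, EuclideanSpace.single i 1)

/-- The vector fields Γ = (∂ₜ, ∂₁, ∂₂, ∂₃, Ω₁, Ω₂, Ω₃, S), where Ω = x ∧ ∇ are the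
rotations and S = t∂ₜ + Σ xₖ∂ₖ is the scaling field. -/
def Gam : Fin 8 → (Pt → ℝ) → Pt → ℝ :=
  ![dt, dxi 0, dxi 1, dxi 2,
    fun f p => p.2 1 * dxi 2 f p - p.2 2 * dxi 1 f p,
    fun f p => p.2 2 * dxi 0 f p - p.2 0 * dxi 2 f p,
    fun f p => p.2 0 * dxi 1 f p - p.2 1 * dxi 0 f p,
    fun f p => p.1 * dt f p + ∑ k, p.2 k * dxi k f p]

/-- The composition Γ^a corresponding to a word `a` in the eight fields. -/
def GamWord : List (Fin 8) → (Pt → ℝ) → Pt → ℝ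
  | [], f => f
  | k :: l, f => Gam k (GamWord l f)

/-- The first-order derivatives ∂ = (∂ₜ, ∂₁, ∂₂, ∂₃). -/
def Dop : Fin 4 → (Pt → ℝ) → Pt → ℝ := ![dt, dxi 0, dxi 1, dxi 2]

/-- The composition ∂^a corresponding to a word `a` in the four derivatives. -/
def DWord : List (Fin 4) → (Pt → ℝ) → Pt → ℝ
  | [], f => f
  | k :: l, f => Dop k (DWord l f)

/-- L² norm in the space variable. -/
def L2norm (f : E3 → ℝ) : ℝ := Real.sqrt (∫ x : E3, (f x) ^ 2)

/-- The d'Alembertian □ = ∂ₜ² - Δ. -/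
def box (f : Pt → ℝ) (p : Pt) : ℝ :=
  dt (fun q => dt f q) p - ∑ i, dxi i (fun q => dxi i f q) p

/-- The square of the sound speed, expressed through ψ:
`c²(ρ) = 1 - (γ-1)[(1+t)^λ ∂ₜψ + λ(1+t)^{λ-1}ψ + μψ + (1+t)^{2λ}|∇ψ|²/2]`. -/
def csq (μ lam γ : ℝ) (ψ : Pt → ℝ) (p : Pt) : ℝ :=
  1 - (γ - 1) * ((1 + p.1) ^ lam * dt ψ p + lam * (1 + p.1) ^ (lam - 1) * ψ p
    + μ * ψ p + (1 + p.1) ^ (2 * lam) * (∑ i, (dxi i ψ p) ^ 2) / 2)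

/-- The quadratic error term `Q(ψ) = (c²(ρ)-1)Δψ - 2(1+t)^λ ∂ₜ∇ψ·∇ψ
- 2λ(1+t)^{λ-1}|∇ψ|² - μ|∇ψ|² - (1+t)^{2λ} Σ (∂ᵢψ)(∂ⱼψ)∂ᵢⱼψ`. -/
def Qpsi (μ lam γ : ℝ) (ψ : Pt → ℝ) (p : Pt) : ℝ :=
  (csq μ lam γ ψ p - 1) * (∑ i, dxi i (fun q => dxi i ψ q) p)
    - 2 * (1 + p.1) ^ lam * ∑ i, dxi i (fun q => dt ψ q) p * dxi i ψ p
    - 2 * lam * (1 + p.1) ^ (lam - 1) * ∑ i, (dxi i ψ p) ^ 2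
    - μ * ∑ i, (dxi i ψ p) ^ 2
    - (1 + p.1) ^ (2 * lam) *
        ∑ i, ∑ j, dxi i ψ p * dxi j ψ p * dxi i (fun q => dxi j ψ q) p

/-- ψ solves `□ψ + (μ/(1+t)^λ)∂ₜψ + (2λ/(1+t))∂ₜψ - (λ(1-λ)/(1+t)²)ψ = Q(ψ)` for `t ≥ 0`. -/
def psiEq (μ lam γ : ℝ) (ψ : Pt → ℝ) : Prop :=
  ∀ p : Pt, 0 ≤ p.1 →
    box ψ p + μ / (1 + p.1) ^ lam * dt ψ p + 2 * lam / (1 + p.1) * dt ψ p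
      - lam * (1 - lam) / (1 + p.1) ^ 2 * ψ p = Qpsi μ lam γ ψ p

/-- The time-weighted energy
`E_N(ψ)(t) = Σ_{|a|≤N} ∫ ((1+t)^{2λ}|∂Γ^aψ|² + |Γ^aψ|²) dx`. -/
def energy (lam : ℝ) (N : ℕ) (ψ : Pt → ℝ) (t : ℝ) : ℝ :=
  ∑ n ∈ Finset.range (N + 1), ∑ a : Fin n → Fin 8,
    ∫ x : E3, ((1 + t) ^ (2 * lam) *
        ∑ α : Fin 4, (Dop α (GamWord (List.ofFn a) ψ) (t, x)) ^ 2
      + (GamWord (List.ofFn a) ψ (t, x)) ^ 2)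

local notation "Fn" => Pt → ℝ
local notation "Wd" => List (Fin 4)
local notation:max "Ds" i:max => Dop (Fin.succ i)
lemma mll {a b c : ℝ} (h : b ≤ c) (ha : 0 ≤ a) : a * b ≤ a * c := mul_le_mul_of_nonneg_left h ha
lemma mlr {a b c : ℝ} (h : b ≤ c) (ha : 0 ≤ a) : b * a ≤ c * a := mul_le_mul_of_nonneg_right h ha
variable {μ lam γ M t K E : ℝ} {N L : ℕ} {f g ψ u F ζ : Fn} {p : Pt}
abbrev Sm (f : Fn) : Prop := ContDiff ℝ ((⊤ : ℕ∞) : WithTop ℕ∞) f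
def vec : Fin 4 → Pt := ![(1, 0), (0, EuclideanSpace.single 0 1), (0, EuclideanSpace.single 1 1), (0, EuclideanSpace.single 2 1)]
lemma Dop_eq (k : Fin 4) (f : Fn) (p : Pt) : Dop k f p = fderiv ℝ f p (vec k) := by
  fin_cases k <;> rfl
lemma dt_eq : dt = Dop 0 := rfl
lemma dxi_eq (i : Fin 3) : dxi i = Ds i := by fin_cases i <;> rfl
lemma vec_succ (i : Fin 3) : vec i.succ = (0, EuclideanSpace.single i 1) := by
  fin_cases i <;> rfl
lemma Sm.da (hf : Sm f) (p : Pt) : DifferentiableAt ℝ f p := (hf.differentiable (by simp)) p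
lemma Sm.D (hf : Sm f) (k : Fin 4) : Sm (Dop k f) := by
  have : Dop k f = fun p => fderiv ℝ f p (vec k) := funext (Dop_eq k f)
  rw [this]
  exact (hf.fderiv_right (by simp)).clm_apply contDiff_const
lemma Sm.W (hf : Sm f) (l : Wd) : Sm (DWord l f) := by
  induction l with
  | nil => exact hf
  | cons k l ih => exact ih.D k
lemma D_add (hf : Sm f) (hg : Sm g) (k : Fin 4) : Dop k (fun p => f p + g p) = fun p => Dop k f p + Dop k g p := by
  funext p
  simp only [Dop_eq]
  rw [fderiv_fun_add (hf.da p) (hg.da p)]; rfl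
lemma D_sub (hf : Sm f) (hg : Sm g) (k : Fin 4) : Dop k (fun p => f p - g p) = fun p => Dop k f p - Dop k g p := by
  funext p
  simp only [Dop_eq]
  rw [fderiv_fun_sub (hf.da p) (hg.da p)]; rfl
lemma D_mul (hf : Sm f) (hg : Sm g) (k : Fin 4) : Dop k (fun p => f p * g p) = fun p => Dop k f p * g p + f p * Dop k g p := by
  funext p
  simp only [Dop_eq]
  rw [fderiv_fun_mul (hf.da p) (hg.da p)]
  simp [smul_eq_mul]; ring
lemma D_cmul (hf : Sm f) (c : ℝ) (k : Fin 4) : Dop k (fun p => c * f p) = fun p => c * Dop k f p := by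
  funext p
  simp only [Dop_eq]
  rw [fderiv_const_mul (hf.da p)]; simp
lemma D_const (c : ℝ) (k : Fin 4) : Dop k (fun _ => c) = fun _ => 0 := by
  funext p
  simp [Dop_eq]
lemma D_sum {ι : Type*} (s : Finset ι) {f : ι → Fn} (hf : ∀ i ∈ s, Sm (f i)) (k : Fin 4) : Dop k (fun p => ∑ i ∈ s, f i p) = fun p => ∑ i ∈ s, Dop k (f i) p := by
  funext p
  simp only [Dop_eq]
  rw [fderiv_fun_sum (fun i hi => (hf i hi).da p)]
  simp
lemma D_comm (hf : Sm f) (k l : Fin 4) : Dop k (Dop l f) = Dop l (Dop k f) := by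
  have h1 : ∀ k l : Fin 4, ∀ p, Dop k (Dop l f) p = fderiv ℝ (fderiv ℝ f) p (vec k) (vec l) := by
    intro k l p
    have : Dop l f = fun p => fderiv ℝ f p (vec l) := funext (Dop_eq l f)
    rw [Dop_eq, this]
    have hd : DifferentiableAt ℝ (fderiv ℝ f) p := ((hf.fderiv_right (m := ((⊤ : ℕ∞) : WithTop ℕ∞)) (by simp)).differentiable (by simp)) p
    rw [fderiv_clm_apply hd (by fun_prop)]
    simp
  funext p
  rw [h1, h1]
  have := (hf.contDiffAt (x := p)).isSymmSndFDerivAt (by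
    simp only [minSmoothness_of_isRCLikeNormedField]; exact WithTop.coe_le_coe.2 (le_top : (2 : ℕ∞) ≤ ⊤))
  exact this (vec k) (vec l)
lemma D_congrU (h : ∀ p : Pt, 0 < p.1 → f p = g p) (k : Fin 4) : ∀ p : Pt, 0 < p.1 → Dop k f p = Dop k g p := by
  intro p hp
  rw [Dop_eq, Dop_eq]
  have ho : IsOpen {q : Pt | 0 < q.1} := isOpen_lt continuous_const continuous_fst
  have : f =ᶠ[nhds p] g := by
    filter_upwards [ho.mem_nhds hp] with q hq using h q hq
  rw [this.fderiv_eq]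
lemma W_congrU (h : ∀ p : Pt, 0 < p.1 → f p = g p) (l : Wd) : ∀ p : Pt, 0 < p.1 → DWord l f p = DWord l g p := by
  induction l with
  | nil => exact h
  | cons k l ih => exact D_congrU ih k
lemma W_cons (hf : Sm f) (k : Fin 4) (l : Wd) : DWord (k :: l) f = DWord l (Dop k f) := by
  induction l with
  | nil => rfl
  | cons j l ih =>
    show Dop k (Dop j (DWord l f)) = Dop j (DWord l (Dop k f))
    rw [D_comm (hf.W l), ← ih]; rfl
lemma W_add (hf : Sm f) (hg : Sm g) (l : Wd) : DWord l (fun p => f p + g p) = fun p => DWord l f p + DWord l g p := by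
  induction l with
  | nil => rfl
  | cons k l ih => simp only [DWord]; rw [ih, D_add (hf.W l) (hg.W l)]
lemma W_cmul (hf : Sm f) (c : ℝ) (l : Wd) : DWord l (fun p => c * f p) = fun p => c * DWord l f p := by
  induction l with
  | nil => rfl
  | cons k l ih => simp only [DWord]; rw [ih, D_cmul (hf.W l)]
lemma W_sum {ι : Type*} (s : Finset ι) {f : ι → Fn} (hf : ∀ i, Sm (f i)) (l : Wd) : DWord l (fun p => ∑ i ∈ s, f i p) = fun p => ∑ i ∈ s, DWord l (f i) p := by
  induction l with
  | nil => rfl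
  | cons k l ih => simp only [DWord]; rw [ih, D_sum s (fun i _ => (hf i).W l)]
lemma W_append (l m : Wd) (f : Fn) : DWord (l ++ m) f = DWord l (DWord m f) := by
  induction l with
  | nil => rfl
  | cons k l ih => simp only [List.cons_append, DWord]; rw [ih]
lemma leib (a : Wd) : ∀ {F G : Fn} (_ : Sm F) (_ : Sm G) (p : Pt) (B : ℝ) (_ : ∀ b c : Wd, b.length + c.length = a.length → |DWord b F p| * |DWord c G p| ≤ B), |DWord a (fun p => F p * G p) p| ≤ 2 ^ a.length * B := by
  induction a with
  | nil =>
    intro F G hF hG p B h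
    have := h [] [] rfl
    simpa [DWord, abs_mul] using this
  | cons k l ih =>
    intro F G hF hG p B h
    rw [W_cons (hF.mul hG), D_mul hF hG, W_add ((hF.D k).mul hG) (hF.mul (hG.D k))]
    have h1 := ih (hF.D k) hG p B (fun b c hbc => by
      have := h (k :: b) c (by simp; omega)
      rwa [W_cons hF] at this)
    have h2 := ih hF (hG.D k) p B (fun b c hbc => by
      have := h b (k :: c) (by simp; omega)
      rwa [W_cons hG] at this)
    calc _ ≤ _ := abs_add_le _ _
      _ ≤ 2 ^ l.length * B + 2 ^ l.length * B := add_le_add h1 h2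
      _ = _ := by simp [pow_succ]; ring
lemma leib' (a : Wd) : ∀ {F G : Fn} (_ : Sm F) (_ : Sm G) (p : Pt) (B : ℝ) (_ : 0 ≤ B) (_ : ∀ b c : Wd, 1 ≤ b.length → b.length + c.length = a.length → |DWord b F p| * |DWord c G p| ≤ B), |DWord a (fun p => F p * G p) p - F p * DWord a G p| ≤ 2 ^ a.length * B := by
  induction a with
  | nil =>
    intro F G hF hG p B hB h
    simpa [DWord] using hB
  | cons k l ih =>
    intro F G hF hG p B hB h
    rw [W_cons (hF.mul hG), D_mul hF hG, W_add ((hF.D k).mul hG) (hF.mul (hG.D k)), W_cons hG]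
    have h1 := leib l (hF.D k) hG p B (fun b c hbc => by
      have := h (k :: b) c (by simp) (by simp; omega)
      rwa [W_cons hF] at this)
    have h2 := ih hF (hG.D k) p B hB (fun b c hb hbc => by
      have := h b (k :: c) hb (by simp; omega)
      rwa [W_cons hG] at this)
    calc _ = |DWord l (fun p => Dop k F p * G p) p + (DWord l (fun p => F p * Dop k G p) p
            - F p * DWord l (Dop k G) p)| := by congr 1; ring
      _ ≤ _ := abs_add_le _ _
      _ ≤ 2 ^ l.length * B + 2 ^ l.length * B := add_le_add h1 h2
      _ = _ := by simp [pow_succ]; ring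
def Sp (M : ℝ) (f : Fn) : Prop := ∀ p : Pt, 0 < p.1 → p.1 + M < ‖p.2‖ → f p = 0
lemma Sp.D {M : ℝ} {f : Fn} (h : Sp M f) (k : Fin 4) : Sp M (Dop k f) := by
  intro p hp hM
  have ho : IsOpen {q : Pt | 0 < q.1 ∧ q.1 + M < ‖q.2‖} := (isOpen_lt continuous_const continuous_fst).inter (isOpen_lt (f := fun q : Pt => q.1 + M) (g := fun q : Pt => ‖q.2‖) (by fun_prop) (by fun_prop))
  have : f =ᶠ[nhds p] (fun _ => 0) := by
    filter_upwards [ho.mem_nhds ⟨hp, hM⟩] with q hq using h q hq.1 hq.2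
  rw [Dop_eq, this.fderiv_eq]; simp
lemma Sp.W {M : ℝ} {f : Fn} (h : Sp M f) (l : Wd) : Sp M (DWord l f) := by
  induction l with
  | nil => exact h
  | cons k l ih => exact ih.D k
lemma Sp.mul {M : ℝ} {f : Fn} (h : Sp M f) (g : Fn) : Sp M (fun p => f p * g p) := fun p hp hM => by simp [h p hp hM]
lemma Sp.mul' {M : ℝ} {f : Fn} (h : Sp M f) (g : Fn) : Sp M (fun p => g p * f p) := fun p hp hM => by simp [h p hp hM]
lemma Sp.add {M : ℝ} {f g : Fn} (h : Sp M f) (h' : Sp M g) : Sp M (fun p => f p + g p) := fun p hp hM => by simp [h p hp hM, h' p hp hM]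
lemma Sp.sub {M : ℝ} {f g : Fn} (h : Sp M f) (h' : Sp M g) : Sp M (fun p => f p - g p) := fun p hp hM => by simp [h p hp hM, h' p hp hM]
lemma Sp.sum {M : ℝ} {ι : Type*} (s : Finset ι) {f : ι → Fn} (h : ∀ i ∈ s, Sp M (f i)) : Sp M (fun p => ∑ i ∈ s, f i p) := fun p hp hM => Finset.sum_eq_zero (fun i hi => h i hi p hp hM)
lemma Sp.sq {M : ℝ} {f : Fn} (h : Sp M f) : Sp M (fun p => f p ^ 2) := fun p hp hM => by simp [h p hp hM]
lemma slice_cs {M : ℝ} {f : Fn} (h : Sp M f) {t : ℝ} (ht : 0 < t) : HasCompactSupport (fun x : E3 => f (t, x)) := by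
  apply HasCompactSupport.of_support_subset_isCompact (isCompact_closedBall (0 : E3) (t + M))
  intro x hx
  simp only [Function.mem_support] at hx
  rw [mem_closedBall_zero_iff]
  by_contra hc
  exact hx (h (t, x) ht (not_le.mp hc))
lemma slice_int {M : ℝ} {f : Fn} (hc : Continuous f) (h : Sp M f) {t : ℝ} (ht : 0 < t) : Integrable (fun x : E3 => f (t, x)) := (hc.comp (by fun_prop : Continuous fun x : E3 => ((t, x) : Pt))).integrable_of_hasCompactSupport (slice_cs h ht)
lemma slice_deriv {f : Fn} (hf : Sm f) (i : Fin 3) (t : ℝ) (x : E3) : HasLineDerivAt ℝ (fun x : E3 => f (t, x)) (Ds i f (t, x)) x (EuclideanSpace.single i 1) := by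
  have h1 : HasFDerivAt (fun x : E3 => f (t, x)) ((fderiv ℝ f (t, x)).comp (ContinuousLinearMap.inr ℝ ℝ E3)) x := ((hf.da (t, x)).hasFDerivAt).comp x (hasFDerivAt_prodMk_right t x)
  have := h1.hasLineDerivAt (EuclideanSpace.single i 1)
  rw [Dop_eq, vec_succ]
  simpa using this
lemma int_dx {M : ℝ} {f : Fn} (hf : Sm f) (h : Sp M f) {t : ℝ} (ht : 0 < t) (i : Fin 3) : ∫ x : E3, Ds i f (t, x) = 0 := by
  have := integral_bilinear_hasLineDerivAt_right_eq_neg_left_of_integrable (μ := volume) (f := fun _ : E3 => (1 : ℝ)) (f' := fun _ => 0) (g := fun x : E3 => f (t, x)) (g' := fun x => Ds i f (t, x)) (v := EuclideanSpace.single i 1) (B := ContinuousLinearMap.mul ℝ ℝ) (by simp) (by simpa using slice_int (hf.D _).continuous (h.D i.succ) ht) (by simpa using slice_int hf.continuous h ht) (fun x _ => by simpa using (hasFDerivAt_const (1 : ℝ) x).hasLineDerivAt (EuclideanSpace.single i 1)) (fun x _ => slice_deriv hf i t x)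
  simpa using this
lemma slice_dt {f : Fn} (hf : Sm f) (t : ℝ) (x : E3) : HasDerivAt (fun s => f (s, x)) (Dop 0 f (t, x)) t := by
  have h1 : HasFDerivAt (fun s : ℝ => f (s, x)) ((fderiv ℝ f (t, x)).comp (ContinuousLinearMap.inl ℝ ℝ E3)) t := ((hf.da (t, x)).hasFDerivAt).comp t (hasFDerivAt_prodMk_left t x)
  have := h1.hasDerivAt
  rw [Dop_eq, show vec 0 = (1, 0) from rfl]
  simpa using this
lemma int_dt {M : ℝ} {f : Fn} (hf : Sm f) (h : Sp M f) {t : ℝ} (ht : 0 < t) : HasDerivAt (fun s => ∫ x : E3, f (s, x)) (∫ x : E3, Dop 0 f (t, x)) t := by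
  have hK : IsCompact (Icc (t/2) (2*t) ×ˢ Metric.closedBall (0 : E3) (2*t + M)) := isCompact_Icc.prod (isCompact_closedBall _ _)
  obtain ⟨C, hC⟩ := hK.exists_bound_of_continuousOn (hf.D 0).continuous.continuousOn
  have hs : Ioo (t/2) (2*t) ∈ nhds t := Ioo_mem_nhds (by linarith) (by linarith)
  refine (hasDerivAt_integral_of_dominated_loc_of_deriv_le (F := fun s x => f (s, x)) (F' := fun s x => Dop 0 f (s, x)) (bound := (Metric.closedBall (0 : E3) (2*t + M)).indicator (fun _ => C)) hs ?_ ?_ ?_ ?_ ?_ ?_).2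
  · filter_upwards with s
    exact (hf.continuous.comp (by fun_prop : Continuous fun x : E3 => ((s, x) : Pt))).aestronglyMeasurable
  · exact slice_int hf.continuous h ht
  · exact ((hf.D 0).continuous.comp (by fun_prop : Continuous fun x : E3 => ((t, x) : Pt))).aestronglyMeasurable
  · filter_upwards with x s hs
    by_cases hx : x ∈ Metric.closedBall (0 : E3) (2*t + M)
    · rw [indicator_of_mem hx]
      exact hC (s, x) ⟨⟨hs.1.le, hs.2.le⟩, hx⟩
    · rw [indicator_of_notMem hx]
      rw [mem_closedBall_zero_iff, not_le] at hx
      have := h.D 0 (s, x) (by have := hs.1; simp only; linarith) (by have := hs.2; simp only; linarith)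
      simp [this]
  · exact (integrable_indicator_iff measurableSet_closedBall).2 (integrableOn_const (by exact measure_closedBall_lt_top.ne))
  · filter_upwards with x s hs using slice_dt hf s x
def tau (p : Pt) : ℝ := 1 + p.1 * Real.smoothTransition (1 + 2 * p.1)
lemma tau_pos (p : Pt) : 0 < tau p := by
  unfold tau
  have h1 := Real.smoothTransition.nonneg (1 + 2 * p.1)
  have h2 := Real.smoothTransition.le_one (1 + 2 * p.1)
  rcases le_total p.1 (-1/2) with h | h
  · rw [Real.smoothTransition.zero_of_nonpos (by linarith)]; simp
  · nlinarith
lemma tau_eq (hp : 0 ≤ p.1) : tau p = 1 + p.1 := by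
  unfold tau
  rw [Real.smoothTransition.one_of_one_le (by linarith)]; ring
lemma tau_sm : Sm tau := by
  unfold tau
  have : ContDiff ℝ ((⊤ : ℕ∞) : WithTop ℕ∞) (fun p : Pt => Real.smoothTransition (1 + 2 * p.1)) := Real.smoothTransition.contDiff.comp (by fun_prop)
  exact contDiff_const.add (contDiff_fst.mul this)
def Wt (a : ℝ) (p : Pt) : ℝ := tau p ^ a
local notation:max "Vt" i:max => Wt (2 * i)
lemma Wt_sm (a : ℝ) : Sm (Wt a) := tau_sm.rpow_const_of_ne (fun p => (tau_pos p).ne')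
lemma Wt_pos (a : ℝ) (p : Pt) : 0 < Wt a p := Real.rpow_pos_of_pos (tau_pos p) a
lemma Wt_eq (a : ℝ) (hp : 0 ≤ p.1) : Wt a p = (1 + p.1) ^ a := by
  unfold Wt; rw [tau_eq hp]
lemma Wt_mul (a b : ℝ) (p : Pt) : Wt a p * Wt b p = Wt (a + b) p := (Real.rpow_add (tau_pos p) a b).symm
lemma Wt_mono {a b : ℝ} (h : a ≤ b) (hp : 0 ≤ p.1) : Wt a p ≤ Wt b p := by
  rw [Wt_eq _ hp, Wt_eq _ hp]
  exact Real.rpow_le_rpow_of_exponent_le (by linarith) h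
lemma Wt_zero (p : Pt) : Wt 0 p = 1 := by unfold Wt; simp
lemma D0_Wt (a : ℝ) : ∀ p : Pt, 0 < p.1 → Dop 0 (Wt a) p = a * Wt (a - 1) p := by
  intro p hp
  have h1 := D_congrU (f := Wt a) (g := fun q => (1 + q.1) ^ a) (fun q hq => Wt_eq a hq.le) 0 p hp
  rw [h1, Wt_eq _ hp.le, Dop_eq]
  have h2 : HasFDerivAt (fun q : Pt => (1 + q.1) ^ a) ((a * (1 + p.1) ^ (a - 1)) • (ContinuousLinearMap.fst ℝ ℝ E3)) p := by
    have h3 : HasFDerivAt (fun q : Pt => 1 + q.1) (ContinuousLinearMap.fst ℝ ℝ E3) p := (hasFDerivAt_fst).const_add 1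
    have := h3.rpow_const (p := a) (Or.inl (by linarith : (1 + p.1) ≠ 0))
    exact this
  rw [h2.fderiv]
  simp [vec]
lemma Di_Wt (a : ℝ) (i : Fin 3) : Ds i (Wt a) = fun _ => 0 := by
  funext p
  rw [Dop_eq]
  have h1 : Wt a = (fun s : ℝ => Wt a (s, 0)) ∘ Prod.fst := by
    funext q; simp [Wt, tau]
  have hd : DifferentiableAt ℝ (fun s : ℝ => Wt a (s, 0)) p.1 := by
    have : ContDiff ℝ ((⊤ : ℕ∞) : WithTop ℕ∞) (fun s : ℝ => Wt a (s, 0)) := (Wt_sm a).comp (by fun_prop)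
    exact (this.differentiable (by simp)) _
  rw [h1, fderiv_comp p hd differentiableAt_fst, fderiv_fst]
  simp [vec_succ]
lemma W_Wt (a : ℝ) (l : Wd) : ∃ c, |c| ≤ (|a| + l.length) ^ l.length ∧ ∀ p : Pt, 0 < p.1 → DWord l (Wt a) p = c * Wt (a - l.length) p := by
  induction l with
  | nil => exact ⟨1, by simp, fun p hp => by simp [DWord]⟩
  | cons k l ih =>
    obtain ⟨c, hc, h⟩ := ih
    have h2 : ∀ p : Pt, 0 < p.1 → DWord (k :: l) (Wt a) p = Dop k (fun q => c * Wt (a - l.length) q) p := fun p hp => D_congrU h k p hp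
    rcases Fin.eq_zero_or_eq_succ k with rfl | ⟨i, rfl⟩
    · refine ⟨c * (a - l.length), ?_, ?_⟩
      · rw [abs_mul, List.length_cons, pow_succ]
        have h0 : |a - l.length| ≤ |a| + l.length := by
          have := abs_sub a (l.length : ℝ); simpa using this
        push_cast
        have h3 : (|a| + (l.length : ℝ)) ^ l.length ≤ (|a| + (l.length + 1)) ^ l.length := by
          gcongr; linarith
        exact mul_le_mul (hc.trans h3) (by linarith) (abs_nonneg _) (by positivity)
      · intro p hp
        rw [h2 p hp, D_cmul (Wt_sm _)]
        simp only [D0_Wt _ p hp]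
        simp only [List.length_cons]; push_cast
        rw [show a - ((l.length : ℝ) + 1) = a - l.length - 1 by ring]; ring
    · refine ⟨0, by simp; positivity, ?_⟩
      intro p hp
      rw [h2 p hp, D_cmul (Wt_sm _), Di_Wt]; simp
lemma W_Wt' (a : ℝ) (N : ℕ) : ∃ C ≥ 1, ∀ l : Wd, l.length ≤ N → ∀ p : Pt, 0 < p.1 → |DWord l (Wt a) p| ≤ C * Wt (a - l.length) p := by
  refine ⟨(1 + |a| + N) ^ N, one_le_pow₀ (by have := abs_nonneg a; have : (0:ℝ) ≤ N := by positivity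
                                             linarith [abs_nonneg a]), ?_⟩
  intro l hl p hp
  obtain ⟨c, hc, h⟩ := W_Wt a l
  rw [h p hp, abs_mul, abs_of_pos (Wt_pos _ p)]
  gcongr
  · exact (Wt_pos _ p).le
  refine hc.trans ?_
  have h1 : (l.length : ℝ) ≤ N := by exact_mod_cast hl
  calc (|a| + (l.length : ℝ)) ^ l.length ≤ (1 + |a| + N) ^ l.length := by gcongr; linarith
    _ ≤ _ := pow_le_pow_right₀ (by linarith [abs_nonneg a, (Nat.cast_nonneg N : (0:ℝ) ≤ N)]) hl
lemma one_dim {g g' Φ : ℝ → ℝ} {R : ℝ} (hg : ∀ s, HasDerivAt g (g' s) s) (hb : ∀ s, |g' s| ≤ Φ s) (hΦ : Continuous Φ) (h0 : ∀ s, R ≤ |s| → g s = 0) (hR : 0 ≤ R) (s : ℝ) : |g s| ≤ ∫ u in (-R)..R, Φ u := by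
  have hΦ0 : ∀ u, 0 ≤ Φ u := fun u => (abs_nonneg _).trans (hb u)
  have hnn : 0 ≤ ∫ u in (-R)..R, Φ u := intervalIntegral.integral_nonneg (by linarith) (fun u _ => hΦ0 u)
  by_cases hs : R ≤ |s|
  · rw [h0 s hs]; simpa using hnn
  push Not at hs
  obtain ⟨hs1, hs2⟩ := abs_lt.mp hs
  have key : ∀ x ∈ Icc (-R) R, ‖g x‖ ≤ ∫ u in (-R)..x, Φ u := by
    refine image_norm_le_of_norm_deriv_right_le_deriv_boundary' (f := g) (a := -R) (b := R) (f' := g') (B := fun x => ∫ u in (-R)..x, Φ u) (B' := Φ) ?_ ?_ ?_ ?_ ?_ ?_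
    · exact fun x _ => (hg x).continuousAt.continuousWithinAt
    · exact fun x _ => (hg x).hasDerivWithinAt
    · rw [h0 (-R) (by simp [abs_of_nonneg hR])]; simp
    · exact (intervalIntegral.continuous_primitive (fun a b => hΦ.intervalIntegrable a b) _).continuousOn
    · intro x _
      exact (intervalIntegral.integral_hasDerivAt_right (hΦ.intervalIntegrable _ _) (hΦ.stronglyMeasurableAtFilter _ _) hΦ.continuousAt).hasDerivWithinAt
    · intro x _; exact hb x
  refine (key s ⟨hs1.le, hs2.le⟩).trans ?_
  apply intervalIntegral.integral_mono_interval le_rfl hs1.le hs2.le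
  · exact Filter.Eventually.of_forall hΦ0
  · exact hΦ.intervalIntegrable _ _
lemma three_dim {P P1 P2 P3 : ℝ → ℝ → ℝ → ℝ} {h : ℝ → ℝ → ℝ} {R : ℝ} (hR : 0 ≤ R) (h1 : ∀ a b, HasDerivAt (fun a => P a b (h a b)) (P1 a b (h a b)) a) (h2 : ∀ a b, HasDerivAt (fun b => P1 a b (h a b)) (P2 a b (h a b)) b) (h3 : ∀ a b c, HasDerivAt (fun c => P2 a b c) (P3 a b c) c) (s1 : ∀ a b c, R ≤ |a| → P a b c = 0) (s2 : ∀ a b c, R ≤ |b| → P1 a b c = 0) (s3 : ∀ a b c, R ≤ |c| → P2 a b c = 0) (hc : Continuous (fun q : ℝ × ℝ × ℝ => P3 q.1 q.2.1 q.2.2)) (a b : ℝ) : |P a b (h a b)| ≤ ∫ a in (-R)..R, ∫ b in (-R)..R, ∫ c in (-R)..R, |P3 a b c| := by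
  have c1 : Continuous (fun q : (ℝ × ℝ) × ℝ => |P3 q.1.1 q.1.2 q.2|) := (hc.comp (by fun_prop : Continuous fun q : (ℝ × ℝ) × ℝ => (q.1.1, q.1.2, q.2))).abs
  have c2 : Continuous (fun q : ℝ × ℝ => ∫ c in (-R)..R, |P3 q.1 q.2 c|) := intervalIntegral.continuous_parametric_intervalIntegral_of_continuous' (μ := volume) (f := fun (q : ℝ × ℝ) c => |P3 q.1 q.2 c|) c1 _ _
  have c3 : Continuous (fun a : ℝ => ∫ b in (-R)..R, ∫ c in (-R)..R, |P3 a b c|) := intervalIntegral.continuous_parametric_intervalIntegral_of_continuous' (μ := volume) (f := fun (a : ℝ) b => ∫ c in (-R)..R, |P3 a b c|) c2 _ _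
  refine one_dim (g := fun a => P a b (h a b)) (fun s => h1 s b) ?_ c3 (fun s hs => s1 _ _ _ hs) hR a
  intro a
  refine one_dim (g := fun b => P1 a b (h a b)) (fun s => h2 a s) ?_ (c2.comp (by fun_prop : Continuous fun b : ℝ => (a, b))) (fun s hs => s2 _ _ _ hs) hR b
  intro b
  exact one_dim (g := fun c => P2 a b c) (fun s => h3 a b s) (fun s => le_rfl) (c1.comp (by fun_prop : Continuous fun c : ℝ => ((a, b), c))) (fun s hs => s3 _ _ _ hs) hR _
def mkp (k : Fin 3) (a b c : ℝ) : E3 := WithLp.toLp 2 (k.insertNth c ![a, b])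
lemma mkp_k (k : Fin 3) (a b c : ℝ) : mkp k a b c k = c := by simp [mkp]
lemma mkp_i (k : Fin 3) (a b c : ℝ) : mkp k a b c (k.succAbove 0) = a := by simp [mkp]
lemma mkp_j (k : Fin 3) (a b c : ℝ) : mkp k a b c (k.succAbove 1) = b := by simp [mkp]
lemma mkp_self (k : Fin 3) (x : E3) : mkp k (x (k.succAbove 0)) (x (k.succAbove 1)) (x k) = x := by
  ext i
  rcases Fin.eq_self_or_eq_succAbove k i with rfl | ⟨j, rfl⟩
  · simp [mkp]
  · fin_cases j <;> simp [mkp]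
lemma mkp_eq (k : Fin 3) (a b c : ℝ) : mkp k a b c = EuclideanSpace.single (k.succAbove 0) a + EuclideanSpace.single (k.succAbove 1) b + EuclideanSpace.single k c := by
  rw [← mkp_self k (_ + _)]
  congr 1 <;> fin_cases k <;> simp [Fin.succAbove]
lemma mkp_cont (k : Fin 3) : Continuous (fun q : ℝ × ℝ × ℝ => mkp k q.1 q.2.1 q.2.2) := by
  have : (fun q : ℝ × ℝ × ℝ => mkp k q.1 q.2.1 q.2.2) = fun q =>
    q.1 • EuclideanSpace.single (k.succAbove 0) (1:ℝ) + q.2.1 • EuclideanSpace.single (k.succAbove 1) (1:ℝ) + q.2.2 • EuclideanSpace.single k (1:ℝ) := by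
    funext q; rw [mkp_eq]
    have h : ∀ (i : Fin 3) (r : ℝ), EuclideanSpace.single i r = r • (EuclideanSpace.single i (1:ℝ) : E3) := by
      intro i r; ext j; by_cases hj : j = i <;> simp [hj]
    rw [h _ q.1, h _ q.2.1, h _ q.2.2]
  rw [this]; fun_prop
lemma abs_coord_le (x : E3) (i : Fin 3) : |x i| ≤ ‖x‖ := by
  simpa using EuclideanSpace.norm_eq x ▸ (by
    apply Real.abs_le_sqrt
    have := Finset.single_le_sum (f := fun i => ‖x i‖ ^ 2) (fun i _ => by positivity) (Finset.mem_univ i)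
    simpa using this : |x i| ≤ √(∑ i, ‖x i‖ ^ 2))
lemma swap_ii {G : ℝ → ℝ → ℝ} (hG : Continuous (fun q : ℝ × ℝ => G q.1 q.2)) (R : ℝ) (hR : -R ≤ R) : ∫ a in (-R)..R, ∫ b in (-R)..R, G a b = ∫ b in (-R)..R, ∫ a in (-R)..R, G a b := by
  simp only [intervalIntegral.integral_of_le hR]
  apply MeasureTheory.integral_integral_swap
  rw [Measure.prod_restrict, ← Measure.volume_eq_prod]
  exact (hG.continuousOn.integrableOn_compact (isCompact_Icc.prod isCompact_Icc)).mono_set (prod_mono Ioc_subset_Icc_self Ioc_subset_Icc_self)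
lemma triple_int (k : Fin 3) {F : E3 → ℝ} (hF : Continuous F) (hc : HasCompactSupport F) (h0 : ∀ x, 0 ≤ F x) (R : ℝ) (hR : 0 ≤ R) : ∫ a in (-R)..R, ∫ b in (-R)..R, ∫ c in (-R)..R, F (mkp k a b c) ≤ ∫ x, F x := by
  have hFi : Integrable F := hF.integrable_of_hasCompactSupport hc
  have e1 : MeasurePreserving (fun y : Fin 3 → ℝ => (WithLp.toLp 2 y : E3)) := PiLp.volume_preserving_toLp (Fin 3)
  have e2 := (volume_preserving_piFinSuccAbove (fun _ : Fin 3 => ℝ) k).symm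
  have e3 := (volume_preserving_finTwoArrow ℝ).symm
  have e3' : MeasurePreserving (Prod.map (id : ℝ → ℝ) (MeasurableEquiv.finTwoArrow (α := ℝ)).symm) (volume.prod volume) (volume.prod volume) := (MeasurePreserving.id volume).prod e3
  have e := e1.comp (e2.comp e3')
  have hmk : ∀ q : ℝ × ℝ × ℝ, ((fun y : Fin 3 → ℝ => (WithLp.toLp 2 y : E3)) ∘ ((MeasurableEquiv.piFinSuccAbove (fun _ : Fin 3 => ℝ) k).symm ∘ (Prod.map (id : ℝ → ℝ) (MeasurableEquiv.finTwoArrow (α := ℝ)).symm))) q = mkp k q.2.1 q.2.2 q.1 := by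
    intro q
    rfl
  have hemb : MeasurableEmbedding ((fun y : Fin 3 → ℝ => (WithLp.toLp 2 y : E3)) ∘ ((MeasurableEquiv.piFinSuccAbove (fun _ : Fin 3 => ℝ) k).symm ∘ (Prod.map (id : ℝ → ℝ) (MeasurableEquiv.finTwoArrow (α := ℝ)).symm))) := by
    refine (MeasurableEquiv.toLp 2 (Fin 3 → ℝ)).measurableEmbedding.comp ((MeasurableEquiv.measurableEmbedding _).comp ?_)
    exact ((MeasurableEquiv.refl ℝ).prodCongr (MeasurableEquiv.finTwoArrow (α := ℝ)).symm).measurableEmbedding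
  have hint : ∫ q : ℝ × ℝ × ℝ, F (mkp k q.2.1 q.2.2 q.1) = ∫ x, F x := by
    have := e.integral_comp hemb F
    simp only [hmk] at this
    exact this
  have hI : Integrable (fun q : ℝ × ℝ × ℝ => F (mkp k q.2.1 q.2.2 q.1)) := by
    have := (e.integrable_comp_emb hemb (g := F)).2 hFi
    refine this.congr (Filter.Eventually.of_forall fun q => ?_)
    simp only [Function.comp_apply]
    exact congrArg F (hmk q)
  have hcont : Continuous (fun q : ℝ × ℝ × ℝ => F (mkp k q.2.1 q.2.2 q.1)) := hF.comp ((mkp_cont k).comp (by fun_prop : Continuous fun q : ℝ × ℝ × ℝ => (q.2.1, q.2.2, q.1)))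
  rw [← hint]
  have hbox : ∫ q in (Ioc (-R) R ×ˢ (Ioc (-R) R ×ˢ Ioc (-R) R)), F (mkp k q.2.1 q.2.2 q.1) ≤ ∫ q : ℝ × ℝ × ℝ, F (mkp k q.2.1 q.2.2 q.1) := setIntegral_le_integral hI (Filter.Eventually.of_forall fun q => h0 _)
  refine le_trans (le_of_eq ?_) hbox
  have hR' : -R ≤ R := by linarith
  rw [Measure.volume_eq_prod, setIntegral_prod _ (by
    rw [← Measure.volume_eq_prod]; exact hI.integrableOn)]
  have hin : ∀ c, ∫ q in Ioc (-R) R ×ˢ Ioc (-R) R, F (mkp k q.1 q.2 c) = ∫ a in (-R)..R, ∫ b in (-R)..R, F (mkp k a b c) := by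
    intro c
    rw [Measure.volume_eq_prod, setIntegral_prod]
    · simp only [intervalIntegral.integral_of_le hR']
    · have : Continuous (fun q : ℝ × ℝ => F (mkp k q.1 q.2 c)) := hF.comp ((mkp_cont k).comp (by fun_prop : Continuous fun q : ℝ × ℝ => (q.1, q.2, c)))
      rw [← Measure.volume_eq_prod]
      exact (this.continuousOn.integrableOn_compact (isCompact_Icc.prod isCompact_Icc)).mono_set (prod_mono Ioc_subset_Icc_self Ioc_subset_Icc_self)
  simp only [hin]
  rw [← intervalIntegral.integral_of_le hR']
  have sw : ∀ a, ∫ b in (-R)..R, ∫ c in (-R)..R, F (mkp k a b c) = ∫ c in (-R)..R, ∫ b in (-R)..R, F (mkp k a b c) := by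
    intro a
    refine swap_ii (G := fun b c => F (mkp k a b c)) ?_ R hR'
    exact hF.comp ((mkp_cont k).comp (by fun_prop : Continuous fun q : ℝ × ℝ => (a, q.1, q.2)))
  simp only [sw]
  refine swap_ii (G := fun a c => ∫ b in (-R)..R, F (mkp k a b c)) ?_ R hR'
  apply intervalIntegral.continuous_parametric_intervalIntegral_of_continuous' (μ := volume) (f := fun (q : ℝ × ℝ) b => F (mkp k q.1 b q.2))
  exact hF.comp ((mkp_cont k).comp (by fun_prop :
      Continuous fun q : (ℝ × ℝ) × ℝ => (q.1.1, q.2, q.1.2)))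
def gc : Fin 8 → Fin 4 → Fn := ![![fun _ => 1, fun _ => 0, fun _ => 0, fun _ => 0], ![fun _ => 0, fun _ => 1, fun _ => 0, fun _ => 0], ![fun _ => 0, fun _ => 0, fun _ => 1, fun _ => 0], ![fun _ => 0, fun _ => 0, fun _ => 0, fun _ => 1], ![fun _ => 0, fun _ => 0, fun p => -p.2 2, fun p => p.2 1], ![fun _ => 0, fun p => p.2 2, fun _ => 0, fun p => -p.2 0], ![fun _ => 0, fun p => -p.2 1, fun p => p.2 0, fun _ => 0], ![fun p => p.1, fun p => p.2 0, fun p => p.2 1, fun p => p.2 2]]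
lemma Gam_eq (k : Fin 8) (f : Fn) (p : Pt) : Gam k f p = ∑ α, gc k α p * Dop α f p := by
  fin_cases k <;> simp [Gam, gc, Dop, Fin.sum_univ_succ] <;> ring
lemma Sm_coord (i : Fin 3) : Sm (fun p : Pt => p.2 i) := by
  have : (fun p : Pt => p.2 i) = fun p => (EuclideanSpace.proj i : E3 →L[ℝ] ℝ) p.2 := rfl
  rw [this]
  exact (EuclideanSpace.proj i : E3 →L[ℝ] ℝ).contDiff.comp contDiff_snd
lemma Sm_t : Sm (fun p : Pt => p.1) := contDiff_fst
lemma Sm_gc (k : Fin 8) (α : Fin 4) : Sm (gc k α) := by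
  fin_cases k <;> fin_cases α <;>
    first | exact contDiff_const | exact Sm_coord _ | exact (Sm_coord _).neg | exact Sm_t
lemma D_coord (i : Fin 3) (α : Fin 4) (p : Pt) : Dop α (fun p : Pt => p.2 i) p = if α = i.succ then 1 else 0 := by
  rw [Dop_eq]
  have : HasFDerivAt (fun p : Pt => p.2 i) ((EuclideanSpace.proj i : E3 →L[ℝ] ℝ).comp (ContinuousLinearMap.snd ℝ ℝ E3)) p := ((EuclideanSpace.proj i : E3 →L[ℝ] ℝ).comp (ContinuousLinearMap.snd ℝ ℝ E3)).hasFDerivAt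
  rw [this.fderiv]
  fin_cases α <;> fin_cases i <;> simp [vec]
lemma D_t (α : Fin 4) (p : Pt) : Dop α (fun p : Pt => p.1) p = if α = 0 then 1 else 0 := by
  rw [Dop_eq]
  have : HasFDerivAt (fun p : Pt => p.1) (ContinuousLinearMap.fst ℝ ℝ E3) p := (ContinuousLinearMap.fst ℝ ℝ E3).hasFDerivAt
  rw [this.fderiv]
  fin_cases α <;> simp [vec]
lemma D_neg (k : Fin 4) : Dop k (fun p => - f p) = fun p => - Dop k f p := by
  funext p
  simp only [Dop_eq]
  rw [fderiv_fun_neg]; rfl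
lemma D_gc (k : Fin 8) (α β : Fin 4) : ∃ c : ℝ, |c| ≤ 1 ∧ Dop α (gc k β) = fun _ => c := by
  have h1 : ∀ i : Fin 3, ∃ c : ℝ, |c| ≤ 1 ∧ Dop α (fun p : Pt => p.2 i) = fun _ => c := fun i =>
    ⟨if α = i.succ then 1 else 0, by split_ifs <;> simp, funext (D_coord i α)⟩
  have h2 : ∀ i : Fin 3, ∃ c : ℝ, |c| ≤ 1 ∧ Dop α (fun p : Pt => - p.2 i) = fun _ => c := fun i => by
    obtain ⟨c, hc, h⟩ := h1 i
    exact ⟨-c, by simpa using hc, by rw [D_neg, h]⟩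
  have h3 : ∃ c : ℝ, |c| ≤ 1 ∧ Dop α (fun p : Pt => p.1) = fun _ => c := ⟨if α = 0 then 1 else 0, by split_ifs <;> simp, funext (D_t α)⟩
  have h4 : ∀ r : ℝ, ∃ c : ℝ, |c| ≤ 1 ∧ Dop α (fun _ : Pt => r) = fun _ => c := fun r =>
    ⟨0, by simp, D_const _ _⟩
  fin_cases k <;> fin_cases β <;>
    first | exact h4 _ | exact h1 _ | exact h2 _ | exact h3
lemma Sm.G (hf : Sm f) (k : Fin 8) : Sm (Gam k f) := by
  rw [show Gam k f = fun p => ∑ α, gc k α p * Dop α f p from funext (Gam_eq k f)]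
  exact ContDiff.sum fun α _ => (Sm_gc k α).mul (hf.D α)
lemma Sm.GW (hf : Sm f) (l : List (Fin 8)) : Sm (GamWord l f) := by
  induction l with
  | nil => exact hf
  | cons k l ih => exact ih.G k
lemma Sp.G {M : ℝ} {f : Fn} (h : Sp M f) (k : Fin 8) : Sp M (Gam k f) := by
  intro p hp hM
  rw [Gam_eq]
  exact Finset.sum_eq_zero fun α _ => by rw [h.D α p hp hM, mul_zero]
lemma Sp.GW {M : ℝ} {f : Fn} (h : Sp M f) (l : List (Fin 8)) : Sp M (GamWord l f) := by
  induction l with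
  | nil => exact h
  | cons k l ih => exact ih.G k
lemma G_mul (hf : Sm f) (hg : Sm g) (k : Fin 8) : Gam k (fun p => f p * g p) = fun p => Gam k f p * g p + f p * Gam k g p := by
  funext p
  simp only [Gam_eq, D_mul hf hg]
  rw [Finset.sum_mul, Finset.mul_sum, ← Finset.sum_add_distrib]
  exact Finset.sum_congr rfl fun α _ => by ring
lemma G_add (hf : Sm f) (hg : Sm g) (k : Fin 8) : Gam k (fun p => f p + g p) = fun p => Gam k f p + Gam k g p := by
  funext p
  simp only [Gam_eq, D_add hf hg]
  rw [← Finset.sum_add_distrib]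
  exact Finset.sum_congr rfl fun α _ => by ring
lemma G_cmul (hf : Sm f) (c : ℝ) (k : Fin 8) : Gam k (fun p => c * f p) = fun p => c * Gam k f p := by
  funext p
  simp only [Gam_eq, D_cmul hf]
  rw [Finset.mul_sum]
  exact Finset.sum_congr rfl fun α _ => by ring
lemma GW_add (hf : Sm f) (hg : Sm g) (l : List (Fin 8)) : GamWord l (fun p => f p + g p) = fun p => GamWord l f p + GamWord l g p := by
  induction l with
  | nil => rfl
  | cons k l ih => simp only [GamWord]; rw [ih, G_add (hf.GW l) (hg.GW l)]
lemma GW_cmul (hf : Sm f) (c : ℝ) (l : List (Fin 8)) : GamWord l (fun p => c * f p) = fun p => c * GamWord l f p := by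
  induction l with
  | nil => rfl
  | cons k l ih => simp only [GamWord]; rw [ih, G_cmul (hf.GW l)]
lemma GW_append (l m : List (Fin 8)) (f : Fn) : GamWord (l ++ m) f = GamWord l (GamWord m f) := by
  induction l with
  | nil => rfl
  | cons k l ih => simp only [List.cons_append, GamWord]; rw [ih]
lemma GW_sum {ι : Type*} (s : Finset ι) {f : ι → Fn} (hf : ∀ i, Sm (f i)) (l : List (Fin 8)) : GamWord l (fun p => ∑ i ∈ s, f i p) = fun p => ∑ i ∈ s, GamWord l (f i) p := by
  classical
  induction s using Finset.induction_on with
  | empty =>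
    simp only [Finset.sum_empty]
    have := GW_cmul (f := fun _ => 0) contDiff_const 0 l
    simp only [zero_mul] at this
    exact this
  | insert a s ha ih =>
    simp only [Finset.sum_insert ha]
    rw [GW_add (hf a) (ContDiff.sum fun i _ => hf i), ih]
lemma leibG (a : List (Fin 8)) : ∀ {F G : Fn} (_ : Sm F) (_ : Sm G) (p : Pt) (B : ℝ) (_ : ∀ b c : List (Fin 8), b.length + c.length = a.length → |GamWord b F p| * |GamWord c G p| ≤ B), |GamWord a (fun p => F p * G p) p| ≤ 2 ^ a.length * B := by
  induction a using List.reverseRecOn with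
  | nil =>
    intro F G hF hG p B h
    have := h [] [] rfl
    simpa [GamWord, abs_mul] using this
  | append_singleton l k ih =>
    intro F G hF hG p B h
    rw [GW_append]
    have e : GamWord [k] (fun p => F p * G p) = fun p => Gam k F p * G p + F p * Gam k G p := G_mul hF hG k
    rw [e, GW_add ((hF.G k).mul hG) (hF.mul (hG.G k))]
    have h1 := ih (hF.G k) hG p B (fun b c hbc => by
      have := h (b ++ [k]) c (by simp; omega)
      rwa [GW_append] at this)
    have h2 := ih hF (hG.G k) p B (fun b c hbc => by
      have := h b (c ++ [k]) (by simp; omega)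
      rwa [GW_append] at this)
    refine (abs_add_le _ _).trans ?_
    rw [List.length_append, pow_add]
    simp only [List.length_singleton]
    linarith
lemma supG {G : Fn} (hF : Sm F) (hG : Sm G) (p : Pt) (n : ℕ) {A B : ℝ} (hA : ∀ b : List (Fin 8), b.length ≤ n → |GamWord b F p| ≤ A) (hB : ∀ b : List (Fin 8), b.length ≤ n → |GamWord b G p| ≤ B) : ∀ a : List (Fin 8), a.length ≤ n → |GamWord a (fun p => F p * G p) p| ≤ 2 ^ n * (A * B) := by
  intro a ha
  have hA0 : 0 ≤ A := (abs_nonneg _).trans (hA [] (by simp))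
  have hB0 : 0 ≤ B := (abs_nonneg _).trans (hB [] (by simp))
  refine (leibG a hF hG p (A * B) fun b c h => ?_).trans ?_
  · exact mul_le_mul (hA b (by omega)) (hB c (by omega)) (abs_nonneg _) hA0
  · gcongr; norm_num
lemma comm_bound (c : List (Fin 8)) : ∀ {f : Fn} (_ : Sm f) (p : Pt) (B : ℝ) (α : Fin 4) (_ : ∀ (a : List (Fin 8)) (β : Fin 4), a.length ≤ c.length → |Dop β (GamWord a f) p| ≤ B), |GamWord c (Dop α f) p| ≤ 5 ^ c.length * B := by
  induction c using List.reverseRecOn with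
  | nil => intro f hf p B α h; simpa [GamWord] using h [] α (by simp)
  | append_singleton l k ih =>
    intro f hf p B α h
    choose cc hc1 hc2 using fun β => D_gc k α β
    have e : Gam k (Dop α f) = fun q => Dop α (Gam k f) q + ∑ β, (-cc β) * Dop β f q := by
      funext q
      have : Dop α (Gam k f) = fun q => ∑ β, (cc β * Dop β f q + gc k β q * Dop β (Dop α f) q) := by
        rw [show Gam k f = fun p => ∑ α, gc k α p * Dop α f p from funext (Gam_eq k f)]
        rw [D_sum _ fun β _ => (Sm_gc k β).mul (hf.D β)]
        funext q
        refine Finset.sum_congr rfl fun β _ => ?_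
        rw [D_mul (Sm_gc k β) (hf.D β), hc2 β, D_comm hf α β]
      rw [this, Gam_eq, ← Finset.sum_add_distrib]
      exact Finset.sum_congr rfl fun β _ => by ring
    rw [GW_append, show GamWord [k] (Dop α f) = Gam k (Dop α f) from rfl, e, GW_add ((hf.G k).D α) (ContDiff.sum fun β _ => contDiff_const.mul (hf.D β)), GW_sum _ fun β => contDiff_const.mul (hf.D β)]
    simp only [GW_cmul (hf.D _)]
    have h1 := ih (hf.G k) p B α (fun a β ha => by
      have := h (a ++ [k]) β (by simp; omega)
      rwa [GW_append] at this)
    have h2 : ∀ β, |(-cc β) * GamWord l (Dop β f) p| ≤ 5 ^ l.length * B := fun β => by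
      rw [abs_mul, abs_neg]
      refine (mul_le_of_le_one_left (abs_nonneg _) (hc1 β)).trans ?_
      exact ih hf p B β fun a β ha => h a β (by simp; omega)
    have h3 := (Finset.abs_sum_le_sum_abs (fun β => (-cc β) * GamWord l (Dop β f) p) (Finset.univ : Finset (Fin 4))).trans (Finset.sum_le_sum fun β _ => h2 β)
    simp only [Finset.sum_const, Finset.card_univ, Fintype.card_fin, nsmul_eq_mul] at h3
    refine (abs_add_le _ _).trans ?_
    rw [List.length_append, pow_add]
    simp only [List.length_singleton]
    push_cast at h3
    linarith
lemma D_scale (hg : Sm g) (s : ℝ) (α : Fin 4) : Dop α (fun p => g (s • p)) = fun p => s * Dop α g (s • p) := by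
  funext p
  simp only [Dop_eq]
  have h : HasFDerivAt (fun p : Pt => g (s • p)) ((fderiv ℝ g (s • p)).comp (s • ContinuousLinearMap.id ℝ Pt)) p := ((hg.da (s • p)).hasFDerivAt).comp p ((hasFDerivAt_id p).const_smul s)
  rw [h.fderiv]
  simp
lemma W_scale (hg : Sm g) (s : ℝ) (l : Wd) : DWord l (fun p => g (s • p)) = fun p => s ^ l.length * DWord l g (s • p) := by
  induction l with
  | nil => simp [DWord]
  | cons k l ih =>
    simp only [DWord]
    have : Sm (fun p => DWord l g (s • p)) := (hg.W l).comp (contDiff_id.const_smul s)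
    rw [ih, D_cmul this, D_scale (hg.W l)]
    funext p; simp only [List.length_cons]; ring
lemma G_scale (hg : Sm g) {s : ℝ} (hs : 0 < s) (k : Fin 8) : ∃ n : ℕ, Gam k (fun p => g (s • p)) = fun p => s ^ n * Gam k g (s • p) := by
  have e : ∀ p, Gam k (fun p => g (s • p)) p = ∑ α, gc k α p * (s * Dop α g (s • p)) := by
    intro p; rw [Gam_eq]; simp only [D_scale hg]
  refine ⟨if k.val < 4 then 1 else 0, ?_⟩
  funext p
  rw [e p, Gam_eq]
  fin_cases k <;> simp [gc, Fin.sum_univ_succ] <;> ring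
lemma GW_scale (hg : Sm g) {s : ℝ} (hs : 0 < s) (l : List (Fin 8)) : ∃ n : ℕ, GamWord l (fun p => g (s • p)) = fun p => s ^ n * GamWord l g (s • p) := by
  induction l with
  | nil => exact ⟨0, by simp [GamWord]⟩
  | cons k l ih =>
    obtain ⟨n, hn⟩ := ih
    obtain ⟨m, hm⟩ := G_scale (hg.GW l) hs k
    refine ⟨n + m, ?_⟩
    simp only [GamWord]
    have : Sm (fun p => GamWord l g (s • p)) := (hg.GW l).comp (contDiff_id.const_smul s)
    rw [hn, G_cmul this, hm]
    funext p; ring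
lemma words_finite (k : ℕ) (n : ℕ) : {l : List (Fin k) | l.length ≤ n}.Finite := List.finite_length_le (Fin k) n
lemma scaled_bound (hg : Sm g) (R : ℝ) (n : ℕ) : ∃ C : ℝ, 1 ≤ C ∧ ∀ t : ℝ, 1 ≤ t → ∀ x : E3, ‖x‖ ≤ R * t → (∀ l : List (Fin 8), l.length ≤ n → |GamWord l (fun p => g (t⁻¹ • p)) (t, x)| ≤ C) ∧ (∀ l : Wd, l.length ≤ n → |DWord l (fun p => g (t⁻¹ • p)) (t, x)| ≤ C * (t⁻¹) ^ l.length) := by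
  have hK : IsCompact (({1} : Set ℝ) ×ˢ Metric.closedBall (0 : E3) R) := isCompact_singleton.prod (isCompact_closedBall _ _)
  have b1 : ∀ l : List (Fin 8), ∃ C, ∀ p ∈ ({1} : Set ℝ) ×ˢ Metric.closedBall (0 : E3) R, ‖GamWord l g p‖ ≤ C := fun l => hK.exists_bound_of_continuousOn (hg.GW l).continuous.continuousOn
  have b2 : ∀ l : Wd, ∃ C, ∀ p ∈ ({1} : Set ℝ) ×ˢ Metric.closedBall (0 : E3) R, ‖DWord l g p‖ ≤ C := fun l => hK.exists_bound_of_continuousOn (hg.W l).continuous.continuousOn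
  choose C1 hC1 using b1
  choose C2 hC2 using b2
  obtain ⟨B1, hB1⟩ := ((words_finite 8 n).image C1).bddAbove
  obtain ⟨B2, hB2⟩ := ((words_finite 4 n).image C2).bddAbove
  refine ⟨max 1 (max B1 B2), le_max_left _ _, fun t ht x hx => ?_⟩
  have ht0 : 0 < t := by linarith
  have hs : 0 < t⁻¹ := by positivity
  have hs1 := inv_le_one_of_one_le₀ ht
  have hm : t⁻¹ • ((t, x) : Pt) ∈ ({1} : Set ℝ) ×ˢ Metric.closedBall (0 : E3) R := by
    constructor
    · simp [ht0.ne']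
    · simp only [Prod.smul_snd, mem_closedBall_zero_iff, norm_smul, norm_inv, norm_eq_abs, abs_of_pos ht0]
      rw [inv_mul_le_iff₀ ht0]; linarith
  constructor
  · intro l hl
    obtain ⟨m, hm'⟩ := GW_scale hg hs l
    rw [hm']
    simp only [abs_mul, abs_pow, abs_of_pos hs]
    refine (mul_le_of_le_one_left (abs_nonneg _) (pow_le_one₀ hs.le hs1)).trans ?_
    exact ((hC1 l _ hm).trans (hB1 ⟨l, hl, rfl⟩)).trans ((le_max_left _ _).trans (le_max_right _ _))
  · intro l hl
    rw [W_scale hg]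
    simp only [abs_mul, abs_pow, abs_of_pos hs]
    rw [mul_comm]
    refine mlr ?_ (by positivity)
    exact ((hC2 l _ hm).trans (hB2 ⟨l, hl, rfl⟩)).trans ((le_max_right _ _).trans (le_max_right _ _))
lemma mkp_deriv_a (k : Fin 3) {h : ℝ → ℝ} {h' a b : ℝ} (hh : HasDerivAt h h' a) {G : Fn} (hG : Sm G) : HasDerivAt (fun a => G (t, mkp k a b (h a))) (Dop (k.succAbove 0).succ G (t, mkp k a b (h a)) + h' * Ds k G (t, mkp k a b (h a))) a := by
  have h1 : HasDerivAt (fun a => ((t, mkp k a b (h a)) : Pt)) (0, EuclideanSpace.single (k.succAbove 0) 1 + h' • EuclideanSpace.single k (1:ℝ)) a := by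
    refine (hasDerivAt_const a t).prodMk ?_
    have e : (fun a => mkp k a b (h a)) = fun a =>
      a • EuclideanSpace.single (k.succAbove 0) (1:ℝ) + EuclideanSpace.single (k.succAbove 1) b + (h a) • EuclideanSpace.single k (1:ℝ) := by
      funext q; rw [mkp_eq]
      have h : ∀ (i : Fin 3) (r : ℝ), EuclideanSpace.single i r = r • (EuclideanSpace.single i (1:ℝ) : E3) := by
        intro i r; ext j; by_cases hj : j = i <;> simp [hj]
      rw [h _ q, h k]
    rw [e]
    have := (((hasDerivAt_id a).smul_const (EuclideanSpace.single (k.succAbove 0) (1:ℝ) : E3)).add_const (EuclideanSpace.single (k.succAbove 1) b)).fun_add (hh.smul_const (EuclideanSpace.single k (1:ℝ) : E3))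
    simpa using this
  have := (hG.da (t, mkp k a b (h a))).hasFDerivAt.comp_hasDerivAt a h1
  have e2 : Dop (k.succAbove 0).succ G (t, mkp k a b (h a)) + h' * Ds k G (t, mkp k a b (h a)) = (fderiv ℝ G (t, mkp k a b (h a))) (0, EuclideanSpace.single (k.succAbove 0) 1 + h' • EuclideanSpace.single k (1:ℝ)) := by
    rw [Dop_eq, Dop_eq, vec_succ, vec_succ, ← smul_eq_mul, ← map_smul, ← map_add]
    simp
  rw [e2]; exact this
lemma mkp_deriv_b (k : Fin 3) {h : ℝ → ℝ} {h' a b : ℝ} (hh : HasDerivAt h h' b) {G : Fn} (hG : Sm G) : HasDerivAt (fun b => G (t, mkp k a b (h b))) (Dop (k.succAbove 1).succ G (t, mkp k a b (h b)) + h' * Ds k G (t, mkp k a b (h b))) b := by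
  have h1 : HasDerivAt (fun b => ((t, mkp k a b (h b)) : Pt)) (0, EuclideanSpace.single (k.succAbove 1) 1 + h' • EuclideanSpace.single k (1:ℝ)) b := by
    refine (hasDerivAt_const b t).prodMk ?_
    have e : (fun b => mkp k a b (h b)) = fun b =>
      EuclideanSpace.single (k.succAbove 0) a + b • EuclideanSpace.single (k.succAbove 1) (1:ℝ) + (h b) • EuclideanSpace.single k (1:ℝ) := by
      funext q; rw [mkp_eq]
      have h : ∀ (i : Fin 3) (r : ℝ), EuclideanSpace.single i r = r • (EuclideanSpace.single i (1:ℝ) : E3) := by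
        intro i r; ext j; by_cases hj : j = i <;> simp [hj]
      rw [h _ q, h k]
    rw [e]
    have := (((hasDerivAt_id b).smul_const (EuclideanSpace.single (k.succAbove 1) (1:ℝ) : E3)).const_add (EuclideanSpace.single (k.succAbove 0) a)).fun_add (hh.smul_const (EuclideanSpace.single k (1:ℝ) : E3))
    simpa using this
  have := (hG.da (t, mkp k a b (h b))).hasFDerivAt.comp_hasDerivAt b h1
  have e2 : Dop (k.succAbove 1).succ G (t, mkp k a b (h b)) + h' * Ds k G (t, mkp k a b (h b)) = (fderiv ℝ G (t, mkp k a b (h b))) (0, EuclideanSpace.single (k.succAbove 1) 1 + h' • EuclideanSpace.single k (1:ℝ)) := by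
    rw [Dop_eq, Dop_eq, vec_succ, vec_succ, ← smul_eq_mul, ← map_smul, ← map_add]
    simp
  rw [e2]; exact this
lemma mkp_deriv_c (k : Fin 3) {a b c : ℝ} {G : Fn} (hG : Sm G) : HasDerivAt (fun c => G (t, mkp k a b c)) (Ds k G (t, mkp k a b c)) c := by
  have h1 : HasDerivAt (fun c => ((t, mkp k a b c) : Pt)) (0, EuclideanSpace.single k (1:ℝ)) c := by
    refine (hasDerivAt_const c t).prodMk ?_
    have e : (fun c => mkp k a b c) = fun c =>
      (EuclideanSpace.single (k.succAbove 0) a + EuclideanSpace.single (k.succAbove 1) b) + c • EuclideanSpace.single k (1:ℝ) := by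
      funext q; rw [mkp_eq]
      have h : ∀ (i : Fin 3) (r : ℝ), EuclideanSpace.single i r = r • (EuclideanSpace.single i (1:ℝ) : E3) := by
        intro i r; ext j; by_cases hj : j = i <;> simp [hj]
      rw [h k]
    show HasDerivAt (fun c => mkp k a b c) _ c
    rw [e]
    have := ((hasDerivAt_id c).smul_const (EuclideanSpace.single k (1:ℝ) : E3)).const_add (EuclideanSpace.single (k.succAbove 0) a + EuclideanSpace.single (k.succAbove 1) b)
    simpa using this
  have := (hG.da (t, mkp k a b c)).hasFDerivAt.comp_hasDerivAt c h1
  rw [Dop_eq, vec_succ]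
  exact this
lemma Sp_mkp (ht : 0 < t) {G : Fn} (h : Sp M G) (k i : Fin 3) (a b c : ℝ) (hi : |t| + |M| + 1 ≤ |mkp k a b c i|) : G (t, mkp k a b c) = 0 := by
  apply h _ ht
  have := abs_coord_le (mkp k a b c) i
  have h1 := le_abs_self t
  have h2 := le_abs_self M
  show t + M < ‖mkp k a b c‖
  linarith
lemma sob_core (ht : 0 < t) (k : Fin 3) {P P1 P2 : Fn} {h : ℝ → ℝ → ℝ} (hP2 : Sm P2) (sP : Sp M P) (sP1 : Sp M P1) (sP2 : Sp M P2) (h1 : ∀ a b, HasDerivAt (fun a => P (t, mkp k a b (h a b))) (P1 (t, mkp k a b (h a b))) a) (h2 : ∀ a b, HasDerivAt (fun b => P1 (t, mkp k a b (h a b))) (P2 (t, mkp k a b (h a b))) b) {Φ : E3 → ℝ} (hΦ : Continuous Φ) (hΦc : HasCompactSupport Φ) (hb : ∀ x, |Ds k P2 (t, x)| ≤ Φ x) (a b : ℝ) : |P (t, mkp k a b (h a b))| ≤ ∫ x, Φ x := by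
  have hR : 0 ≤ |t| + |M| + 1 := by positivity
  have hcont : Continuous (fun x : E3 => |Ds k P2 (t, x)|) := ((hP2.D _).continuous.comp (by fun_prop : Continuous fun x : E3 => ((t, x) : Pt))).abs
  have key := three_dim (P := fun a b c => P (t, mkp k a b c)) (P1 := fun a b c => P1 (t, mkp k a b c)) (P2 := fun a b c => P2 (t, mkp k a b c)) (P3 := fun a b c => Ds k P2 (t, mkp k a b c)) (h := h) hR h1 h2 (fun a b c => mkp_deriv_c k hP2) (fun a b c hh => Sp_mkp ht sP k (k.succAbove 0) a b c (by rwa [mkp_i])) (fun a b c hh => Sp_mkp ht sP1 k (k.succAbove 1) a b c (by rwa [mkp_j])) (fun a b c hh => Sp_mkp ht sP2 k k a b c (by rwa [mkp_k])) ((hP2.D _).continuous.comp (continuous_const.prodMk (mkp_cont k))) a b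
  refine key.trans ((triple_int k (F := fun x => |Ds k P2 (t, x)|) hcont ?_ (fun x => abs_nonneg _) _ hR).trans ?_)
  · have := (slice_cs (sP2.D k.succ) ht)
    exact this.comp_left (g := fun y => |y|) abs_zero
  · refine integral_mono (hcont.integrable_of_hasCompactSupport ?_) (hΦ.integrable_of_hasCompactSupport hΦc) hb
    exact (slice_cs (sP2.D k.succ) ht).comp_left (g := fun y => |y|) abs_zero
lemma sob_flat {M t : ℝ} (ht : 0 < t) {f : Fn} (hf : Sm f) (sf : Sp M f) {Φ : E3 → ℝ} (hΦ : Continuous Φ) (hΦc : HasCompactSupport Φ) (hb : ∀ c : Wd, c.length ≤ 3 → ∀ x, (DWord c f (t, x)) ^ 2 ≤ Φ x) (x : E3) : (f (t, x)) ^ 2 ≤ 8 * ∫ x, Φ x := by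
  have hF : Sm (fun p => f p * f p) := hf.mul hf
  have sF := sf.mul f
  have := sob_core (M := M) ht 0 (P := fun p => f p * f p) (h := fun _ _ => x 0) ((hF.D _).D _)
    sF (sF.D _) ((sF.D _).D _) (fun a b => by
      have := mkp_deriv_a 0 (h := fun _ => x 0) (b := b) (t := t) (hasDerivAt_const a (x 0)) hF
      simpa using this) (fun a b => by
      have := mkp_deriv_b 0 (h := fun _ => x 0) (a := a) (t := t) (hasDerivAt_const b (x 0)) (hF.D (Fin.succAbove (0:Fin 3) 0).succ)
      simpa using this) (Φ := fun x => 8 * Φ x) (hΦ.const_mul 8 |> fun h => by simpa using h) (hΦc.comp_left (g := fun y => 8 * y) (by simp)) (fun y => by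
      have := leib [Fin.succ 0, (Fin.succAbove (0:Fin 3) 1).succ, (Fin.succAbove (0:Fin 3) 0).succ]
        hf hf (t, y) (Φ y) (fun b c hbc => by
          simp only [List.length_cons, List.length_nil] at hbc
          have h1 := hb b (by omega) y
          have h2 := hb c (by omega) y
          nlinarith [sq_abs (DWord b f (t, y)), sq_abs (DWord c f (t, y))])
      simp only [List.length_cons, List.length_nil] at this
      norm_num at this
      exact this) (x (Fin.succAbove (0:Fin 3) 0)) (x (Fin.succAbove (0:Fin 3) 1))
  rw [mkp_self, integral_const_mul] at this
  rw [sq]; exact (le_abs_self _).trans this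
def mfn (s : ℝ) : ℝ := s * smoothTransition (32 * s - 1) + (1 - smoothTransition (32 * s - 1))
lemma mfn_pos (s : ℝ) : 0 < mfn s := by
  unfold mfn
  have h0 := smoothTransition.nonneg (32 * s - 1)
  have h1 := smoothTransition.le_one (32 * s - 1)
  by_cases hs : 32 * s - 1 ≤ 0
  · rw [smoothTransition.zero_of_nonpos hs]; norm_num
  · nlinarith
lemma mfn_eq {s : ℝ} (hs : 1/16 ≤ s) : mfn s = s := by
  unfold mfn
  rw [smoothTransition.one_of_one_le (by linarith)]; ring
lemma mfn_sm : ContDiff ℝ ((⊤ : ℕ∞) : WithTop ℕ∞) mfn := by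
  unfold mfn
  have : ContDiff ℝ ((⊤ : ℕ∞) : WithTop ℕ∞) (fun s : ℝ => smoothTransition (32 * s - 1)) := smoothTransition.contDiff.comp (by fun_prop)
  exact (contDiff_id.mul this).add (contDiff_const.sub this)
lemma rot_eq (k i : Fin 3) (hik : i ≠ k) : ∃ (g : Fin 8) (s : ℝ), (s = 1 ∨ s = -1) ∧ ∀ (f : Fn) (p : Pt), p.2 k * Ds i f p - p.2 i * Ds k f p = s * Gam g f p := by
  have : ∀ k i : Fin 3, i ≠ k → (k, i) ∈ ([(1,2),(2,0),(0,1),(2,1),(0,2),(1,0)] : List (Fin 3 × Fin 3)) := by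
    decide
  have h := this k i hik
  simp only [List.mem_cons, Prod.mk.injEq, List.not_mem_nil, or_false] at h
  rcases h with ⟨rfl, rfl⟩ | ⟨rfl, rfl⟩ | ⟨rfl, rfl⟩ | ⟨rfl, rfl⟩ | ⟨rfl, rfl⟩ | ⟨rfl, rfl⟩
  · exact ⟨4, 1, Or.inl rfl, fun f p => by simp only [← dxi_eq]; simp [Gam]⟩
  · exact ⟨5, 1, Or.inl rfl, fun f p => by simp only [← dxi_eq]; simp [Gam]⟩
  · exact ⟨6, 1, Or.inl rfl, fun f p => by simp only [← dxi_eq]; simp [Gam]⟩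
  · exact ⟨4, -1, Or.inr rfl, fun f p => by simp only [← dxi_eq]; simp [Gam]⟩
  · exact ⟨5, -1, Or.inr rfl, fun f p => by simp only [← dxi_eq]; simp [Gam]⟩
  · exact ⟨6, -1, Or.inr rfl, fun f p => by simp only [← dxi_eq]; simp [Gam]⟩
lemma D_zero_of_open {G : Fn} {U : Set Pt} (hU : IsOpen U) (h : ∀ p ∈ U, G p = 0) (hp : p ∈ U) (k : Fin 4) : Dop k G p = 0 := by
  have : G =ᶠ[nhds p] (fun _ => 0) := by
    filter_upwards [hU.mem_nhds hp] with q hq using h q hq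
  rw [Dop_eq, this.fderiv_eq]; simp
lemma ext_aux {σ r s0 : ℝ} (ht : 0 < t) (hσ : σ = 1 ∨ σ = -1) (k i : Fin 3) {c : ℝ → E3} (hck : ∀ s, c s k = σ * √(r - s ^ 2)) (hci : ∀ s, c s i = s) {G κ : Fn} (hG0 : ∀ p : Pt, σ * p.2 k < t / 16 → G p = 0) (hκ : ∀ x : E3, t / 16 ≤ σ * x k → κ (t, x) * x k = 1) (H : ∀ h', HasDerivAt (fun s => σ * √(r - s ^ 2)) h' s0 → HasDerivAt (fun s => G (t, c s)) (Ds i G (t, c s0) + h' * Ds k G (t, c s0)) s0) : HasDerivAt (fun s => G (t, c s)) (κ (t, c s0) * ((c s0) k * Ds i G (t, c s0) - (c s0) i * Ds k G (t, c s0))) s0 := by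
  have hσ2 : σ * σ = 1 := by rcases hσ with rfl | rfl <;> norm_num
  have hq : ∀ s, σ * (c s) k = √(r - s ^ 2) := fun s => by rw [hck, ← mul_assoc, hσ2, one_mul]
  by_cases hs : √(r - s0 ^ 2) < t / 16
  · have ho : IsOpen {p : Pt | σ * p.2 k < t / 16} := isOpen_lt (continuous_const.mul (Sm_coord k).continuous) continuous_const
    have hm : ((t, c s0) : Pt) ∈ {p : Pt | σ * p.2 k < t / 16} := by grind
    rw [D_zero_of_open ho hG0 hm, D_zero_of_open ho hG0 hm]
    simp only [mul_zero, sub_zero]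
    have : (fun s => G (t, c s)) =ᶠ[nhds s0] fun _ => 0 := by
      have hc : ContinuousAt (fun s => √(r - s ^ 2)) s0 := by fun_prop
      filter_upwards [hc.eventually_lt continuousAt_const hs] with s h
      apply hG0
      show σ * (c s) k < t / 16
      rw [hq]; exact h
    exact (hasDerivAt_const s0 (0:ℝ)).congr_of_eventuallyEq this
  · push Not at hs
    have hpos := lt_of_lt_of_le (by positivity) hs
    have hpos' : 0 < r - s0 ^ 2 := by rwa [Real.sqrt_pos] at hpos
    have hd : HasDerivAt (fun s => σ * √(r - s ^ 2)) (σ * ((-(2 * s0)) / (2 * √(r - s0 ^ 2)))) s0 := by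
      have h1 : HasDerivAt (fun s : ℝ => r - s ^ 2) (-(2 * s0)) s0 := by
        simpa using (hasDerivAt_pow 2 s0).const_sub r
      exact (h1.sqrt hpos'.ne').const_mul σ
    have h2 := H _ hd
    have hk := hκ (c s0) (by rw [hq]; exact hs)
    convert h2 using 1
    have e1 : κ (t, c s0) * (c s0) k * Ds i G (t, c s0) = Ds i G (t, c s0) := by
      rw [hk, one_mul]
    have e2 : κ (t, c s0) = σ / √(r - s0 ^ 2) := by
      rw [hck] at hk
      have : κ (t, c s0) * σ = 1 / √(r - s0 ^ 2) := by
        rw [eq_div_iff hpos.ne']; linarith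
      calc κ (t, c s0) = κ (t, c s0) * σ * σ := by rw [mul_assoc, hσ2, mul_one]
        _ = _ := by rw [this]; ring
    rw [mul_sub, ← mul_assoc, e1, hci, e2]
    field_simp
    ring
def cutE (k : Fin 3) (σ : ℝ) (p : Pt) : ℝ := smoothTransition (16 * (σ * p.2 k) - 1)
def invE (k : Fin 3) (σ : ℝ) (p : Pt) : ℝ := σ * (mfn (σ * p.2 k))⁻¹
lemma cutE_sm (k : Fin 3) (σ : ℝ) : Sm (cutE k σ) := smoothTransition.contDiff.comp ((contDiff_const.mul (contDiff_const.mul (Sm_coord k))).sub contDiff_const)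
lemma invE_sm (k : Fin 3) (σ : ℝ) : Sm (invE k σ) := contDiff_const.mul ((mfn_sm.comp (contDiff_const.mul (Sm_coord k))).inv (fun p => (mfn_pos _).ne'))
lemma Sm.scale (hg : Sm g) (s : ℝ) : Sm (fun p => g (s • p)) := hg.comp (contDiff_id.const_smul s)
lemma sob_ext_aux (M : ℝ) (hM : 0 < M) (k : Fin 3) (σ : ℝ) (hσ : σ = 1 ∨ σ = -1) : ∃ C : ℝ, 0 < C ∧ ∀ {t : ℝ} (_ : 1 ≤ t) {f : Fn} (_ : Sm f) (_ : Sp M f) {Φ : E3 → ℝ} (_ : Continuous Φ) (_ : HasCompactSupport Φ) (_ : ∀ c : List (Fin 8), c.length ≤ 3 → ∀ x, (GamWord c f (t, x)) ^ 2 ≤ Φ x) (x : E3) (_ : t / 8 ≤ σ * x k), t ^ 2 * (f (t, x)) ^ 2 ≤ C * ∫ x, Φ x := by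
  have hσ2 : σ * σ = 1 := by rcases hσ with rfl | rfl <;> norm_num
  obtain ⟨C1, hC1, b1⟩ := scaled_bound (cutE_sm k σ) (1 + M) 3
  obtain ⟨C2, hC2, b2⟩ := scaled_bound (invE_sm k σ) (1 + M) 3
  obtain ⟨g1, s1, hs1, hg1⟩ := rot_eq k (k.succAbove 0) (Fin.succAbove_ne k 0)
  obtain ⟨g2, s2, hs2, hg2⟩ := rot_eq k (k.succAbove 1) (Fin.succAbove_ne k 1)
  refine ⟨2 ^ 3 * (C2 * (2 ^ 3 * (C2 * (2 ^ 3 * (C1 * (2 ^ 3)))))), by positivity, ?_⟩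
  intro t ht f hf sf Φ hΦ hΦc hb x hx
  have ht0 : 0 < t := by linarith
  have hΦ0 : ∀ y, 0 ≤ Φ y := fun y => (sq_nonneg _).trans (hb [] (by simp) y)
  set η : Fn := fun p => cutE k σ (t⁻¹ • p) with hη
  set κ : Fn := fun p => invE k σ (t⁻¹ • p) with hκ
  have smη : Sm η := (cutE_sm k σ).scale _
  have smκ : Sm κ := (invE_sm k σ).scale _
  have hcoord : ∀ p : Pt, σ * (t⁻¹ • p).2 k = (σ * p.2 k) / t := fun p => by
    simp only [Prod.smul_snd, PiLp.smul_apply, smul_eq_mul]; field_simp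
  have hη0 : ∀ p : Pt, σ * p.2 k < t / 16 → η p = 0 := fun p hp => by
    simp only [hη, cutE, hcoord]
    apply smoothTransition.zero_of_nonpos
    have : (σ * p.2 k) / t < 1 / 16 := by rw [div_lt_iff₀ ht0]; linarith
    linarith
  have hη1 : η (t, x) = 1 := by
    simp only [hη, cutE, hcoord]
    apply smoothTransition.one_of_one_le
    have : 1 / 8 ≤ (σ * x k) / t := by rw [le_div_iff₀ ht0]; linarith
    linarith
  have hκ1 : ∀ y : E3, t / 16 ≤ σ * y k → (t⁻¹ * κ (t, y)) * y k = 1 := fun y hy => by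
    simp only [hκ, invE, hcoord]
    have h16 : 1 / 16 ≤ (σ * y k) / t := by rw [le_div_iff₀ ht0]; linarith
    rw [mfn_eq h16]
    have hne := (lt_of_lt_of_le (by positivity) hy).ne'
    have : y k ≠ 0 := right_ne_zero_of_mul hne
    have : σ ≠ 0 := left_ne_zero_of_mul hne
    field_simp
  set P : Fn := fun p => η p * (f p * f p) with hP
  set P1 : Fn := fun p => (t⁻¹ * s1) * (κ p * Gam g1 P p) with hP1
  set P2 : Fn := fun p => (t⁻¹ * s2) * (κ p * Gam g2 P1 p) with hP2
  have smP : Sm P := smη.mul (hf.mul hf)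
  have smQ : Sm (fun p => κ p * Gam g1 P p) := smκ.mul (smP.G g1)
  have smP1 : Sm P1 := contDiff_const.mul smQ
  have smQ2 : Sm (fun p => κ p * Gam g2 P1 p) := smκ.mul (smP1.G g2)
  have smP2 : Sm P2 := contDiff_const.mul smQ2
  have spP : Sp M P := (sf.mul f).mul' η
  have spP1 : Sp M P1 := ((spP.G g1).mul' κ).mul' _
  have spP2 : Sp M P2 := ((spP1.G g2).mul' κ).mul' _
  have zP : ∀ p : Pt, σ * p.2 k < t / 16 → P p = 0 := fun p hp => by
    simp only [hP, hη0 p hp, zero_mul]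
  have ho : IsOpen {p : Pt | σ * p.2 k < t / 16} := isOpen_lt (continuous_const.mul (Sm_coord k).continuous) continuous_const
  have zP1 : ∀ p : Pt, σ * p.2 k < t / 16 → P1 p = 0 := fun p hp => by
    simp only [hP1]
    have : Gam g1 P p = 0 := by
      rw [Gam_eq]
      exact Finset.sum_eq_zero fun α _ => by rw [D_zero_of_open ho zP hp, mul_zero]
    rw [this]; simp
  set q : ℝ := (x (k.succAbove 0)) ^ 2 + (x (k.succAbove 1)) ^ 2 + (x k) ^ 2
  set h : ℝ → ℝ → ℝ := fun a b => σ * √(q - b ^ 2 - a ^ 2) with hh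
  have d1 : ∀ a b, HasDerivAt (fun a => P (t, mkp k a b (h a b))) (P1 (t, mkp k a b (h a b))) a := by
    intro a b
    have := ext_aux (r := q - b ^ 2) (s0 := a) ht0 hσ k (k.succAbove 0) (c := fun a => mkp k a b (h a b)) (fun s => by rw [mkp_k]) (fun s => by rw [mkp_i]) (κ := fun p => t⁻¹ * κ p) zP hκ1 (fun h' hd => mkp_deriv_a k (h := fun a => h a b) hd smP)
    convert this using 1
    have e := hg1 P (t, mkp k a b (h a b))
    simp only at e
    rw [e]
    simp only [hP1]; ring
  have d2 : ∀ a b, HasDerivAt (fun b => P1 (t, mkp k a b (h a b))) (P2 (t, mkp k a b (h a b))) b := by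
    intro a b
    have := ext_aux (r := q - a ^ 2) (s0 := b) ht0 hσ k (k.succAbove 1) (c := fun b => mkp k a b (h a b)) (fun s => by rw [mkp_k]; simp only [hh]; ring_nf) (fun s => by rw [mkp_j]) (κ := fun p => t⁻¹ * κ p) zP1 hκ1 (fun h' hd => mkp_deriv_b k (h := fun b => h a b) (by
        convert hd using 2; simp only [hh]; ring_nf) smP1)
    convert this using 1
    have e := hg2 P1 (t, mkp k a b (h a b))
    simp only at e
    rw [e]
    simp only [hP2]; ring
  have key := sob_core (M := M) ht0 k (h := h) smP2 spP spP1 spP2 d1 d2 (Φ := fun y => (t⁻¹) ^ 2 * (2 ^ 3 * (C2 * (2 ^ 3 * (C2 * (2 ^ 3 * (C1 * (2 ^ 3 * Φ y)))))))) (by fun_prop) (hΦc.comp_left (g := fun y => (t⁻¹) ^ 2 * (2 ^ 3 * (C2 * (2 ^ 3 * (C2 * (2 ^ 3 * (C1 * (2 ^ 3 * y)))))))) (by simp))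
    ?_ (x (k.succAbove 0)) (x (k.succAbove 1))
  · have e : h (x (k.succAbove 0)) (x (k.succAbove 1)) = x k := by
      simp only [hh, q]
      rw [show (x (k.succAbove 0)) ^ 2 + (x (k.succAbove 1)) ^ 2 + (x k) ^ 2 - (x (k.succAbove 1)) ^ 2 - (x (k.succAbove 0)) ^ 2 = (σ * x k) ^ 2 by
          rw [mul_pow, sq σ, hσ2]; ring]
      rw [Real.sqrt_sq (le_trans (by positivity) hx), ← mul_assoc, hσ2, one_mul]
    rw [e, mkp_self] at key
    simp only [hP, hη1, one_mul] at key
    simp only [integral_const_mul] at key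
    have h3 := (le_abs_self _).trans key
    have h4 : t ^ 2 * (f (t, x)) ^ 2 ≤ t ^ 2 * ((t⁻¹) ^ 2 * (2 ^ 3 * (C2 * (2 ^ 3 * (C2 * (2 ^ 3 * (C1 * (2 ^ 3 * ∫ y, Φ y)))))))) := by
      rw [sq (f (t, x))]
      exact mll h3 (by positivity)
    refine h4.trans (le_of_eq ?_)
    field_simp
  · intro y
    by_cases hy : t + M < ‖y‖
    · rw [spP2.D k.succ _ ht0 hy, abs_zero]
      have := hΦ0 y
      positivity
    push Not at hy
    have hy' : ‖y‖ ≤ (1 + M) * t := by nlinarith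
    have bη := (b1 t ht y hy').1
    have bκ := (b2 t ht y hy').1
    have u1 : ∀ a : List (Fin 8), a.length ≤ 3 → |GamWord a (fun p => f p * f p) (t, y)| ≤ 2 ^ 3 * Φ y := by
      intro a ha
      refine (leibG a hf hf (t, y) (Φ y) fun b c hbc => ?_).trans ?_
      · have h1 := hb b (by omega) y
        have h2 := hb c (by omega) y
        nlinarith [sq_nonneg (|GamWord b f (t, y)| - |GamWord c f (t, y)|), sq_abs (GamWord b f (t, y)), sq_abs (GamWord c f (t, y))]
      · exact mlr (pow_le_pow_right₀ (by norm_num) ha) (hΦ0 y)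
    have u2 := supG smη (hf.mul hf) (t, y) 3 bη u1
    have u3 := supG smκ (smP.G g1) (t, y) 2 (fun b hb => bκ b (by omega)) (B := 2 ^ 3 * (C1 * (2 ^ 3 * Φ y))) (fun b hb => by
        have := u2 (b ++ [g1]) (by simp; omega)
        rwa [GW_append] at this)
    have u3' : ∀ a : List (Fin 8), a.length ≤ 2 → |GamWord a P1 (t, y)| ≤ t⁻¹ * (2 ^ 3 * (C2 * (2 ^ 3 * (C1 * (2 ^ 3 * Φ y))))) := fun a ha => by
      simp only [hP1]
      rw [GW_cmul smQ, abs_mul, abs_mul, abs_of_pos (inv_pos.2 ht0)]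
      have h1 : |s1| = 1 := by rcases hs1 with rfl | rfl <;> simp
      rw [h1, mul_one]
      refine mll ((u3 a ha).trans ?_) (by positivity)
      have := hΦ0 y
      gcongr <;> norm_num
    have u4 := supG smκ (smP1.G g2) (t, y) 1 (fun b hb => bκ b (by omega)) (B := t⁻¹ * (2 ^ 3 * (C2 * (2 ^ 3 * (C1 * (2 ^ 3 * Φ y)))))) (fun b hb => by
        have := u3' (b ++ [g2]) (by simp; omega)
        rwa [GW_append] at this)
    have u5 := u4 [k.succ.castLE (by norm_num)] (by simp)
    have ek : ∀ F : Fn, GamWord [k.succ.castLE (by norm_num)] F = Ds k F := by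
      intro F; fin_cases k <;> rfl
    rw [ek] at u5
    simp only [hP2]
    rw [D_cmul smQ2, abs_mul, abs_mul, abs_of_pos (inv_pos.2 ht0)]
    have h1 : |s2| = 1 := by rcases hs2 with rfl | rfl <;> simp
    rw [h1, mul_one]
    refine (mll u5 (by positivity)).trans ?_
    have := hΦ0 y
    have hX : 0 ≤ C2 * (2 ^ 3 * (C2 * (2 ^ 3 * (C1 * (2 ^ 3 * Φ y))))) := by positivity
    have hX2 : 0 ≤ t⁻¹ ^ 2 * (C2 * (2 ^ 3 * (C2 * (2 ^ 3 * (C1 * (2 ^ 3 * Φ y)))))) := by positivity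
    nlinarith
lemma sob_ext (M : ℝ) (hM : 0 < M) : ∃ C : ℝ, 0 < C ∧ ∀ {t : ℝ} (_ : 1 ≤ t) {f : Fn} (_ : Sm f) (_ : Sp M f) {Φ : E3 → ℝ} (_ : Continuous Φ) (_ : HasCompactSupport Φ) (_ : ∀ c : List (Fin 8), c.length ≤ 3 → ∀ x, (GamWord c f (t, x)) ^ 2 ≤ Φ x) (x : E3) (k : Fin 3) (_ : t / 8 ≤ |x k|), t ^ 2 * (f (t, x)) ^ 2 ≤ C * ∫ x, Φ x := by
  choose C1 hC1 h1 using fun k => sob_ext_aux M hM k 1 (Or.inl rfl)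
  choose C2 hC2 h2 using fun k => sob_ext_aux M hM k (-1) (Or.inr rfl)
  refine ⟨∑ k, (C1 k + C2 k), Finset.sum_pos (fun k _ => add_pos (hC1 k) (hC2 k)) ⟨0, Finset.mem_univ _⟩, ?_⟩
  intro t ht f hf sf Φ hΦ hΦc hb x k hk
  have hΦ0 : 0 ≤ ∫ y, Φ y := integral_nonneg fun y => (sq_nonneg _).trans (hb [] (by simp) y)
  have hle := Finset.single_le_sum (f := fun k => C1 k + C2 k) (fun k _ => (add_pos (hC1 k) (hC2 k)).le) (Finset.mem_univ k)
  rcases le_total 0 (x k) with h | h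
  · rw [abs_of_nonneg h] at hk
    refine (h1 k ht hf sf hΦ hΦc hb x (by linarith)).trans (mlr ?_ hΦ0)
    linarith [hC2 k]
  · rw [abs_of_nonpos h] at hk
    refine (h2 k ht hf sf hΦ hΦc hb x (by linarith)).trans (mlr ?_ hΦ0)
    linarith [hC1 k]
lemma W_zero (l : Wd) : DWord l (fun _ => (0:ℝ)) = fun _ => 0 := by
  induction l with
  | nil => rfl
  | cons k l ih => simp only [DWord]; rw [ih, D_const]
lemma W_const (c : ℝ) (l : Wd) (hl : 1 ≤ l.length) : DWord l (fun _ => c) = fun _ => 0 := by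
  cases l with
  | nil => simp at hl
  | cons k l => rw [W_cons contDiff_const, D_const, W_zero]
lemma Wt_le_one {a : ℝ} (ha : a ≤ 0) (hp : 0 < p.1) : Wt a p ≤ 1 := by
  have := Wt_mono ha hp.le; rwa [Wt_zero] at this
lemma one_le_Wt {a : ℝ} (ha : 0 ≤ a) (hp : 0 < p.1) : 1 ≤ Wt a p := by
  have := Wt_mono ha hp.le; rwa [Wt_zero] at this
lemma Wt_neg (a : ℝ) (p : Pt) : Wt (-a) p = (Wt a p)⁻¹ := Real.rpow_neg (tau_pos p).le a
def mc (lam c μ : ℝ) (p : Pt) : ℝ := c * Wt (lam - 1) p + μ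
lemma mc_sm (lam c μ : ℝ) : Sm (mc lam c μ) := (contDiff_const.mul (Wt_sm _)).add contDiff_const
lemma mc_bound (lam c μ : ℝ) (h1 : lam ≤ 1) (N : ℕ) : ∃ C ≥ 1, ∀ l : Wd, l.length ≤ N →
    ∀ p : Pt, 0 < p.1 → |DWord l (mc lam c μ) p| ≤ C ∧
      (1 ≤ l.length → |DWord l (mc lam c μ) p| ≤ C * Wt (-1) p) := by
  obtain ⟨C0, hC0, h⟩ := W_Wt' (lam - 1) N
  refine ⟨|c| * C0 + |μ| + 1, by nlinarith [abs_nonneg c, abs_nonneg μ], fun l hl p hp => ?_⟩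
  have e : DWord l (mc lam c μ) p = c * DWord l (Wt (lam - 1)) p + DWord l (fun _ => μ) p := by
    unfold mc
    rw [W_add (contDiff_const.mul (Wt_sm _)) contDiff_const, W_cmul (Wt_sm _)]
  have hb := h l hl p hp
  have hlen : (0:ℝ) ≤ l.length := by positivity
  have k1 : |c * DWord l (Wt (lam - 1)) p| ≤ |c| * C0 * Wt (lam - 1 - l.length) p := by
    rw [abs_mul, mul_assoc]; exact mll hb (abs_nonneg _)
  have hcC : 0 ≤ |c| * C0 := by positivity
  have k2 : 1 ≤ l.length → |DWord l (mc lam c μ) p| ≤ (|c| * C0 + |μ| + 1) * Wt (-1) p := by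
    intro h1'
    rw [e, W_const μ l h1', add_zero]
    have : (1:ℝ) ≤ l.length := by exact_mod_cast h1'
    have k3 := Wt_mono (a := lam - 1 - l.length) (b := -1) (by linarith) hp.le
    have := Wt_pos (-1) p
    have hμ := abs_nonneg μ
    nlinarith [mll k3 hcC]
  refine ⟨?_, k2⟩
  rcases Nat.eq_zero_or_pos l.length with h0 | h0
  · rw [List.length_eq_zero_iff] at h0
    subst h0
    rw [e]
    refine (abs_add_le _ _).trans ?_
    have k3 := Wt_le_one (a := lam - 1 - ([] : Wd).length) (by simp; linarith) hp
    simp only [DWord] at *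
    nlinarith [mll k3 hcC]
  · refine (k2 h0).trans ?_
    have := Wt_le_one (a := -1) (by norm_num) hp
    exact mul_le_of_le_one_right (by positivity) this
structure PH (N L : ℕ) (lam : ℝ) (ψ : Fn) (p : Pt) (e q Y : ℝ) : Prop where
  hp : 0 < p.1
  e0 : 0 ≤ e
  e1 : e ≤ 1
  qW : (Wt lam p)⁻¹ ≤ q
  q1 : q ≤ 1
  Y0 : 0 ≤ Y
  b0 : |ψ p| ≤ e
  b1 : ∀ b : Wd, 1 ≤ b.length → b.length ≤ L → |DWord b ψ p| ≤ e / Wt lam p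
  b2 : ∀ b : Wd, 2 ≤ b.length → b.length ≤ L → |DWord b ψ p| ≤ e / Wt lam p * q
  b3 : ∀ b : Wd, 1 ≤ b.length → b.length ≤ N + 1 → |DWord b ψ p| ≤ Y
  hL : N / 2 + 1 ≤ L
  hL' : L ≤ N + 1
structure Cl (N L : ℕ) (lam : ℝ) (p : Pt) (e q Y C : ℝ) (F : Fn) : Prop where
  sm : Sm F
  c0 : |F p| ≤ C * e
  c1 : ∀ b : Wd, 1 ≤ b.length → b.length + 1 ≤ L → |DWord b F p| ≤ C * (e * q)
  c2 : ∀ b : Wd, 1 ≤ b.length → b.length ≤ N → |DWord b F p| ≤ C * (Wt lam p * Y + e * q)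
lemma PH.q0 {e q Y : ℝ} (h : PH N L lam ψ p e q Y) : 0 < q := lt_of_lt_of_le (inv_pos.2 (Wt_pos _ _)) h.qW
lemma Cl.add {e q Y C C' : ℝ} {F' : Fn} (h : Cl N L lam p e q Y C F) (h' : Cl N L lam p e q Y C' F') : Cl N L lam p e q Y (C + C') (fun p => F p + F' p) where
  sm := h.sm.add h'.sm
  c0 := (abs_add_le _ _).trans (by linarith [h.c0, h'.c0])
  c1 := fun b h1 h2 => by
    rw [W_add h.sm h'.sm]
    exact (abs_add_le _ _).trans (by linarith [h.c1 b h1 h2, h'.c1 b h1 h2])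
  c2 := fun b h1 h2 => by
    rw [W_add h.sm h'.sm]
    exact (abs_add_le _ _).trans (by linarith [h.c2 b h1 h2, h'.c2 b h1 h2])
lemma Cl.cmul {e q Y C : ℝ} (h : Cl N L lam p e q Y C F) (r : ℝ) : Cl N L lam p e q Y (|r| * C) (fun p => r * F p) where
  sm := contDiff_const.mul h.sm
  c0 := by rw [abs_mul, mul_assoc]; exact mll h.c0 (abs_nonneg _)
  c1 := fun b h1 h2 => by
    rw [W_cmul h.sm, abs_mul, mul_assoc]; exact mll (h.c1 b h1 h2) (abs_nonneg _)
  c2 := fun b h1 h2 => by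
    rw [W_cmul h.sm, abs_mul, mul_assoc]; exact mll (h.c2 b h1 h2) (abs_nonneg _)
lemma Cl.zero {e q Y : ℝ} (h : PH N L lam ψ p e q Y) (C : ℝ) (hC : 0 ≤ C) : Cl N L lam p e q Y C (fun _ => 0) where
  sm := contDiff_const
  c0 := by rw [abs_zero]; exact mul_nonneg hC h.e0
  c1 := fun b h1 h2 => by
    rw [W_zero, abs_zero]; exact mul_nonneg hC (mul_nonneg h.e0 h.q0.le)
  c2 := fun b h1 h2 => by
    rw [W_zero, abs_zero]
    exact mul_nonneg hC (add_nonneg (mul_nonneg (Wt_pos _ _).le h.Y0) (mul_nonneg h.e0 h.q0.le))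
lemma Cl.mono {e q Y C C' : ℝ} (H : PH N L lam ψ p e q Y) (h : Cl N L lam p e q Y C F) (hC : C ≤ C') : Cl N L lam p e q Y C' F where
  sm := h.sm
  c0 := h.c0.trans (mlr hC H.e0)
  c1 := fun b h1 h2 => (h.c1 b h1 h2).trans (mlr hC (mul_nonneg H.e0 H.q0.le))
  c2 := fun b h1 h2 => (h.c2 b h1 h2).trans (mlr hC (add_nonneg (mul_nonneg (Wt_pos _ _).le H.Y0) (mul_nonneg H.e0 H.q0.le)))
lemma Cl.mul {e q Y C C' : ℝ} {F' : Fn} (H : PH N L lam ψ p e q Y) (h : Cl N L lam p e q Y C F) (h' : Cl N L lam p e q Y C' F') (hC : 0 ≤ C) (hC' : 0 ≤ C') : Cl N L lam p e q Y (2 ^ (N + 1) * (C * C')) (fun p => F p * F' p) := by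
  have hCC := mul_nonneg hC hC'
  have hq0 := H.q0.le
  have hq1 := H.q1
  have he0 := H.e0
  have he1 := H.e1
  have hY := H.Y0
  have hW := (Wt_pos lam p).le
  have hp2 : (1:ℝ) ≤ 2 ^ (N + 1) := one_le_pow₀ (by norm_num)
  set X := Wt lam p * Y + e * q with hX
  have hX0 : 0 ≤ X := by positivity
  have heq := mul_le_one₀ he1 hq0 hq1
  refine ⟨h.sm.mul h'.sm, ?_, ?_, ?_⟩
  · rw [abs_mul]
    have h1 := mul_le_mul h.c0 h'.c0 (abs_nonneg _) (by positivity)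
    have h2 : C * e * (C' * e) ≤ C * C' * e := by
      have : C * C' * (e * e) ≤ C * C' * (e * 1) := by gcongr
      linarith
    have h3 : C * C' * e ≤ 2 ^ (N + 1) * (C * C' * e) := le_mul_of_one_le_left (by positivity) hp2
    linarith
  · intro b hb1 hb2
    have hbN : b.length ≤ N + 1 := by have := H.hL'; omega
    refine (leib b h.sm h'.sm p (C * C' * (e * q)) fun c d hcd => ?_).trans ?_
    · have bd : ∀ (F : Fn) (C : ℝ), 0 ≤ C → Cl N L lam p e q Y C F → ∀ c : Wd, c.length ≤ b.length → |DWord c F p| ≤ C * e := by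
        intro F C hC h c hc
        rcases Nat.eq_zero_or_pos c.length with h0 | h0
        · rw [List.length_eq_zero_iff] at h0; subst h0; exact h.c0
        · refine (h.c1 c h0 (by omega)).trans ?_
          exact mll (mul_le_of_le_one_right he0 hq1) hC
      rcases Nat.eq_zero_or_pos c.length with h0 | h0
      · have h1 := mul_le_mul (bd F C hC h c (by omega)) (h'.c1 d (by omega) (by omega)) (abs_nonneg _) (by positivity)
        refine h1.trans ?_
        calc C * e * (C' * (e * q)) = (C * C' * (e * q)) * e := by ring
          _ ≤ (C * C' * (e * q)) * 1 := by gcongr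
          _ = _ := by ring
      · have h1 := mul_le_mul (h.c1 c (by omega) (by omega)) (bd F' C' hC' h' d (by omega)) (abs_nonneg _) (by positivity)
        refine h1.trans ?_
        calc C * (e * q) * (C' * e) = (C * C' * (e * q)) * e := by ring
          _ ≤ (C * C' * (e * q)) * 1 := by gcongr
          _ = _ := by ring
    · rw [mul_assoc (2 ^ (N+1))]
      exact mlr (pow_le_pow_right₀ (by norm_num) hbN) (by positivity)
  · intro b hb1 hb2
    refine (leib b h.sm h'.sm p (C * C' * X) fun c d hcd => ?_).trans ?_
    · have lo : ∀ (F : Fn) (C : ℝ), 0 ≤ C → Cl N L lam p e q Y C F → ∀ c : Wd, c.length ≤ N / 2 → |DWord c F p| ≤ C := by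
        intro F C hC h c hc
        rcases Nat.eq_zero_or_pos c.length with h0 | h0
        · rw [List.length_eq_zero_iff] at h0; subst h0; exact h.c0.trans (mul_le_of_le_one_right hC he1)
        · have := H.hL
          exact (h.c1 c h0 (by omega)).trans (mul_le_of_le_one_right hC heq)
      rcases le_total c.length d.length with h0 | h0
      · have h1 := mul_le_mul (lo F C hC h c (by omega)) (h'.c2 d (by omega) (by omega)) (abs_nonneg _) hC
        refine h1.trans (le_of_eq (by ring))
      · have h1 := mul_le_mul (h.c2 c (by omega) (by omega)) (lo F' C' hC' h' d (by omega)) (abs_nonneg _) (by positivity)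
        refine h1.trans (le_of_eq (by ring))
    · rw [mul_assoc (2 ^ (N+1))]
      exact mlr (pow_le_pow_right₀ (by norm_num) (by omega)) (by positivity)
lemma Wt_word (lam : ℝ) (h1 : lam ≤ 1) (N : ℕ) : ∃ C ≥ 1, ∀ l : Wd, l.length ≤ N → ∀ p : Pt, 0 < p.1 → |DWord l (Wt lam) p| ≤ C * Wt lam p ∧ (1 ≤ l.length → |DWord l (Wt lam) p| ≤ C) := by
  obtain ⟨C0, hC0, h⟩ := W_Wt' lam N
  refine ⟨C0, hC0, fun l hl p hp => ⟨(h l hl p hp).trans ?_, fun h0 => (h l hl p hp).trans ?_⟩⟩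
  · have : (0:ℝ) ≤ l.length := by positivity
    exact mll (Wt_mono (by linarith) hp.le) (by linarith)
  · have : (1:ℝ) ≤ l.length := by exact_mod_cast h0
    exact mul_le_of_le_one_right (by linarith) (Wt_le_one (by linarith) hp)
lemma clA (lam : ℝ) (h1 : lam ≤ 1) (N L : ℕ) : ∃ C ≥ 1, ∀ (ψ : Fn) (p : Pt) (e q Y : ℝ), Sm ψ → PH N L lam ψ p e q Y → ∀ α, Cl N L lam p e q Y C (fun p => Wt lam p * Dop α ψ p) := by
  obtain ⟨C0, hC0, h⟩ := Wt_word lam h1 (N + 1)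
  have hC0' : 0 ≤ C0 := by linarith
  refine ⟨2 ^ (N + 1) * C0, ?_, fun ψ p e q Y hψ H α => ?_⟩
  · have : (1:ℝ) ≤ 2 ^ (N + 1) := one_le_pow₀ (by norm_num)
    nlinarith
  have hW := Wt_pos lam p
  have hq0 := H.q0.le
  have he0 := H.e0
  have hY := H.Y0
  have hL := H.hL
  have hL' := H.hL'
  have ew : ∀ b : Wd, DWord b (Dop α ψ) = DWord (α :: b) ψ := fun b => (W_cons hψ α b).symm
  refine ⟨(Wt_sm lam).mul (hψ.D α), ?_, ?_, ?_⟩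
  · have hh := H.b1 [α] (by simp) (by simp; omega)
    rw [abs_mul, abs_of_pos hW]
    calc Wt lam p * |Dop α ψ p| ≤ Wt lam p * (e / Wt lam p) := mll hh hW.le
      _ = 1 * e := by field_simp
      _ ≤ _ := by
        refine mlr ?_ he0
        have : (1:ℝ) ≤ 2 ^ (N + 1) := one_le_pow₀ (by norm_num)
        nlinarith
  · intro b hb1 hb2
    refine (leib b (Wt_sm lam) (hψ.D α) p (C0 * (e * q)) fun c d hcd => ?_).trans ?_
    · rw [ew]
      rcases Nat.eq_zero_or_pos c.length with h0 | h0
      · have h1 := mul_le_mul (h c (by omega) p H.hp).1 (H.b2 (α :: d) (by simp; omega) (by simp; omega)) (abs_nonneg _) (by positivity)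
        refine h1.trans (le_of_eq ?_)
        field_simp
      · have h1 := mul_le_mul ((h c (by omega) p H.hp).2 h0) (H.b1 (α :: d) (by simp) (by simp; omega)) (abs_nonneg _) (by positivity)
        refine h1.trans (mll ?_ hC0')
        rw [div_eq_mul_inv]
        exact mll H.qW he0
    · rw [mul_assoc (2 ^ (N+1))]
      exact mlr (pow_le_pow_right₀ (by norm_num) (by omega)) (by positivity)
  · intro b hb1 hb2
    refine (leib b (Wt_sm lam) (hψ.D α) p (C0 * (Wt lam p * Y + e * q)) fun c d hcd => ?_).trans ?_
    · rw [ew]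
      have h1 := mul_le_mul (h c (by omega) p H.hp).1 (H.b3 (α :: d) (by simp) (by simp; omega)) (abs_nonneg _) (by positivity)
      refine h1.trans ?_
      have : 0 ≤ C0 * (e * q) := by positivity
      linarith
    · rw [mul_assoc (2 ^ (N+1))]
      exact mlr (pow_le_pow_right₀ (by norm_num) (by omega)) (by positivity)
lemma clB (lam c μ : ℝ) (h1 : lam ≤ 1) (N L : ℕ) : ∃ C ≥ 1, ∀ (ψ : Fn) (p : Pt) (e q Y : ℝ), Sm ψ → 0 ≤ lam → PH N L lam ψ p e q Y → Cl N L lam p e q Y C (fun p => mc lam c μ p * ψ p) := by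
  obtain ⟨C0, hC0, h⟩ := mc_bound lam c μ h1 (N + 1)
  have hC0' : 0 ≤ C0 := by linarith
  have hp2 : (1:ℝ) ≤ 2 ^ (N + 1) := one_le_pow₀ (by norm_num)
  refine ⟨2 ^ (N + 1) * C0, ?_, fun ψ p e q Y hψ hl0 H => ?_⟩
  · nlinarith
  have hW := Wt_pos lam p
  have hq0 := H.q0.le
  have he0 := H.e0
  have hY := H.Y0
  have hL := H.hL
  have hL' := H.hL'
  have hW1 : 1 ≤ Wt lam p := one_le_Wt hl0 H.hp
  have ht : Wt (-1) p ≤ q := by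
    refine le_trans (Wt_mono (b := -lam) (by linarith) H.hp.le) ?_
    rw [Wt_neg]; exact H.qW
  have heW : e / Wt lam p ≤ e * q := by
    rw [div_eq_mul_inv]; exact mll H.qW he0
  have hbe : ∀ d : Wd, d.length ≤ L → |DWord d ψ p| ≤ e := by
    intro d hd
    rcases Nat.eq_zero_or_pos d.length with h0 | h0
    · rw [List.length_eq_zero_iff] at h0; subst h0; exact H.b0
    · exact (H.b1 d h0 hd).trans (div_le_self he0 hW1)
  refine ⟨(mc_sm _ _ _).mul hψ, ?_, ?_, ?_⟩
  · rw [abs_mul]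
    have h3 := mul_le_mul (h [] (by simp) p H.hp).1 H.b0 (abs_nonneg _) hC0'
    simp only [DWord] at h3
    refine h3.trans (mlr ?_ he0)
    nlinarith
  · intro b hb1 hb2
    refine (leib b (mc_sm _ _ _) hψ p (C0 * (e * q)) fun c d hcd => ?_).trans ?_
    · rcases Nat.eq_zero_or_pos c.length with h0 | h0
      · exact mul_le_mul (h c (by omega) p H.hp).1 ((H.b1 d (by omega) (by omega)).trans heW) (abs_nonneg _) (by positivity)
      · have h1 := mul_le_mul ((h c (by omega) p H.hp).2 h0) (hbe d (by omega)) (abs_nonneg _) (mul_nonneg hC0' (Wt_pos _ _).le)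
        refine h1.trans ?_
        have : C0 * Wt (-1) p * e ≤ C0 * q * e := by gcongr
        linarith
    · rw [mul_assoc (2 ^ (N+1))]
      exact mlr (pow_le_pow_right₀ (by norm_num) (by omega)) (by positivity)
  · intro b hb1 hb2
    refine (leib b (mc_sm _ _ _) hψ p (C0 * (Wt lam p * Y + e * q)) fun c d hcd => ?_).trans ?_
    · rcases Nat.eq_zero_or_pos d.length with h0 | h0
      · have h1 := mul_le_mul ((h c (by omega) p H.hp).2 (by omega)) (hbe d (by omega)) (abs_nonneg _) (mul_nonneg hC0' (Wt_pos _ _).le)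
        refine h1.trans ?_
        have : C0 * Wt (-1) p * e ≤ C0 * q * e := by gcongr
        have : 0 ≤ C0 * (Wt lam p * Y) := by positivity
        linarith
      · have h1 := mul_le_mul (h c (by omega) p H.hp).1 (H.b3 d h0 (by omega)) (abs_nonneg _) hC0'
        refine h1.trans ?_
        have : C0 * (1 * Y) ≤ C0 * (Wt lam p * Y) := by gcongr
        have : 0 ≤ C0 * (e * q) := by positivity
        linarith
    · rw [mul_assoc (2 ^ (N+1))]
      exact mlr (pow_le_pow_right₀ (by norm_num) (by omega)) (by positivity)
def gA (lam : ℝ) (ψ : Fn) (i : Fin 3) (p : Pt) : ℝ := Wt lam p * Ds i ψ p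
def g0 (μ lam γ : ℝ) (ψ : Fn) (p : Pt) : ℝ := (-(γ - 1)) * ((Wt lam p * Dop 0 ψ p + mc lam lam μ p * ψ p) + (1 / 2) * (gA lam ψ 0 p * gA lam ψ 0 p + (gA lam ψ 1 p * gA lam ψ 1 p + gA lam ψ 2 p * gA lam ψ 2 p)))
def gij (μ lam γ : ℝ) (ψ : Fn) (i j : Fin 3) (p : Pt) : ℝ := (if i = j then 1 else 0) * g0 μ lam γ ψ p + (-1) * (gA lam ψ i p * gA lam ψ j p)
def gi (lam : ℝ) (ψ : Fn) (i : Fin 3) (p : Pt) : ℝ := (-2) * gA lam ψ i p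
lemma cl_coef (μ lam γ : ℝ) (hl0 : 0 ≤ lam) (h1 : lam ≤ 1) (N L : ℕ) : ∃ C ≥ 1, ∀ (ψ : Fn) (p : Pt) (e q Y : ℝ), Sm ψ → PH N L lam ψ p e q Y → (∀ i j, Cl N L lam p e q Y C (gij μ lam γ ψ i j)) ∧ (∀ i, Cl N L lam p e q Y C (gi lam ψ i)) ∧ (∀ i, Cl N L lam p e q Y C (gA lam ψ i)) := by
  obtain ⟨C1, hC1, hA⟩ := clA lam h1 N L
  obtain ⟨C2, hC2, hB⟩ := clB lam lam μ h1 N L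
  have hp2 : (1:ℝ) ≤ 2 ^ (N + 1) := one_le_pow₀ (by norm_num)
  set P := 2 ^ (N + 1) * (C1 * C1) with hP
  have hP0 : 1 ≤ P := one_le_mul_of_one_le_of_one_le hp2 (one_le_mul_of_one_le_of_one_le hC1 hC1)
  set G := |-(γ - 1)| * ((C1 + C2) + |(1:ℝ)/2| * (P + (P + P))) with hG
  have hG0 : 0 ≤ G := by positivity
  refine ⟨G + P + |(-2:ℝ)| * C1, by have : 0 ≤ |(-2:ℝ)| * C1 := by positivity
                                    linarith, fun ψ p e q Y hψ H => ?_⟩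
  have hC10 : 0 ≤ C1 := by linarith
  have a := fun i : Fin 3 => hA ψ p e q Y hψ H i.succ
  have pr := fun i j : Fin 3 => Cl.mul H (a i) (a j) hC10 hC10
  have hg0 : Cl N L lam p e q Y G (g0 μ lam γ ψ) := Cl.cmul (((hA ψ p e q Y hψ H 0).add (hB ψ p e q Y hψ hl0 H)).add (Cl.cmul ((pr 0 0).add ((pr 1 1).add (pr 2 2))) (1/2))) _
  have h2C : 0 ≤ |(-2:ℝ)| * C1 := by positivity
  refine ⟨fun i j => ?_, fun i => ?_, fun i => (a i).mono H ?_⟩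
  · refine Cl.mono H ((hg0.cmul (if i = j then 1 else 0)).add ((pr i j).cmul (-1))) ?_
    have : |(if i = j then (1:ℝ) else 0)| * G ≤ 1 * G := by
      refine mlr ?_ hG0
      split_ifs <;> simp
    rw [abs_neg, abs_one]
    linarith
  · refine Cl.mono H ((a i).cmul (-2)) ?_
    linarith
  · nlinarith
def gab (μ lam γ : ℝ) (ψ : Fn) (α β : Fin 4) : Fn := Fin.cases (fun _ => 0) (fun i => Fin.cases (gi lam ψ i) (fun j => gij μ lam γ ψ i j) β) α
lemma cl_gab (μ lam γ : ℝ) (hl0 : 0 ≤ lam) (h1 : lam ≤ 1) (N L : ℕ) : ∃ C ≥ 1, ∀ (ψ : Fn) (p : Pt) (e q Y : ℝ), Sm ψ → PH N L lam ψ p e q Y → (∀ α β, Cl N L lam p e q Y C (gab μ lam γ ψ α β)) := by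
  obtain ⟨C, hC, h⟩ := cl_coef μ lam γ hl0 h1 N L
  refine ⟨C, hC, fun ψ p e q Y hψ H α β => ?_⟩
  obtain ⟨a1, a2, _⟩ := h ψ p e q Y hψ H
  refine Fin.cases ?_ (fun i => ?_) α
  · exact Cl.zero H C (by linarith)
  · refine Fin.cases ?_ (fun j => ?_) β
    · exact a2 i
    · exact a1 i j
def cf (μ lam : ℝ) (p : Pt) : ℝ := μ * Wt (-lam) p + 2 * lam * Wt (-1) p
def cz (lam : ℝ) (p : Pt) : ℝ := lam * (1 - lam) * Wt (-2) p
lemma gA_sm (h : Sm ψ) (i : Fin 3) : Sm (gA lam ψ i) := (Wt_sm lam).mul (h.D _)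
lemma gab_sm (h : Sm ψ) (α β : Fin 4) : Sm (gab μ lam γ ψ α β) := by
  have g0s : Sm (g0 μ lam γ ψ) := by
    unfold g0
    exact contDiff_const.mul ((((Wt_sm lam).mul (h.D _)).add ((mc_sm _ _ _).mul h)).add (contDiff_const.mul (((gA_sm h 0).mul (gA_sm h 0)).add (((gA_sm h 1).mul (gA_sm h 1)).add ((gA_sm h 2).mul (gA_sm h 2))))))
  refine Fin.cases ?_ (fun i => ?_) α
  · exact contDiff_const
  · refine Fin.cases ?_ (fun j => ?_) β
    · exact contDiff_const.mul (gA_sm h i)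
    · exact (contDiff_const.mul g0s).add (contDiff_const.mul ((gA_sm h i).mul (gA_sm h j)))
lemma cf_sm (μ lam : ℝ) : Sm (cf μ lam) := (contDiff_const.mul (Wt_sm _)).add (contDiff_const.mul (Wt_sm _))
lemma cz_sm (lam : ℝ) : Sm (cz lam) := contDiff_const.mul (Wt_sm _)
def EqU (μ lam γ : ℝ) (ψ : Fn) : Prop := ∀ p : Pt, 0 < p.1 → Dop 0 (Dop 0 ψ) p - ∑ i : Fin 3, Ds i (Ds i ψ) p = (∑ α, ∑ β, gab μ lam γ ψ α β p * Dop α (Dop β ψ) p) + (-1) * (cf μ lam p * Dop 0 ψ p) + cz lam p * ψ p + (-1) * (∑ i : Fin 3, mc lam (2 * lam) μ p * (Ds i ψ p * Ds i ψ p))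
lemma eqU_of (hψ : Sm ψ) (h : psiEq μ lam γ ψ) : EqU μ lam γ ψ := by
  intro p hp
  have e := h p hp.le
  have hp1 : 0 < 1 + p.1 := by linarith
  simp only [box, Qpsi, csq, dt_eq, dxi_eq] at e
  have e2 : (1 + p.1) ^ (2 * lam) = Wt lam p * Wt lam p := by
    rw [Wt_mul, Wt_eq _ hp.le]; ring_nf
  have e3 : (1 + p.1) ^ lam = Wt lam p := (Wt_eq _ hp.le).symm
  have e4 : (1 + p.1) ^ (lam - 1) = Wt (lam - 1) p := (Wt_eq _ hp.le).symm
  have e5 : (1 + p.1)⁻¹ = Wt (-1) p := by rw [Wt_eq _ hp.le, Real.rpow_neg hp1.le, Real.rpow_one]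
  have e6 : ((1 + p.1) ^ 2)⁻¹ = Wt (-2) p := by
    rw [Wt_eq _ hp.le, Real.rpow_neg hp1.le]; norm_num
  rw [div_eq_mul_inv _ ((1 + p.1) ^ 2), div_eq_mul_inv _ (1 + p.1), div_eq_mul_inv μ, e2, e3, e4, e5, e6, ← Wt_neg] at e
  simp only [gab, Fin.sum_univ_succ, Fin.cases_zero, Fin.cases_succ, gi, gij, g0, gA, mc, cf, cz] at e ⊢
  simp only [Fin.sum_univ_zero, Finset.univ_unique, Finset.sum_singleton, Fin.isValue] at e ⊢
  simp only [show (default : Fin 1).succ.succ = (2 : Fin 3) from rfl, show (Fin.succ 0 : Fin 3) = 1 from rfl, show (Fin.succ 0 : Fin 2) = 1 from rfl, show (Fin.succ 1 : Fin 3) = 2 from rfl, show ((default : Fin 1).succ : Fin 2) = 1 from rfl, show (Fin.succ 0 : Fin 4) = 1 from rfl, show (Fin.succ 1 : Fin 4) = 2 from rfl, show (Fin.succ 2 : Fin 4) = 3 from rfl] at e ⊢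
  have c1 := congrFun (D_comm hψ 0 1) p
  have c2 := congrFun (D_comm hψ 0 2) p
  have c3 := congrFun (D_comm hψ 0 3) p
  simp only [if_neg (show ¬ ((0:Fin 3) = 1) by decide), if_neg (show ¬ ((0:Fin 3) = 2) by decide), if_neg (show ¬ ((1:Fin 3) = 0) by decide),
    if_neg (show ¬ ((1:Fin 3) = 2) by decide), if_neg (show ¬ ((2:Fin 3) = 0) by decide), if_neg (show ¬ ((2:Fin 3) = 1) by decide), if_true]
  norm_num at e ⊢
  rw [← sub_eq_zero] at e ⊢
  rw [← e]
  have : ∀ f : Fn, (fun q => f q) = f := fun f => rfl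
  ring
lemma W_D (hf : Sm f) (k : Fin 4) (a : Wd) : DWord a (Dop k f) = Dop k (DWord a f) := (W_cons hf k a).symm
lemma eqU_word (hψ : Sm ψ) (h : EqU μ lam γ ψ) (a : Wd) (p : Pt) (hp : 0 < p.1) : Dop 0 (Dop 0 (DWord a ψ)) p - ∑ i : Fin 3, Ds i (Ds i (DWord a ψ)) p = (∑ α, ∑ β, DWord a (fun p => gab μ lam γ ψ α β p * Dop α (Dop β ψ) p) p) + (-1) * DWord a (fun p => cf μ lam p * Dop 0 ψ p) p + DWord a (fun p => cz lam p * ψ p) p + (-1) * (∑ i : Fin 3, DWord a (fun p => mc lam (2 * lam) μ p * (Ds i ψ p * Ds i ψ p)) p) := by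
  have s1 : ∀ α β, Sm (fun p => gab μ lam γ ψ α β p * Dop α (Dop β ψ) p) := fun α β =>
    (gab_sm hψ α β).mul ((hψ.D β).D α)
  have s2 := (cf_sm μ lam).mul (hψ.D 0)
  have s3 := (cz_sm lam).mul hψ
  have s4 : ∀ i : Fin 3, Sm (fun p => mc lam (2 * lam) μ p * (Ds i ψ p * Ds i ψ p)) := fun i =>
    (mc_sm _ _ _).mul ((hψ.D _).mul (hψ.D _))
  have h' : ∀ p : Pt, 0 < p.1 → Dop 0 (Dop 0 ψ) p + (-1) * (∑ i : Fin 3, Ds i (Ds i ψ) p) = (∑ α, ∑ β, gab μ lam γ ψ α β p * Dop α (Dop β ψ) p) + (-1) * (cf μ lam p * Dop 0 ψ p) + cz lam p * ψ p + (-1) * (∑ i : Fin 3, mc lam (2 * lam) μ p * (Ds i ψ p * Ds i ψ p)) := by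
    intro p hp; have := h p hp; linarith
  have := W_congrU h' a p hp
  have t1 : ∀ α, Sm (fun p => ∑ β, gab μ lam γ ψ α β p * Dop α (Dop β ψ) p) := fun α => ContDiff.sum fun β _ => s1 α β
  have t2 : Sm (fun p => ∑ α, ∑ β, gab μ lam γ ψ α β p * Dop α (Dop β ψ) p) := ContDiff.sum fun α _ => t1 α
  have t3 : Sm (fun p => (∑ i : Fin 3, mc lam (2 * lam) μ p * (Ds i ψ p * Ds i ψ p))) := ContDiff.sum fun i _ => s4 i
  have t4 : Sm (fun p => (∑ i : Fin 3, Ds i (Ds i ψ) p)) := ContDiff.sum fun i _ => (hψ.D _).D _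
  rw [W_add ((hψ.D 0).D 0) (contDiff_const.mul t4), W_cmul t4, W_sum _ (fun i => (hψ.D _).D _), W_add ((t2.add (contDiff_const.mul s2)).add s3) (contDiff_const.mul t3), W_add (t2.add (contDiff_const.mul s2)) s3, W_add t2 (contDiff_const.mul s2), W_cmul s2, W_cmul t3, W_sum _ t1, W_sum _ s4] at this
  simp only [W_sum _ (s1 _), W_D (hψ.D _), W_D hψ] at this
  linarith
lemma comm_nl (μ lam γ : ℝ) (hl0 : 0 ≤ lam) (h1 : lam ≤ 1) (N : ℕ) : ∃ C ≥ 1, ∀ (ψ : Fn) (p : Pt) (e Y : ℝ), Sm ψ → PH N (N - N/2 + 1) lam ψ p e (Wt lam p)⁻¹ Y → ∀ a : Wd, a.length ≤ N → ∀ α β, |DWord a (fun p => gab μ lam γ ψ α β p * Dop α (Dop β ψ) p) p - gab μ lam γ ψ α β p * Dop α (Dop β (DWord a ψ)) p| ≤ C * (e * (Wt lam p)⁻¹ * Y) := by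
  obtain ⟨C, hC, h⟩ := cl_gab μ lam γ hl0 h1 N (N - N/2 + 1)
  have hC0 : 0 ≤ C := by linarith
  refine ⟨2 ^ N * (2 * C), ?_, fun ψ p e Y hψ H a ha α β => ?_⟩
  · have : (1:ℝ) ≤ 2 ^ N := one_le_pow₀ (by norm_num)
    nlinarith
  have K := h ψ p e _ Y hψ H α β
  have he := H.e0
  have hY := H.Y0
  have hW := Wt_pos lam p
  have B0 : 0 ≤ e * (Wt lam p)⁻¹ * Y := by positivity
  have ew : ∀ b : Wd, DWord b (Dop α (Dop β ψ)) = DWord (α :: β :: b) ψ := fun b => by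
    rw [W_D (hψ.D _), W_D hψ]; rfl
  have := leib' a K.sm ((hψ.D β).D α) p (2 * C * (e * (Wt lam p)⁻¹ * Y)) (by positivity) ?_
  · rw [W_D (hψ.D _), W_D hψ] at this
    refine this.trans ?_
    rw [mul_assoc (2 ^ N)]
    exact mlr (pow_le_pow_right₀ (by norm_num) ha) (by positivity)
  intro b c hb hbc
  rw [ew]
  rcases le_total (b.length + 1) (N - N/2 + 1) with h0 | h0
  · refine (mul_le_mul (K.c1 b hb h0) (H.b3 _ (by simp) (by simp; omega)) (abs_nonneg _) (by positivity)).trans ?_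
    nlinarith
  rcases le_or_gt b.length (N - N/2) with h0' | h0'
  · refine (mul_le_mul (K.c1 b hb (by omega)) (H.b3 _ (by simp) (by simp; omega)) (abs_nonneg _) (by positivity)).trans ?_
    nlinarith
  have k2 := H.b2 (α :: β :: c) (by simp) (by simp; omega)
  have k3 := H.b3 (α :: β :: c) (by simp) (by simp; omega)
  have k1 := K.c2 b hb (by omega)
  refine (mlr k1 (abs_nonneg _)).trans ?_
  calc C * (Wt lam p * Y + e * (Wt lam p)⁻¹) * |DWord (α :: β :: c) ψ p|
      = C * (Wt lam p * Y) * |DWord (α :: β :: c) ψ p| + C * (e * (Wt lam p)⁻¹) * |DWord (α :: β :: c) ψ p| := by ring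
    _ ≤ C * (Wt lam p * Y) * (e / Wt lam p * (Wt lam p)⁻¹) + C * (e * (Wt lam p)⁻¹) * Y := by gcongr
    _ = _ := by field_simp; ring
lemma quad_bd (lam c μ : ℝ) (h1 : lam ≤ 1) (N L : ℕ) : ∃ C ≥ 1, ∀ (ψ : Fn) (p : Pt) (e q Y : ℝ), Sm ψ → PH N L lam ψ p e q Y → ∀ a : Wd, a.length ≤ N → ∀ α, |DWord a (fun p => mc lam c μ p * (Dop α ψ p * Dop α ψ p)) p| ≤ C * (e * (Wt lam p)⁻¹ * Y) := by
  obtain ⟨C, hC, h⟩ := mc_bound lam c μ h1 N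
  have hC0 : 0 ≤ C := by linarith
  have h2 : (1:ℝ) ≤ 2 ^ N := one_le_pow₀ (by norm_num)
  refine ⟨2 ^ N * (C * 2 ^ N), ?_, fun ψ p e q Y hψ H a ha α => ?_⟩
  · exact one_le_mul_of_one_le_of_one_le h2 (one_le_mul_of_one_le_of_one_le hC h2)
  have he := H.e0
  have hY := H.Y0
  have hW := Wt_pos lam p
  have hL := H.hL
  have B0 : 0 ≤ e * (Wt lam p)⁻¹ * Y := by positivity
  refine (leib a (mc_sm _ _ _) ((hψ.D α).mul (hψ.D α)) p (C * 2 ^ N * (e * (Wt lam p)⁻¹ * Y)) fun b d hbd => ?_).trans ?_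
  · rw [mul_assoc C]
    refine mul_le_mul (h b (by omega) p H.hp).1 ?_ (abs_nonneg _) hC0
    refine (leib d (hψ.D α) (hψ.D α) p (e * (Wt lam p)⁻¹ * Y) fun b c hbc => ?_).trans ?_
    · rw [W_D hψ, W_D hψ]
      have b1 := fun c => H.b1 (α :: c) (by simp)
      have b3 := fun c => H.b3 (α :: c) (by simp)
      simp only [List.length_cons] at b1 b3
      rcases le_total b.length c.length with h0 | h0
      · exact mul_le_mul (b1 b (by omega)) (b3 c (by omega)) (abs_nonneg _) (by positivity)
      · rw [mul_comm]; exact mul_le_mul (b1 c (by omega)) (b3 b (by omega)) (abs_nonneg _) (by positivity)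
    · exact mlr (pow_le_pow_right₀ (by norm_num) (by omega)) (by positivity)
  · rw [mul_assoc (2 ^ N)]
    exact mlr (pow_le_pow_right₀ (by norm_num) ha) (by positivity)
lemma int_nl (μ lam γ : ℝ) (hl0 : 0 ≤ lam) (h1 : lam ≤ 1) (N L : ℕ) (hL4 : 4 ≤ L) : ∃ C ≥ 1, ∀ (ψ : Fn) (p : Pt) (e Y z s : ℝ), Sm ψ → PH N L lam ψ p e 1 Y → 0 ≤ z → 0 ≤ s → ∀ a : Wd, a.length ≤ N → (∀ c : Wd, c.length ≤ a.length → ∀ α β, |Dop α (Dop β (DWord c ψ)) p| ≤ z) → (∀ c : Wd, c.length + 4 ≤ a.length → ∀ α β, |Dop α (Dop β (DWord c ψ)) p| ≤ s) → ∀ α β, |DWord a (fun p => gab μ lam γ ψ α β p * Dop α (Dop β ψ) p) p| ≤ C * (e * z + Wt lam p * Y * s) := by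
  obtain ⟨C, hC, h⟩ := cl_gab μ lam γ hl0 h1 N L
  have hC0 : 0 ≤ C := by linarith
  refine ⟨2 ^ N * C, ?_, fun ψ p e Y z s hψ H hz0 hs0 a ha hz hs α β => ?_⟩
  · have : (1:ℝ) ≤ 2 ^ N := one_le_pow₀ (by norm_num)
    nlinarith
  have K := h ψ p e _ Y hψ H α β
  have he := H.e0
  have hY := H.Y0
  have hW := Wt_pos lam p
  refine (leib a K.sm ((hψ.D β).D α) p (C * (e * z + Wt lam p * Y * s)) ?_).trans ?_
  · intro b c hbc
    rw [W_D (hψ.D _), W_D hψ]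
    have kz := hz c (by omega) α β
    have s0 : 0 ≤ C * (Wt lam p * Y * s) := by positivity
    rcases Nat.eq_zero_or_pos b.length with h0 | h0
    · rw [List.length_eq_zero_iff] at h0; subst h0
      refine (mul_le_mul K.c0 kz (abs_nonneg _) (by positivity)).trans ?_
      linarith
    rcases le_or_gt (b.length + 1) L with h4 | h4
    · refine (mul_le_mul (K.c1 b h0 h4) kz (abs_nonneg _) (by positivity)).trans ?_
      linarith
    have ks := hs c (by omega) α β
    refine (mlr (K.c2 b h0 (by omega)) (abs_nonneg _)).trans ?_
    calc C * (Wt lam p * Y + e * 1) * |Dop α (Dop β (DWord c ψ)) p|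
        = C * (Wt lam p * Y * |Dop α (Dop β (DWord c ψ)) p| + e * |Dop α (Dop β (DWord c ψ)) p|) := by ring
      _ ≤ C * (Wt lam p * Y * s + e * z) := by gcongr
      _ = _ := by ring
  · rw [mul_assoc (2 ^ N)]
    exact mlr (pow_le_pow_right₀ (by norm_num) ha) (by positivity)
lemma lin_bd (μ lam : ℝ) (hl0 : 0 ≤ lam) (h1 : lam ≤ 1) (N : ℕ) : ∃ C ≥ 1, ∀ (ψ : Fn) (p : Pt) (Y : ℝ), Sm ψ → 0 < p.1 → 0 ≤ Y → (∀ b : Wd, 1 ≤ b.length → b.length ≤ N + 1 → |DWord b ψ p| ≤ Y) → ∀ a : Wd, a.length ≤ N → |DWord a (fun p => cf μ lam p * Dop 0 ψ p) p - cf μ lam p * Dop 0 (DWord a ψ) p| ≤ C * ((Wt (-1-lam) p + Wt (-2) p) * Y) ∧ |DWord a (fun p => cf μ lam p * Dop 0 ψ p) p| ≤ C * ((Wt lam p)⁻¹ * Y) ∧ |DWord a (fun p => cz lam p * ψ p) p| ≤ C * (lam * (1 - lam) * Wt (-2) p * (Y + |ψ p|)) := by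
  obtain ⟨C1, hC1, k1⟩ := W_Wt' (-lam) N
  obtain ⟨C2, hC2, k2⟩ := W_Wt' (-1) N
  obtain ⟨C3, hC3, k3⟩ := W_Wt' (-2) N
  have h2 : (1:ℝ) ≤ 2 ^ N := one_le_pow₀ (by norm_num)
  set C := |μ| * C1 + 2 * C2 + C3 with hCdef
  have hμ := abs_nonneg μ
  have hC : 1 ≤ C := by nlinarith
  have hC0 : 0 ≤ C := by linarith
  have hcf : ∀ b : Wd, b.length ≤ N → ∀ p : Pt, 0 < p.1 → |DWord b (cf μ lam) p| ≤ |μ| * (C1 * Wt (-lam - b.length) p) + 2 * lam * (C2 * Wt (-1 - b.length) p) := by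
    intro b hb p hp
    have : DWord b (cf μ lam) p = μ * DWord b (Wt (-lam)) p + 2 * lam * DWord b (Wt (-1)) p := by
      unfold cf
      rw [W_add (contDiff_const.mul (Wt_sm _)) (contDiff_const.mul (Wt_sm _)), W_cmul (Wt_sm _), W_cmul (Wt_sm _)]
    rw [this]
    refine (abs_add_le _ _).trans ?_
    rw [abs_mul, abs_mul (2 * lam), abs_of_nonneg (by positivity : 0 ≤ 2 * lam)]
    have := k1 b hb p hp
    have := k2 b hb p hp
    gcongr
  have ll : lam * (1 - lam) ≥ 0 := mul_nonneg hl0 (by linarith)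
  refine ⟨2 ^ N * C, one_le_mul_of_one_le_of_one_le h2 hC, fun ψ p Y hψ hp hY hb a ha => ⟨?_, ?_, ?_⟩⟩
  · have pw := Wt_pos (-1 - lam) p
    have pw2 := Wt_pos (-2) p
    have := leib' a (cf_sm μ lam) (hψ.D 0) p (C * ((Wt (-1-lam) p + Wt (-2) p) * Y)) (by positivity) ?_
    · rw [W_D hψ] at this
      refine this.trans ?_
      rw [mul_assoc (2 ^ N)]
      exact mlr (pow_le_pow_right₀ (by norm_num) ha) (by positivity)
    · intro b c hb1 hbc
      rw [← mul_assoc C]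
      have hbl : (1:ℝ) ≤ b.length := by exact_mod_cast hb1
      refine mul_le_mul ((hcf b (by omega) p hp).trans ?_) (by rw [W_D hψ]; exact hb (0 :: c) (by simp) (by simp; omega)) (abs_nonneg _) (by positivity)
      have m1 := Wt_mono (a := -lam - b.length) (b := -1 - lam) (by linarith) hp.le
      have m2 := Wt_mono (a := -1 - b.length) (b := -2) (by linarith) hp.le
      have pb := Wt_pos (-1 - b.length) p
      calc |μ| * (C1 * Wt (-lam - b.length) p) + 2 * lam * (C2 * Wt (-1 - b.length) p)
          ≤ |μ| * (C1 * Wt (-1 - lam) p) + 2 * 1 * (C2 * Wt (-2) p) := by gcongr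
        _ ≤ |μ| * (C1 * (Wt (-1 - lam) p + Wt (-2) p)) + 2 * 1 * (C2 * (Wt (-1 - lam) p + Wt (-2) p)) + C3 * (Wt (-1 - lam) p + Wt (-2) p) := by
            have : 0 ≤ C3 * (Wt (-1 - lam) p + Wt (-2) p) := by positivity
            have a1 : Wt (-1-lam) p ≤ (Wt (-1 - lam) p + Wt (-2) p) := by linarith
            have a2 : Wt (-2) p ≤ (Wt (-1 - lam) p + Wt (-2) p) := by linarith
            have b1 : |μ| * (C1 * Wt (-1 - lam) p) ≤ |μ| * (C1 * (Wt (-1 - lam) p + Wt (-2) p)) := by gcongr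
            have b2 : 2 * 1 * (C2 * Wt (-2) p) ≤ 2 * 1 * (C2 * (Wt (-1 - lam) p + Wt (-2) p)) := by gcongr
            linarith
        _ = _ := by rw [hCdef]; ring
  · rw [← Wt_neg]
    have pw := Wt_pos (-lam) p
    refine (leib a (cf_sm μ lam) (hψ.D 0) p (C * (Wt (-lam) p * Y)) ?_).trans ?_
    · intro b c hbc
      rw [← mul_assoc C]
      have hbl : (0:ℝ) ≤ b.length := by positivity
      refine mul_le_mul ((hcf b (by omega) p hp).trans ?_) (by rw [W_D hψ]; exact hb (0 :: c) (by simp) (by simp; omega)) (abs_nonneg _) (by positivity)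
      have m1 := Wt_mono (a := -lam - b.length) (b := -lam) (by linarith) hp.le
      have m2 := Wt_mono (a := -1 - b.length) (b := -lam) (by linarith) hp.le
      have pb := Wt_pos (-1 - b.length) p
      calc |μ| * (C1 * Wt (-lam - b.length) p) + 2 * lam * (C2 * Wt (-1 - b.length) p)
          ≤ |μ| * (C1 * Wt (-lam) p) + 2 * 1 * (C2 * Wt (-lam) p) := by gcongr
        _ ≤ |μ| * (C1 * Wt (-lam) p) + 2 * 1 * (C2 * Wt (-lam) p) + C3 * Wt (-lam) p := by
            have : 0 ≤ C3 * Wt (-lam) p := by positivity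
            linarith
        _ = _ := by rw [hCdef]; ring
    · rw [mul_assoc (2 ^ N)]
      exact mlr (pow_le_pow_right₀ (by norm_num) ha) (by positivity)
  · have pw := Wt_pos (-2) p
    refine (leib a (cz_sm lam) hψ p (C * (lam * (1 - lam) * Wt (-2) p * (Y + |ψ p|))) ?_).trans ?_
    · intro b c hbc
      have hbl : (0:ℝ) ≤ b.length := by positivity
      have e1 : DWord b (cz lam) p = lam * (1 - lam) * DWord b (Wt (-2)) p := by
        unfold cz; rw [W_cmul (Wt_sm _)]
      have e2 : |DWord b (cz lam) p| ≤ lam * (1 - lam) * (C * Wt (-2) p) := by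
        rw [e1, abs_mul, abs_of_nonneg ll]
        refine mll ((k3 b (by omega) p hp).trans ?_) ll
        have m1 := Wt_mono (a := -2 - b.length) (b := -2) (by linarith) hp.le
        have : C3 ≤ C := by nlinarith
        have := Wt_pos (-2 - b.length) p
        gcongr
      have e3 : |DWord c ψ p| ≤ Y + |ψ p| := by
        rcases Nat.eq_zero_or_pos c.length with h0 | h0
        · rw [List.length_eq_zero_iff] at h0; subst h0; simp only [DWord]; linarith
        · have := hb c h0 (by omega); have := abs_nonneg (ψ p); linarith
      refine (mul_le_mul e2 e3 (abs_nonneg _) (by positivity)).trans (le_of_eq (by ring))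
    · rw [mul_assoc (2 ^ N)]
      exact mlr (pow_le_pow_right₀ (by norm_num) ha) (by positivity)
def wsum {k : ℕ} (n : ℕ) (F : List (Fin k) → ℝ) : ℝ := ∑ m ∈ Finset.range (n + 1), ∑ a : Fin m → Fin k, F (List.ofFn a)
lemma le_wsum {k n : ℕ} {F : List (Fin k) → ℝ} (h0 : ∀ l, 0 ≤ F l) (l : List (Fin k)) (hl : l.length ≤ n) : F l ≤ wsum n F := by
  have e : F l = F (List.ofFn l.get) := by rw [List.ofFn_get]
  rw [e]
  refine le_trans ?_ (Finset.single_le_sum (f := fun m => ∑ a : Fin m → Fin k, F (List.ofFn a)) (fun m _ => Finset.sum_nonneg fun a _ => h0 _) (Finset.mem_range.2 (by omega : l.length < n + 1)))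
  exact Finset.single_le_sum (f := fun a : Fin l.length → Fin k => F (List.ofFn a)) (fun a _ => h0 _) (Finset.mem_univ l.get)
lemma wsum_le {k n : ℕ} {F G : List (Fin k) → ℝ} (h : ∀ l, l.length ≤ n → F l ≤ G l) : wsum n F ≤ wsum n G := by
  refine Finset.sum_le_sum fun m hm => Finset.sum_le_sum fun a _ => h _ ?_
  rw [List.length_ofFn]; have := Finset.mem_range.1 hm; omega
lemma wsum_add {k n : ℕ} (F G : List (Fin k) → ℝ) : wsum n (fun l => F l + G l) = wsum n F + wsum n G := by
  simp only [wsum, Finset.sum_add_distrib]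
lemma wsum_mul {k n : ℕ} (F : List (Fin k) → ℝ) (c : ℝ) : wsum n (fun l => c * F l) = c * wsum n F := by
  simp only [wsum, Finset.mul_sum]
lemma wsum_const {k n : ℕ} (c : ℝ) : wsum n (fun _ : List (Fin k) => c) = wsum n (fun _ : List (Fin k) => 1) * c := by
  rw [mul_comm, ← wsum_mul]; simp
lemma wsum_nonneg {k n : ℕ} {F : List (Fin k) → ℝ} (h0 : ∀ l, 0 ≤ F l) : 0 ≤ wsum n F := Finset.sum_nonneg fun _ _ => Finset.sum_nonneg fun _ _ => h0 _
lemma wsum_sm {k n : ℕ} {F : List (Fin k) → Fn} (h : ∀ l, Sm (F l)) : Sm (fun p => wsum n (fun l => F l p)) := ContDiff.sum fun _ _ => ContDiff.sum fun _ _ => h _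
lemma wsum_sp {M : ℝ} {k n : ℕ} {F : List (Fin k) → Fn} (h : ∀ l, Sp M (F l)) : Sp M (fun p => wsum n (fun l => F l p)) := Sp.sum _ fun _ _ => Sp.sum _ fun _ _ => h _
lemma wsum_int {X : Type*} [MeasurableSpace X] {ν : Measure X} {k n : ℕ} {F : List (Fin k) → X → ℝ} (h : ∀ l, Integrable (F l) ν) : ∫ x, wsum n (fun l => F l x) ∂ν = wsum n (fun l => ∫ x, F l x ∂ν) := by
  unfold wsum
  rw [integral_finset_sum _ fun m _ => integrable_finset_sum _ fun a _ => h _]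
  exact Finset.sum_congr rfl fun m _ => integral_finset_sum _ fun a _ => h _
def Y2 (N : ℕ) (ψ : Fn) (p : Pt) : ℝ := wsum N (fun a : Wd => ∑ α, (Dop α (DWord a ψ) p) ^ 2)
def YG2 (N : ℕ) (ψ : Fn) (p : Pt) : ℝ := wsum N (fun a : List (Fin 8) => ∑ α, (Dop α (GamWord a ψ) p) ^ 2)
lemma Y2_sm {N : ℕ} {ψ : Fn} (h : Sm ψ) : Sm (Y2 N ψ) := wsum_sm fun l => ContDiff.sum fun α _ => ((h.W l).D α).pow 2
lemma YG2_sm {N : ℕ} {ψ : Fn} (h : Sm ψ) : Sm (YG2 N ψ) := wsum_sm fun l => ContDiff.sum fun α _ => ((h.GW l).D α).pow 2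
lemma Y2_sp {M : ℝ} {N : ℕ} {ψ : Fn} (h : Sp M ψ) : Sp M (Y2 N ψ) := wsum_sp fun l => Sp.sum _ fun α _ => ((h.W l).D α).sq
lemma YG2_sp {M : ℝ} {N : ℕ} {ψ : Fn} (h : Sp M ψ) : Sp M (YG2 N ψ) := wsum_sp fun l => Sp.sum _ fun α _ => ((h.GW l).D α).sq
lemma Y2_nonneg (N : ℕ) (ψ : Fn) (p : Pt) : 0 ≤ Y2 N ψ p := wsum_nonneg fun _ => Finset.sum_nonneg fun _ _ => sq_nonneg _
lemma YG2_nonneg (N : ℕ) (ψ : Fn) (p : Pt) : 0 ≤ YG2 N ψ p := wsum_nonneg fun _ => Finset.sum_nonneg fun _ _ => sq_nonneg _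
lemma le_Y2 (ψ : Fn) (p : Pt) (a : Wd) (ha : a.length ≤ N) (α : Fin 4) : (Dop α (DWord a ψ) p) ^ 2 ≤ Y2 N ψ p := (Finset.single_le_sum (f := fun α => (Dop α (DWord a ψ) p) ^ 2) (fun _ _ => sq_nonneg _) (Finset.mem_univ α)).trans (le_wsum (F := fun a : Wd => ∑ α, (Dop α (DWord a ψ) p) ^ 2) (fun _ => Finset.sum_nonneg fun _ _ => sq_nonneg _) a ha)
lemma le_YG2 (ψ : Fn) (p : Pt) (a : List (Fin 8)) (ha : a.length ≤ N) (α : Fin 4) : (Dop α (GamWord a ψ) p) ^ 2 ≤ YG2 N ψ p := (Finset.single_le_sum (f := fun α => (Dop α (GamWord a ψ) p) ^ 2) (fun _ _ => sq_nonneg _) (Finset.mem_univ α)).trans (le_wsum (F := fun a : List (Fin 8) => ∑ α, (Dop α (GamWord a ψ) p) ^ 2) (fun _ => Finset.sum_nonneg fun _ _ => sq_nonneg _) a ha)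
def up (l : Wd) : List (Fin 8) := l.map (Fin.castLE (by norm_num))
lemma up_len (l : Wd) : (up l).length = l.length := by simp [up]
lemma Dop_Gam (k : Fin 4) : Dop k = Gam (Fin.castLE (by norm_num) k) := by fin_cases k <;> rfl
lemma DW_GW (l : Wd) (f : Fn) : DWord l f = GamWord (up l) f := by
  induction l with
  | nil => rfl
  | cons k l ih => simp only [DWord]; rw [ih, Dop_Gam]; rfl
lemma W_le_YG (ψ : Fn) (p : Pt) (b : Wd) (h1 : 1 ≤ b.length) (h2 : b.length ≤ N + 1) : (DWord b ψ p) ^ 2 ≤ YG2 N ψ p := by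
  cases b with
  | nil => simp at h1
  | cons k l =>
    simp only [DWord]; rw [DW_GW]
    exact le_YG2 ψ p (up l) (by rw [up_len]; simpa using h2) k
lemma W_le_Y (ψ : Fn) (p : Pt) (b : Wd) (h1 : 1 ≤ b.length) (h2 : b.length ≤ N + 1) : (DWord b ψ p) ^ 2 ≤ Y2 N ψ p := by
  cases b with
  | nil => simp at h1
  | cons k l => exact le_Y2 ψ p l (by simpa using h2) k
structure Hyp (μ lam γ M : ℝ) (N : ℕ) (ψ : Fn) (E : ℝ) : Prop where
  sm : Sm ψ
  sp : Sp M ψ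
  eq : EqU μ lam γ ψ
  E0 : 0 ≤ E
  l0 : 0 < lam
  l1 : lam ≤ 1
  M0 : 0 < M
  hN : 8 ≤ N
  en : ∀ t : ℝ, 0 < t → ∫ x : E3, YG2 N ψ (t, x) ≤ (E / (1 + t) ^ lam) ^ 2
  en0 : ∀ t : ℝ, 0 < t → ∫ x : E3, ψ (t, x) ^ 2 ≤ E ^ 2
section
section
end
lemma Hyp.W1 (h : Hyp μ lam γ M N ψ E) (ht : 0 < t) : 1 ≤ (1 + t) ^ lam := Real.one_le_rpow (by linarith) h.l0.le
lemma Hyp.W2 (h : Hyp μ lam γ M N ψ E) (ht : 0 < t) : (1 + t) ^ lam ≤ 1 + t := by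
  conv_rhs => rw [← Real.rpow_one (1 + t)]
  exact Real.rpow_le_rpow_of_exponent_le (by linarith) h.l1
lemma slice_cont {f : Fn} (hf : Sm f) (t : ℝ) : Continuous (fun x : E3 => f (t, x)) := hf.continuous.comp (by fun_prop)
lemma Hyp.d0 (h : Hyp μ lam γ M N ψ E) (ht : 0 < t) (x : E3) : |ψ (t, x)| ≤ 4 * E := by
  have hN := h.hN
  have s : Sm (fun p => ψ p ^ 2 + YG2 N ψ p) := (h.sm.pow 2).add (YG2_sm h.sm)
  have sp : Sp M (fun p => ψ p ^ 2 + YG2 N ψ p) := (h.sp.sq).add (YG2_sp h.sp)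
  have := sob_flat ht h.sm h.sp (slice_cont s t) (slice_cs sp ht) (fun c hc y => ?_) x
  · rw [integral_add (slice_int (h.sm.pow 2).continuous h.sp.sq ht) (slice_int (YG2_sm h.sm).continuous (YG2_sp h.sp) ht)] at this
    have h1 := h.en t ht
    have h2 := h.en0 t ht
    have h3 : (E / (1 + t) ^ lam) ^ 2 ≤ E ^ 2 := pow_le_pow_left₀ (div_nonneg h.E0 (zero_le_one.trans (h.W1 ht))) (div_le_self h.E0 (h.W1 ht)) 2
    refine abs_le_of_sq_le_sq ?_ (by linarith [h.E0])
    nlinarith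
  · rcases Nat.eq_zero_or_pos c.length with h0 | h0
    · rw [List.length_eq_zero_iff] at h0; subst h0; simp only [DWord]; linarith [YG2_nonneg N ψ (t, y)]
    · have := W_le_YG (N := N) ψ (t, y) c h0 (by omega)
      have := sq_nonneg (ψ (t, y))
      linarith
lemma Hyp.d1 (h : Hyp μ lam γ M N ψ E) (ht : 0 < t) (x : E3) (b : Wd) (h1 : 1 ≤ b.length) (h2 : b.length + 2 ≤ N) : |DWord b ψ (t, x)| ≤ 3 * (E / (1 + t) ^ lam) := by
  have := sob_flat ht (h.sm.W b) (h.sp.W b) (slice_cont (YG2_sm (N := N) h.sm) t) (slice_cs (YG2_sp h.sp) ht) (fun c hc y => ?_) x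
  · have h1 := h.en t ht
    have h3 := div_nonneg h.E0 (zero_le_one.trans (h.W1 ht))
    refine abs_le_of_sq_le_sq ?_ (by linarith)
    nlinarith
  · rw [← W_append]
    exact W_le_YG ψ (t, y) _ (by simp; omega) (by simp; omega)
end
lemma d2_ext (M : ℝ) (hM : 0 < M) : ∃ C ≥ 1, ∀ (μ lam γ E : ℝ) (N : ℕ) (ψ : Fn), Hyp μ lam γ M N ψ E → ∀ t : ℝ, 1 ≤ t → ∀ (x : E3) (k : Fin 3), t / 8 ≤ |x k| → ∀ b : Wd, 1 ≤ b.length → b.length + 2 ≤ N → |DWord b ψ (t, x)| ≤ C * (E / (1 + t) ^ lam / (1 + t) ^ lam) := by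
  obtain ⟨C0, hC0, hs⟩ := sob_ext M hM
  refine ⟨1 + 2 * Real.sqrt (C0 * 15625), by have := Real.sqrt_nonneg (C0 * 15625); linarith, fun μ lam γ E N ψ h t ht x k hk b h1 h2 => ?_⟩
  have ht0 : 0 < t := by linarith
  set S := Real.sqrt (C0 * 15625) with hS
  have hS0 : 0 ≤ S := Real.sqrt_nonneg _
  have hS2 : S ^ 2 = C0 * 15625 := Real.sq_sqrt (by positivity)
  have hW := h.W1 ht0
  have hW2 := h.W2 ht0
  set W := (1 + t) ^ lam with hWdef
  have hW0 : 0 < W := by linarith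
  have sm' : Sm (fun p => 15625 * YG2 N ψ p) := contDiff_const.mul (YG2_sm h.sm)
  have sp' : Sp M (fun p => 15625 * YG2 N ψ p) := (YG2_sp h.sp).mul' _
  have := hs ht (h.sm.W b) (h.sp.W b) (slice_cont sm' t) (slice_cs sp' ht0) (fun c hc y => ?_) x k hk
  · rw [integral_const_mul] at this
    have en := h.en t ht0
    have hF := div_nonneg h.E0 hW0.le
    have k1 : (t * |DWord b ψ (t, x)|) ^ 2 ≤ (S * (E / W)) ^ 2 := by
      rw [mul_pow, sq_abs, mul_pow, hS2]
      calc _ ≤ _ := this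
        _ ≤ C0 * (15625 * (E / W) ^ 2) := by gcongr
        _ = _ := by ring
    have k2 := abs_le_of_sq_le_sq k1 (by positivity)
    rw [abs_mul, abs_abs, abs_of_pos ht0] at k2
    have k3 : |DWord b ψ (t, x)| * W ≤ 2 * S * (E / W) := by
      have := abs_nonneg (DWord b ψ (t, x))
      nlinarith
    rw [← mul_div_assoc, le_div_iff₀ hW0]
    nlinarith
  · cases b with
    | nil => simp at h1
    | cons j l =>
      have B := comm_bound c (h.sm.W l) (t, y) (Real.sqrt (YG2 N ψ (t, y))) j (fun a β ha => ?_)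
      · simp only [DWord]
        have k0 := Real.sqrt_nonneg (YG2 N ψ (t, y))
        have k1 : |GamWord c (Dop j (DWord l ψ)) (t, y)| ≤ 125 * Real.sqrt (YG2 N ψ (t, y)) := by
          refine B.trans (mlr ?_ k0)
          calc (5:ℝ) ^ c.length ≤ 5 ^ 3 := pow_le_pow_right₀ (by norm_num) hc
            _ = 125 := by norm_num
        have := sq_le_sq' (by linarith [abs_nonneg (GamWord c (Dop j (DWord l ψ)) (t, y))]) k1
        rw [sq_abs, mul_pow, Real.sq_sqrt (YG2_nonneg _ _ _)] at this
        linarith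
      · refine Real.abs_le_sqrt ?_
        rw [DW_GW, ← GW_append]
        exact le_YG2 ψ _ _ (by simp [up_len] at h2 ⊢; omega) β
lemma KS_alg {B bx D v00 v01 v02 v03 x0 x1 x2 v0 s0 R1 R2 R3 : ℝ} (ht : 1 ≤ t) (hx : x0 ^ 2 + x1 ^ 2 + x2 ^ 2 ≤ (t / 2) ^ 2) (hB : 0 ≤ B) (hb : v00 - D = bx) (h0 : |v0| ≤ B) (hs : |s0| ≤ B) (r1 : |R1| ≤ 5 * B) (r2 : |R2| ≤ 5 * B) (r3 : |R3| ≤ 5 * B) (e1 : t * v01 + x0 * D = R1) (e2 : t * v02 + x1 * D = R2) (e3 : t * v03 + x2 * D = R3) (e0 : s0 = v0 + t * v00 + (x0 * v01 + x1 * v02 + x2 * v03)) : |D| ≤ 2 * |bx| + 20 * (B / t) ∧ |v00| ≤ 3 * |bx| + 25 * (B / t) ∧ |v01| ≤ 3 * |bx| + 25 * (B / t) ∧ |v02| ≤ 3 * |bx| + 25 * (B / t) ∧ |v03| ≤ 3 * |bx| + 25 * (B / t) := by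
  have ht0 : 0 < t := by linarith
  have a0 : |x0| ≤ t / 2 := abs_le_of_sq_le_sq (by nlinarith [sq_nonneg x1, sq_nonneg x2]) (by linarith)
  have a1 : |x1| ≤ t / 2 := abs_le_of_sq_le_sq (by nlinarith [sq_nonneg x0, sq_nonneg x2]) (by linarith)
  have a2 : |x2| ≤ t / 2 := abs_le_of_sq_le_sq (by nlinarith [sq_nonneg x1, sq_nonneg x0]) (by linarith)
  set β := B / t with hβ
  have hBt : B = β * t := by rw [hβ]; field_simp
  have hβ0 : 0 ≤ β := by positivity
  have key : (t ^ 2 - (x0 ^ 2 + x1 ^ 2 + x2 ^ 2)) * D = - t ^ 2 * bx + t * s0 - t * v0 - (x0 * R1 + x1 * R2 + x2 * R3) := by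
    rw [e0, ← e1, ← e2, ← e3, ← hb]; ring
  have m : ∀ x R : ℝ, |x| ≤ t / 2 → |R| ≤ 5 * B → |x * R| ≤ t / 2 * (5 * B) := fun x R h h' => by
    rw [abs_mul]; exact mul_le_mul h h' (abs_nonneg _) (by linarith)
  have kb : |(t ^ 2 - (x0 ^ 2 + x1 ^ 2 + x2 ^ 2)) * D| ≤ t ^ 2 * |bx| + t * B + t * B + 3 * (t / 2 * (5 * B)) := by
    rw [key]
    have q1 : |(- t ^ 2 * bx)| = t ^ 2 * |bx| := by rw [abs_mul, abs_neg, abs_of_pos (by positivity : 0 < t ^ 2)]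
    have q2 : |t * s0| ≤ t * B := by rw [abs_mul, abs_of_pos ht0]; gcongr
    have q3 : |t * v0| ≤ t * B := by rw [abs_mul, abs_of_pos ht0]; gcongr
    have := m x0 R1 a0 r1
    have := m x1 R2 a1 r2
    have := m x2 R3 a2 r3
    have := abs_sub (- t ^ 2 * bx + t * s0 - t * v0) (x0 * R1 + x1 * R2 + x2 * R3)
    have := abs_sub (- t ^ 2 * bx + t * s0) (t * v0)
    have := abs_add_le (- t ^ 2 * bx) (t * s0)
    have := abs_add_le (x0 * R1 + x1 * R2) (x2 * R3)
    have := abs_add_le (x0 * R1) (x1 * R2)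
    linarith
  have hD : |D| ≤ 2 * |bx| + 20 * β := by
    rw [abs_mul] at kb
    have k1 : t ^ 2 * (3 / 4) ≤ |t ^ 2 - (x0 ^ 2 + x1 ^ 2 + x2 ^ 2)| := le_trans (by nlinarith) (le_abs_self _)
    have k2 : t ^ 2 * (3 / 4) * |D| ≤ t ^ 2 * (|bx| + 9.5 * β) := by
      refine (mlr k1 (abs_nonneg _)).trans (kb.trans ?_)
      rw [hBt]; nlinarith
    have k3 : (3 / 4) * |D| ≤ |bx| + 9.5 * β := by
      rw [mul_assoc] at k2
      exact le_of_mul_le_mul_left k2 (by positivity)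
    have := abs_nonneg bx
    linarith
  have hj : ∀ v x R : ℝ, t * v + x * D = R → |x| ≤ t / 2 → |R| ≤ 5 * B → |v| ≤ 3 * |bx| + 25 * β := by
    intro v x R e hx hR
    have : t * |v| ≤ t * (5 * β + |D| / 2) := by
      calc t * |v| = |R - x * D| := by rw [← e, ← abs_of_pos ht0, ← abs_mul, abs_of_pos ht0]; congr 1; ring
        _ ≤ |R| + |x * D| := abs_sub _ _
        _ ≤ 5 * B + t / 2 * |D| := by rw [abs_mul]; gcongr
        _ = _ := by rw [hBt]; ring
    have := le_of_mul_le_mul_left this ht0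
    have := abs_nonneg bx
    linarith
  refine ⟨hD, ?_, hj _ _ _ e1 a0 r1, hj _ _ _ e2 a1 r2, hj _ _ _ e3 a2 r3⟩
  have : v00 = bx + D := by linarith
  rw [this]
  have := abs_add_le bx D
  linarith
lemma norm_sq3 (x : E3) : ‖x‖ ^ 2 = x 0 ^ 2 + x 1 ^ 2 + x 2 ^ 2 := by
  rw [EuclideanSpace.norm_sq_eq, Fin.sum_univ_three]; simp
lemma KS_pt {v : Fn} (hv : Sm v) {x : E3} {B : ℝ} (ht : 1 ≤ t) (hx : ‖x‖ ≤ t / 2) (h0 : ∀ β, |Dop β v (t, x)| ≤ B) (h1 : ∀ k β, |Dop β (Gam k v) (t, x)| ≤ B) : |∑ i : Fin 3, Ds i (Ds i v) (t, x)| ≤ 2 * |Dop 0 (Dop 0 v) (t, x) - ∑ i : Fin 3, Ds i (Ds i v) (t, x)| + 20 * (B / t) ∧ ∀ α, |Dop α (Dop 0 v) (t, x)| ≤ 3 * |Dop 0 (Dop 0 v) (t, x) - ∑ i : Fin 3, Ds i (Ds i v) (t, x)| + 25 * (B / t) := by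
  set p : Pt := (t, x) with hp
  have g4 : Gam 4 v = fun p => p.2 1 * Dop 3 v p - p.2 2 * Dop 2 v p := rfl
  have g5 : Gam 5 v = fun p => p.2 2 * Dop 1 v p - p.2 0 * Dop 3 v p := rfl
  have g6 : Gam 6 v = fun p => p.2 0 * Dop 2 v p - p.2 1 * Dop 1 v p := rfl
  have g7 : Gam 7 v = fun p => p.1 * Dop 0 v p + (p.2 0 * Dop 1 v p + p.2 1 * Dop 2 v p + p.2 2 * Dop 3 v p) := by
    funext p
    show p.1 * dt v p + ∑ k, p.2 k * dxi k v p = _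
    rw [Fin.sum_univ_three]; rfl
  have sx : ∀ (i : Fin 3) β, Sm (fun p : Pt => p.2 i * Dop β v p) := fun i β => (Sm_coord i).mul (hv.D β)
  have st := Sm_t.mul (hv.D 0)
  have dx : ∀ (i : Fin 3) α β, Dop α (fun p : Pt => p.2 i * Dop β v p) p = (if α = i.succ then 1 else 0) * Dop β v p + x i * Dop α (Dop β v) p := by
    intro i α β; rw [D_mul (Sm_coord i) (hv.D β)]; simp only [D_coord]; rfl
  have dt' : ∀ α, Dop α (fun p : Pt => p.1 * Dop 0 v p) p = (if α = 0 then 1 else 0) * Dop 0 v p + t * Dop α (Dop 0 v) p := by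
    intro α; rw [D_mul Sm_t (hv.D 0)]; simp only [D_t]; rfl
  have d4 : ∀ α, Dop α (Gam 4 v) p = Dop α (fun p : Pt => p.2 1 * Dop 3 v p) p - Dop α (fun p : Pt => p.2 2 * Dop 2 v p) p := by
    intro α; rw [g4, D_sub (sx 1 3) (sx 2 2)]
  have d5 : ∀ α, Dop α (Gam 5 v) p = Dop α (fun p : Pt => p.2 2 * Dop 1 v p) p - Dop α (fun p : Pt => p.2 0 * Dop 3 v p) p := by
    intro α; rw [g5, D_sub (sx 2 1) (sx 0 3)]
  have d6 : ∀ α, Dop α (Gam 6 v) p = Dop α (fun p : Pt => p.2 0 * Dop 2 v p) p - Dop α (fun p : Pt => p.2 1 * Dop 1 v p) p := by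
    intro α; rw [g6, D_sub (sx 0 2) (sx 1 1)]
  have d7 : ∀ α, Dop α (Gam 7 v) p = Dop α (fun p : Pt => p.1 * Dop 0 v p) p + (Dop α (fun p : Pt => p.2 0 * Dop 1 v p) p + Dop α (fun p : Pt => p.2 1 * Dop 2 v p) p + Dop α (fun p : Pt => p.2 2 * Dop 3 v p) p) := by
    intro α; rw [g7, D_add st (((sx 0 1).add (sx 1 2)).add (sx 2 3)), D_add ((sx 0 1).add (sx 1 2)) (sx 2 3), D_add (sx 0 1) (sx 1 2)]
  simp only [dx, dt'] at d4 d5 d6 d7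
  have c : ∀ α β, Dop α (Dop β v) p = Dop β (Dop α v) p := fun α β => congrFun (D_comm hv α β) p
  have hB := (abs_nonneg _).trans (h0 0)
  have tri : ∀ a b c d e : ℝ, |a| ≤ B → |b| ≤ B → |c| ≤ B → |d| ≤ B → |e| ≤ B → |a + b + c + d + e| ≤ 5 * B := by
    intro a b c d e ha hb hc hd he
    have := abs_add_le (a + b + c + d) e
    have := abs_add_le (a + b + c) d
    have := abs_add_le (a + b) c
    have := abs_add_le a b
    linarith
  have ng : ∀ a : ℝ, |a| ≤ B → |-a| ≤ B := fun a h => by rwa [abs_neg]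
  have hz : |(0:ℝ)| ≤ B := by simpa using hB
  have hx' : x 0 ^ 2 + x 1 ^ 2 + x 2 ^ 2 ≤ (t / 2) ^ 2 := by
    rw [← norm_sq3]; exact pow_le_pow_left₀ (norm_nonneg _) hx 2
  have sum3 : ∑ i : Fin 3, Ds i (Ds i v) p = Dop 1 (Dop 1 v) p + Dop 2 (Dop 2 v) p + Dop 3 (Dop 3 v) p := by
    rw [Fin.sum_univ_three]; rfl
  rw [sum3]
  have A := KS_alg (t := t) (B := B) (D := Dop 1 (Dop 1 v) p + Dop 2 (Dop 2 v) p + Dop 3 (Dop 3 v) p) (v00 := Dop 0 (Dop 0 v) p) (v01 := Dop 1 (Dop 0 v) p) (v02 := Dop 2 (Dop 0 v) p) (v03 := Dop 3 (Dop 0 v) p) (x0 := x 0) (x1 := x 1) (x2 := x 2) (v0 := Dop 0 v p) (s0 := Dop 0 (Gam 7 v) p) (R1 := Dop 1 (Gam 7 v) p + Dop 1 v p + Dop 2 (Gam 6 v) p + -Dop 3 (Gam 5 v) p + 0) (R2 := Dop 2 (Gam 7 v) p + Dop 2 v p + Dop 3 (Gam 4 v) p + -Dop 1 (Gam 6 v)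 p + 0) (R3 := Dop 3 (Gam 7 v) p + Dop 3 v p + Dop 1 (Gam 5 v) p + -Dop 2 (Gam 4 v) p + 0)
    ht hx' hB rfl (h0 0) (h1 7 0) (tri _ _ _ _ _ (h1 7 1) (h0 1) (h1 6 2) (ng _ (h1 5 3)) hz) (tri _ _ _ _ _ (h1 7 2) (h0 2) (h1 4 3) (ng _ (h1 6 1)) hz) (tri _ _ _ _ _ (h1 7 3) (h0 3) (h1 5 1) (ng _ (h1 4 2)) hz) (by rw [d7, d6, d5]; simp [c 2 1, c 3 1]; norm_num [Fin.ext_iff]; ring) (by rw [d7, d6, d4]; simp [c 2 1, c 3 2]; norm_num [Fin.ext_iff]; ring) (by rw [d7, d5, d4]; simp [c 3 1, c 3 2]; norm_num [Fin.ext_iff]; ring) (by rw [d7]; simp [c 0 1, c 0 2, c 0 3])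
  obtain ⟨a1, a2, a3, a4, a5⟩ := A
  refine ⟨a1, fun α => ?_⟩
  fin_cases α
  · exact a2
  · exact a3
  · exact a4
  · exact a5
def cutI (p : Pt) : ℝ := 1 - smoothTransition (8 * ‖p.2‖ ^ 2 - 1)
lemma cutI_sm : Sm cutI := contDiff_const.sub (smoothTransition.contDiff.comp ((contDiff_const.mul ((contDiff_norm_sq ℝ).comp contDiff_snd)).sub contDiff_const))
lemma W_zero_of_open {U : Set Pt} (hU : IsOpen U) (h : ∀ p ∈ U, f p = 0) (c : Wd) : ∀ p ∈ U, DWord c f p = 0 := by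
  induction c with
  | nil => exact h
  | cons k l ih => exact fun p hp => D_zero_of_open hU ih hp k
lemma cut_ex : ∃ C ≥ 1, ∀ t : ℝ, 1 ≤ t → ∃ ζ : Fn, Sm ζ ∧ (∀ p, 0 ≤ ζ p ∧ ζ p ≤ 1) ∧ (∀ x : E3, (∀ k, |x k| < t / 8) → ζ (t, x) = 1) ∧ (∀ x : E3, t / 2 < ‖x‖ → ζ (t, x) = 0) ∧ ∀ c : Wd, c.length ≤ 3 → ∀ x : E3, |DWord c ζ (t, x)| ≤ C * (t⁻¹) ^ c.length := by
  obtain ⟨C, hC, h⟩ := scaled_bound cutI_sm 1 3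
  refine ⟨C, hC, fun t ht => ⟨fun p => cutI (t⁻¹ • p), cutI_sm.scale _, fun p => ?_, fun x hx => ?_, fun x hx => ?_, fun c hc x => ?_⟩⟩
  · unfold cutI
    constructor
    · linarith [smoothTransition.le_one (8 * ‖(t⁻¹ • p).2‖ ^ 2 - 1)]
    · linarith [smoothTransition.nonneg (8 * ‖(t⁻¹ • p).2‖ ^ 2 - 1)]
  all_goals have ht0 : 0 < t := by linarith
  all_goals have hn : ∀ p : Pt, ‖(t⁻¹ • p).2‖ = ‖p.2‖ / t := fun p => by (rw [Prod.smul_snd, norm_smul, norm_inv, Real.norm_of_nonneg ht0.le]; field_simp)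
  · simp only [cutI, hn]
    rw [smoothTransition.zero_of_nonpos, sub_zero]
    rw [div_pow, norm_sq3]
    have hk : ∀ k, x k ^ 2 ≤ t ^ 2 / 64 := fun k => by
      have := sq_le_sq' (by linarith [abs_nonneg (x k), hx k]) (hx k).le
      rw [sq_abs] at this; linarith [this]
    have : (x 0 ^ 2 + x 1 ^ 2 + x 2 ^ 2) / t ^ 2 ≤ 3 / 64 := by
      rw [div_le_iff₀ (by positivity)]; linarith [hk 0, hk 1, hk 2]
    linarith
  · simp only [cutI, hn]
    rw [smoothTransition.one_of_one_le, sub_self]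
    have : 1 / 2 ≤ ‖x‖ / t := by rw [le_div_iff₀ ht0]; linarith
    nlinarith
  · by_cases hx : ‖x‖ ≤ 1 * t
    · exact (h t ht x hx).2 c hc
    · rw [W_zero_of_open (U := {p : Pt | t / 2 < ‖p.2‖}) (isOpen_lt continuous_const (by fun_prop)) (fun p hp => ?_) c]
      · rw [abs_zero]; positivity
      · show t / 2 < ‖x‖
        linarith
      · simp only [cutI, hn]
        rw [smoothTransition.one_of_one_le, sub_self]
        have : 1 / 2 ≤ ‖p.2‖ / t := by
          rw [le_div_iff₀ ht0]
          have : t / 2 < ‖p.2‖ := hp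
          linarith
        nlinarith
lemma ell (ht : 0 < t) (hf : Sm f) (sf : Sp M f) : ∫ x : E3, (∑ i : Fin 3, ∑ j : Fin 3, (Ds i (Ds j f) (t, x)) ^ 2) = ∫ x : E3, (∑ i : Fin 3, Ds i (Ds i f) (t, x)) ^ 2 := by
  have s1 : ∀ i j : Fin 3, Sm (fun p => Ds j f p * Ds i (Ds j f) p) := fun i j => (hf.D _).mul ((hf.D _).D _)
  have s2 : ∀ i j : Fin 3, Sm (fun p => Ds j f p * Ds i (Ds i f) p) := fun i j => (hf.D _).mul ((hf.D _).D _)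
  have p1 : ∀ i j : Fin 3, Sp M (fun p => Ds j f p * Ds i (Ds j f) p) := fun i j => (sf.D _).mul _
  have p2 : ∀ i j : Fin 3, Sp M (fun p => Ds j f p * Ds i (Ds i f) p) := fun i j => (sf.D _).mul _
  have key : ∀ p : Pt, (∑ i : Fin 3, ∑ j : Fin 3, (Ds i (Ds j f) p) ^ 2) - (∑ i : Fin 3, Ds i (Ds i f) p) ^ 2 = ∑ i : Fin 3, ∑ j : Fin 3, (Ds i (fun p => Ds j f p * Ds i (Ds j f) p) p - Ds j (fun p => Ds j f p * Ds i (Ds i f) p) p) := by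
    intro p
    rw [sq (∑ i : Fin 3, Ds i (Ds i f) p), Finset.sum_mul_sum, ← Finset.sum_sub_distrib]
    refine Finset.sum_congr rfl fun i _ => ?_
    rw [← Finset.sum_sub_distrib]
    refine Finset.sum_congr rfl fun j _ => ?_
    rw [D_mul (hf.D _) ((hf.D _).D _), D_mul (hf.D _) ((hf.D _).D _)]
    have : Ds i (Ds i (Ds j f)) = Ds j (Ds i (Ds i f)) := by
      rw [D_comm hf i.succ j.succ, D_comm (hf.D _) i.succ j.succ]
    simp only [this]
    ring
  have i1 : ∀ i j : Fin 3, Integrable (fun x : E3 => Ds i (fun p => Ds j f p * Ds i (Ds j f) p) (t, x)) := fun i j =>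
    slice_int ((s1 i j).D _).continuous ((p1 i j).D _) ht
  have i2 : ∀ i j : Fin 3, Integrable (fun x : E3 => Ds j (fun p => Ds j f p * Ds i (Ds i f) p) (t, x)) := fun i j =>
    slice_int ((s2 i j).D _).continuous ((p2 i j).D _) ht
  have i3 : Integrable (fun x : E3 => ∑ i : Fin 3, ∑ j : Fin 3, (Ds i (Ds j f) (t, x)) ^ 2) := integrable_finset_sum _ fun i _ => integrable_finset_sum _ fun j _ =>
      slice_int (((hf.D j.succ).D i.succ).pow 2).continuous ((sf.D _).D _).sq ht
  have i4 := slice_int (f := fun p => (∑ i : Fin 3, Ds i (Ds i f) p) ^ 2) ((ContDiff.sum fun i _ => (hf.D i.succ).D i.succ).pow 2).continuous (Sp.sum _ fun i _ => (sf.D _).D _).sq ht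
  have i5 : ∀ i j : Fin 3, Integrable (fun x : E3 => Ds i (fun p => Ds j f p * Ds i (Ds j f) p) (t, x) - Ds j (fun p => Ds j f p * Ds i (Ds i f) p) (t, x)) := fun i j => (i1 i j).sub (i2 i j)
  rw [← sub_eq_zero, ← integral_sub i3 i4]
  simp only [key]
  rw [integral_finset_sum _ fun i _ => integrable_finset_sum _ fun j _ => i5 i j]
  refine Finset.sum_eq_zero fun i _ => ?_
  rw [integral_finset_sum _ fun j _ => i5 i j]
  refine Finset.sum_eq_zero fun j _ => ?_
  rw [integral_sub (i1 i j) (i2 i j), int_dx (s1 i j) (p1 i j) ht, int_dx (s2 i j) (p2 i j) ht, sub_zero]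
def er (N : ℕ) (lam : ℝ) (ψ : Fn) (p : Pt) : ℝ := Wt (-lam) p ^ 2 * YG2 N ψ p + Wt (-lam) p ^ 4 * ψ p ^ 2
lemma er_sm (h : Sm ψ) : Sm (er N lam ψ) := (((Wt_sm _).pow 2).mul (YG2_sm h)).add (((Wt_sm _).pow 4).mul (h.pow 2))
lemma er_sp (h : Sp M ψ) : Sp M (er N lam ψ) := ((YG2_sp h).mul' _).add (h.sq.mul' _)
lemma er_nonneg (N : ℕ) (lam : ℝ) (ψ : Fn) (p : Pt) : 0 ≤ er N lam ψ p := by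
  have := YG2_nonneg N ψ p
  unfold er; positivity
lemma er_1 (N : ℕ) (lam : ℝ) (ψ : Fn) (p : Pt) : Wt (-lam) p * √(YG2 N ψ p) ≤ √(er N lam ψ p) := by
  refine Real.le_sqrt_of_sq_le ?_
  rw [mul_pow, Real.sq_sqrt (YG2_nonneg _ _ _)]
  unfold er; nlinarith [sq_nonneg (Wt (-lam) p ^ 2 * ψ p)]
lemma er_2 (N : ℕ) (lam : ℝ) (ψ : Fn) (p : Pt) : Wt (-lam) p ^ 2 * |ψ p| ≤ √(er N lam ψ p) := by
  refine Real.le_sqrt_of_sq_le ?_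
  rw [mul_pow, sq_abs]
  have := mul_nonneg (sq_nonneg (Wt (-lam) p)) (YG2_nonneg N ψ p)
  unfold er; linarith
lemma er_sq (N : ℕ) (lam : ℝ) (ψ : Fn) (p : Pt) : √(er N lam ψ p) ^ 2 = er N lam ψ p := Real.sq_sqrt (er_nonneg _ _ _ _)
section
section
end
lemma Wt_t (ht : 0 < t) (a : ℝ) (x : E3) : Wt a (t, x) = (1 + t) ^ a := Wt_eq a (p := (t, x)) ht.le
lemma Hyp.er_int (h : Hyp μ lam γ M N ψ E) (ht : 0 < t) : ∫ x : E3, er N lam ψ (t, x) ≤ 2 * (E * ((1 + t) ^ (-lam)) ^ 2) ^ 2 := by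
  simp only [er, Wt_t ht]
  have i1 := slice_int (YG2_sm (N := N) h.sm).continuous (YG2_sp h.sp) ht
  have i2 := slice_int (h.sm.pow 2).continuous h.sp.sq ht
  rw [integral_add (i1.const_mul _) (i2.const_mul _), integral_const_mul, integral_const_mul]
  have h1 := h.en t ht
  have h2 := h.en0 t ht
  rw [div_eq_mul_inv, ← Real.rpow_neg (by linarith)] at h1
  set w := (1 + t) ^ (-lam)
  have a1 := mll h1 (sq_nonneg w)
  have a2 := mll h2 (by positivity : (0:ℝ) ≤ w ^ 4)
  nlinarith
lemma Hyp.tinv (h : Hyp μ lam γ M N ψ E) (ht : 1 ≤ t) (x : E3) : t⁻¹ ≤ 2 * Wt (-lam) (t, x) := by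
  have := h.W2 (t := t) (by linarith)
  rw [Wt_t (by linarith), Real.rpow_neg (by linarith)]
  have h1 := h.W1 (t := t) (by linarith)
  rw [inv_le_comm₀ (by linarith) (by positivity), mul_inv, inv_inv]
  linarith
lemma Hyp.tB (h : Hyp μ lam γ M N ψ E) (ht : 1 ≤ t) (x : E3) : t⁻¹ * √(YG2 N ψ (t, x)) ≤ 2 * √(er N lam ψ (t, x)) := by
  have := mlr (h.tinv ht x) (Real.sqrt_nonneg (YG2 N ψ (t, x)))
  linarith [er_1 N lam ψ (t, x)]
lemma Hyp.tψ (h : Hyp μ lam γ M N ψ E) (ht : 1 ≤ t) (x : E3) : (t⁻¹) ^ 2 * |ψ (t, x)| ≤ 4 * √(er N lam ψ (t, x)) := by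
  have h0 : 0 ≤ t⁻¹ := inv_nonneg.2 (by linarith)
  have h1 := pow_le_pow_left₀ h0 (h.tinv ht x) 2
  have := mlr h1 (abs_nonneg (ψ (t, x)))
  nlinarith [er_2 N lam ψ (t, x)]
lemma W_abs_YG (p : Pt) (b : Wd) (h1 : 1 ≤ b.length) (h2 : b.length ≤ N + 1) : |DWord b ψ p| ≤ √(YG2 N ψ p) := Real.abs_le_sqrt (W_le_YG ψ p b h1 h2)
structure Cut (C t : ℝ) (ζ : Fn) : Prop where
  sm : Sm ζ
  n0 : ∀ p, 0 ≤ ζ p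
  n1 : ∀ p, ζ p ≤ 1
  out : ∀ x : E3, t / 2 < ‖x‖ → ζ (t, x) = 0
  b : ∀ c : Wd, c.length ≤ 3 → ∀ x : E3, |DWord c ζ (t, x)| ≤ C * (t⁻¹) ^ c.length
def bx (v : Fn) (p : Pt) : ℝ := Dop 0 (Dop 0 v) p - ∑ i : Fin 3, Ds i (Ds i v) p
lemma bx_sm {v : Fn} (h : Sm v) : Sm (bx v) := ((h.D _).D _).sub (ContDiff.sum fun i _ => (h.D _).D _)
lemma cut_err {C : ℝ} (hζ : Cut C t ζ) (hC : 1 ≤ C) (h : Hyp μ lam γ M N ψ E) (ht : 1 ≤ t) (d : Wd) (hd : d.length + 1 ≤ N) (x : E3) (i j : Fin 4) : |Dop i (Dop j (fun p => ζ p * DWord d ψ p)) (t, x) - ζ (t, x) * Dop i (Dop j (DWord d ψ)) (t, x)| ≤ 10 * C * √(er N lam ψ (t, x)) := by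
  have sv := h.sm.W d
  have ht0 : 0 < t := by linarith
  have ti := inv_le_one_of_one_le₀ ht
  have ti0 := inv_pos.2 ht0
  rw [D_mul hζ.sm sv, D_add ((hζ.sm.D _).mul sv) (hζ.sm.mul (sv.D _)), D_mul (hζ.sm.D _) sv, D_mul hζ.sm (sv.D _)]
  have b1 := hζ.b [i] (by simp) x
  have b2 := hζ.b [j] (by simp) x
  have b3 := hζ.b [i, j] (by simp) x
  simp only [DWord, List.length_cons, List.length_nil, zero_add, pow_one] at b1 b2 b3
  have v1 := W_abs_YG (N := N) (ψ := ψ) (t, x) (i :: d) (by simp) (by simp; omega)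
  have v2 := W_abs_YG (N := N) (ψ := ψ) (t, x) (j :: d) (by simp) (by simp; omega)
  simp only [DWord] at v1 v2
  have v0 : |DWord d ψ (t, x)| ≤ √(YG2 N ψ (t, x)) + |ψ (t, x)| := by
    cases d with
    | nil => simp only [DWord]; linarith [Real.sqrt_nonneg (YG2 N ψ (t, x))]
    | cons k l => exact (W_abs_YG (N := N) (t, x) (k :: l) (by simp) (by omega)).trans (by linarith [abs_nonneg (ψ (t, x))])
  have e1 := h.tB ht x
  have e2 := h.tψ ht x
  have hB := Real.sqrt_nonneg (YG2 N ψ (t, x))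
  set B := √(YG2 N ψ (t, x))
  set ρ := √(er N lam ψ (t, x))
  have k1 : |Dop i ζ (t, x) * Dop j (DWord d ψ) (t, x)| ≤ C * t⁻¹ * B := by
    rw [abs_mul]; exact mul_le_mul b1 v2 (abs_nonneg _) (by positivity)
  have k2 : |Dop j ζ (t, x) * Dop i (DWord d ψ) (t, x)| ≤ C * t⁻¹ * B := by
    rw [abs_mul]; exact mul_le_mul b2 v1 (abs_nonneg _) (by positivity)
  have k3 : |Dop i (Dop j ζ) (t, x) * DWord d ψ (t, x)| ≤ C * t⁻¹ ^ 2 * (B + |ψ (t, x)|) := by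
    rw [abs_mul]; exact mul_le_mul b3 v0 (abs_nonneg _) (by positivity)
  have k4 : C * t⁻¹ ^ 2 * B ≤ C * t⁻¹ * B := by
    gcongr; nlinarith
  have e1' := mll e1 (by linarith : 0 ≤ C)
  have e2' := mll e2 (by linarith : 0 ≤ C)
  refine (le_of_eq ?_).trans ((abs_add_three _ _ _).trans (by linarith [k1, k2, k3] : |Dop i (Dop j ζ) (t, x) * DWord d ψ (t, x)| + |Dop j ζ (t, x) * Dop i (DWord d ψ) (t, x)| + |Dop i ζ (t, x) * Dop j (DWord d ψ) (t, x)| ≤ _))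
  congr 1; ring
lemma cut_ell {C : ℝ} (hζ : Cut C t ζ) (hC : 1 ≤ C) (h : Hyp μ lam γ M N ψ E) (ht : 1 ≤ t) (d : Wd) (hd : d.length + 1 ≤ N) : ∫ x : E3, (∑ α, ∑ β, (ζ (t, x) * Dop α (Dop β (DWord d ψ)) (t, x)) ^ 2) ≤ 100000 * C ^ 2 * ∫ x : E3, ((ζ (t, x) * bx (DWord d ψ) (t, x)) ^ 2 + er N lam ψ (t, x)) := by
  have sv := h.sm.W d
  have spv := h.sp.W d
  have ht0 : 0 < t := by linarith
  set v := DWord d ψ with hv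
  set f : Fn := fun p => ζ p * v p with hf
  have sf : Sm f := hζ.sm.mul sv
  have spf : Sp M f := spv.mul' ζ
  have I2 : ∀ i j : Fin 4, Integrable (fun x : E3 => (ζ (t, x) * Dop i (Dop j v) (t, x)) ^ 2) := fun i j =>
    slice_int (f := fun p => (ζ p * Dop i (Dop j v) p) ^ 2) ((hζ.sm.mul ((sv.D j).D i)).pow 2).continuous (((spv.D _).D _).mul' _).sq ht0
  have Ib := slice_int (f := fun p => (ζ p * bx v p) ^ 2) ((hζ.sm.mul (bx_sm sv)).pow 2).continuous (((((spv.D _).D _).sub (Sp.sum _ fun i _ => (spv.D _).D _))).mul' _).sq ht0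
  have Ie : Integrable (fun x : E3 => er N lam ψ (t, x)) := slice_int (er_sm h.sm).continuous (er_sp h.sp) ht0
  have If : Integrable (fun x : E3 => ∑ i : Fin 3, ∑ j : Fin 3, (Ds i (Ds j f) (t, x)) ^ 2) := integrable_finset_sum _ fun i _ => integrable_finset_sum _ fun j _ =>
      slice_int (((sf.D j.succ).D i.succ).pow 2).continuous ((spf.D _).D _).sq ht0
  have Il := slice_int (f := fun p => (∑ i : Fin 3, Ds i (Ds i f) p) ^ 2) ((ContDiff.sum fun i _ => (sf.D i.succ).D i.succ).pow 2).continuous (Sp.sum _ fun i _ => (spf.D _).D _).sq ht0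
  have ks : ∀ x : E3, |ζ (t, x) * ∑ i : Fin 3, Ds i (Ds i v) (t, x)| ≤ 2 * |ζ (t, x) * bx v (t, x)| + 40 * √(er N lam ψ (t, x)) ∧ ∀ α, |ζ (t, x) * Dop α (Dop 0 v) (t, x)| ≤ 3 * |ζ (t, x) * bx v (t, x)| + 50 * √(er N lam ψ (t, x)) := by
    intro x
    have r0 := Real.sqrt_nonneg (er N lam ψ (t, x))
    by_cases hx : t / 2 < ‖x‖
    · rw [hζ.out x hx]; simp
    push Not at hx
    have z0 := hζ.n0 (t, x)
    have z1 := hζ.n1 (t, x)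
    have K := KS_pt sv (B := √(YG2 N ψ (t, x))) ht hx (fun β => W_abs_YG (N := N) (t, x) (β :: d) (by simp) (by simp; omega)) (fun k β => Real.abs_le_sqrt (by
        rw [hv, DW_GW]
        exact le_YG2 ψ (t, x) (k :: up d) (by simp [up_len]; omega) β))
    have e1 := h.tB ht x
    rw [div_eq_inv_mul] at K
    have key : ∀ (X b : ℝ) (n m : ℝ), 0 ≤ m → |X| ≤ n * |b| + m * (t⁻¹ * √(YG2 N ψ (t, x))) → |ζ (t, x) * X| ≤ n * |ζ (t, x) * b| + 2 * m * √(er N lam ψ (t, x)) := by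
      intro X b n m hm hX
      rw [abs_mul, abs_mul, abs_of_nonneg z0]
      have a1 := mll hX z0
      have a2 := mll e1 hm
      have a3 : 0 ≤ m * (t⁻¹ * √(YG2 N ψ (t, x))) := by positivity
      nlinarith
    refine ⟨?_, fun α => ?_⟩
    · have := key _ _ 2 20 (by norm_num) K.1
      unfold bx; linarith
    · have := key _ _ 3 25 (by norm_num) (K.2 α)
      unfold bx; linarith
  have p1 : ∀ x : E3, (∑ α, ∑ β, (ζ (t, x) * Dop α (Dop β v) (t, x)) ^ 2) ≤ 2 * (∑ i : Fin 3, ∑ j : Fin 3, (Ds i (Ds j f) (t, x)) ^ 2) + (126 * (ζ (t, x) * bx v (t, x)) ^ 2 + (35000 + 1800 * C ^ 2) * er N lam ψ (t, x)) := by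
    intro x
    have r2 := er_sq N lam ψ (t, x)
    have hz : ∀ α, (ζ (t, x) * Dop α (Dop 0 v) (t, x)) ^ 2 ≤ 18 * (ζ (t, x) * bx v (t, x)) ^ 2 + 5000 * er N lam ψ (t, x) := fun α => by
      have := (ks x).2 α
      rw [← sq_abs, ← sq_abs (ζ (t, x) * bx v (t, x)), ← r2]
      nlinarith [abs_nonneg (ζ (t, x) * Dop α (Dop 0 v) (t, x)), sq_nonneg (3 * |ζ (t, x) * bx v (t, x)| - 50 * √(er N lam ψ (t, x)))]
    have hs : ∀ i j : Fin 3, (ζ (t, x) * Ds i (Ds j v) (t, x)) ^ 2 ≤ 2 * (Ds i (Ds j f) (t, x)) ^ 2 + 200 * C ^ 2 * er N lam ψ (t, x) := fun i j => by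
      have := cut_err hζ hC h ht d hd x i.succ j.succ
      rw [← hv, ← hf] at this
      have := sq_le_sq' (by linarith [abs_nonneg (Ds i (Ds j f) (t, x) - ζ (t, x) * Ds i (Ds j v) (t, x))]) this
      rw [sq_abs, mul_pow, r2] at this
      nlinarith [sq_nonneg (2 * Ds i (Ds j f) (t, x) - ζ (t, x) * Ds i (Ds j v) (t, x))]
    have hc : ∀ j : Fin 3, Dop 0 (Ds j v) = Ds j (Dop 0 v) := fun j => D_comm sv _ _
    simp only [Fin.sum_univ_succ (n := 3)]
    simp only [hc]
    simp only [Fin.sum_univ_three]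
    linarith [hz 0, hz (Fin.succ 0), hz (Fin.succ 1), hz (Fin.succ 2), hs 0 0, hs 0 1, hs 0 2, hs 1 0, hs 1 1, hs 1 2, hs 2 0, hs 2 1, hs 2 2]
  have p2 : ∀ x : E3, (∑ i : Fin 3, Ds i (Ds i f) (t, x)) ^ 2 ≤ 8 * (ζ (t, x) * bx v (t, x)) ^ 2 + 2 * (70 * C) ^ 2 * er N lam ψ (t, x) := by
    intro x
    have r2 := er_sq N lam ψ (t, x)
    have r0 := Real.sqrt_nonneg (er N lam ψ (t, x))
    have a1 := (ks x).1
    have a2 : ∀ i : Fin 3, _ := fun i => cut_err hζ hC h ht d hd x i.succ i.succ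
    rw [← hv, ← hf] at a2
    set ρ := √(er N lam ψ (t, x))
    have a3 : |∑ i : Fin 3, Ds i (Ds i f) (t, x)| ≤ 2 * |ζ (t, x) * bx v (t, x)| + 70 * C * ρ := by
      have e : ∑ i : Fin 3, Ds i (Ds i f) (t, x) = (ζ (t, x) * ∑ i : Fin 3, Ds i (Ds i v) (t, x)) + ∑ i : Fin 3, (Ds i (Ds i f) (t, x) - ζ (t, x) * Ds i (Ds i v) (t, x)) := by
        rw [Finset.sum_sub_distrib, Finset.mul_sum]; ring
      have a4 : |∑ i : Fin 3, (Ds i (Ds i f) (t, x) - ζ (t, x) * Ds i (Ds i v) (t, x))| ≤ 3 * (10 * C * ρ) := by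
        refine (Finset.abs_sum_le_sum_abs _ _).trans ((Finset.sum_le_sum fun i _ => a2 i).trans ?_)
        simp
      rw [e]
      refine (abs_add_le _ _).trans ?_
      have : 40 * ρ ≤ 40 * C * ρ := by nlinarith
      linarith
    rw [← sq_abs, ← sq_abs (ζ (t, x) * bx v (t, x)), ← r2]
    nlinarith [abs_nonneg (∑ i : Fin 3, Ds i (Ds i f) (t, x)), sq_nonneg (2 * |ζ (t, x) * bx v (t, x)| - 70 * C * ρ)]
  have q2 := integral_mono Il ((Ib.const_mul 8).add (Ie.const_mul (2 * (70 * C) ^ 2))) p2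
  have Ibe : Integrable (fun x : E3 => 126 * (ζ (t, x) * bx v (t, x)) ^ 2 + (35000 + 1800 * C ^ 2) * er N lam ψ (t, x)) := (Ib.const_mul 126).add (Ie.const_mul (35000 + 1800 * C ^ 2))
  have q1 := integral_mono (integrable_finset_sum _ fun α _ => integrable_finset_sum _ fun β _ => I2 α β) ((If.const_mul 2).add Ibe) p1
  simp only [Pi.add_apply] at q1 q2
  rw [integral_add (Ib.const_mul 8) (Ie.const_mul (2 * (70 * C) ^ 2)), integral_const_mul, integral_const_mul] at q2
  rw [integral_add (If.const_mul 2) Ibe, integral_const_mul, ell ht0 sf spf] at q1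
  rw [integral_add (Ib.const_mul 126) (Ie.const_mul (35000 + 1800 * C ^ 2)), integral_const_mul, integral_const_mul] at q1
  rw [integral_add Ib Ie]
  have n1 : 0 ≤ ∫ x : E3, (ζ (t, x) * bx v (t, x)) ^ 2 := integral_nonneg fun _ => sq_nonneg _
  have n2 : 0 ≤ ∫ x : E3, er N lam ψ (t, x) := integral_nonneg fun _ => er_nonneg _ _ _ _
  set a := ∫ x : E3, (ζ (t, x) * bx v (t, x)) ^ 2
  set e := ∫ x : E3, er N lam ψ (t, x)
  have hC2 : 1 ≤ C ^ 2 := one_le_pow₀ hC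
  have m1 := mlr hC2 n1
  have m2 := mlr hC2 n2
  nlinarith
end
def z2 (R : ℕ) (ψ : Fn) (p : Pt) : ℝ := wsum R (fun d : Wd => ∑ α, ∑ β, (Dop α (Dop β (DWord d ψ)) p) ^ 2)
lemma z2_sm {R : ℕ} (h : Sm ψ) : Sm (z2 R ψ) := wsum_sm fun l => ContDiff.sum fun α _ => ContDiff.sum fun β _ => (((h.W l).D β).D α).pow 2
lemma z2_sp {R : ℕ} (h : Sp M ψ) : Sp M (z2 R ψ) := wsum_sp fun l => Sp.sum _ fun α _ => Sp.sum _ fun β _ => (((h.W l).D β).D α).sq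
lemma z2_nonneg (R : ℕ) (ψ : Fn) (p : Pt) : 0 ≤ z2 R ψ p := wsum_nonneg fun _ => Finset.sum_nonneg fun _ _ => Finset.sum_nonneg fun _ _ => sq_nonneg _
lemma le_z2 {R : ℕ} (ψ : Fn) (p : Pt) (d : Wd) (hd : d.length ≤ R) (α β : Fin 4) : (Dop α (Dop β (DWord d ψ)) p) ^ 2 ≤ z2 R ψ p := ((Finset.single_le_sum (f := fun β => (Dop α (Dop β (DWord d ψ)) p) ^ 2) (fun _ _ => sq_nonneg _) (Finset.mem_univ β)).trans (Finset.single_le_sum (f := fun α => ∑ β, (Dop α (Dop β (DWord d ψ)) p) ^ 2) (fun _ _ => Finset.sum_nonneg fun _ _ => sq_nonneg _) (Finset.mem_univ α))).trans (le_wsum (F := fun d : Wd => ∑ α, ∑ β, (Dop α (Dop β (DWord d ψ)) p) ^ 2) (fun _ => Finset.sum_nonneg fun _ _ => Finset.sum_nonneg fun _ _ => sq_nonneg _) d hd)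
section
section
end
lemma Hyp.PH1 (h : Hyp μ lam γ M N ψ E) (hE : 4 * E ≤ 1) (ht : 0 < t) (x : E3) : PH N (N - 2) lam ψ (t, x) (4 * E) 1 (√(YG2 N ψ (t, x))) := by
  have hN := h.hN
  have hw := h.W1 ht
  have hE0 := h.E0
  have d1 : ∀ b : Wd, 1 ≤ b.length → b.length ≤ N - 2 → |DWord b ψ (t, x)| ≤ 4 * E / Wt lam (t, x) := fun b hb hb' => by
    refine (h.d1 ht x b hb (by omega)).trans ?_
    rw [Wt_t ht, mul_div_assoc]
    have : 0 ≤ E / (1 + t) ^ lam := by positivity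
    linarith
  exact ⟨ht, by linarith, hE, by rw [Wt_t ht]; exact inv_le_one_of_one_le₀ hw, le_rfl, Real.sqrt_nonneg _, h.d0 ht x, d1,
    fun b hb hb' => by rw [mul_one]; exact d1 b (by omega) hb', fun b hb hb' => W_abs_YG _ b hb hb', by omega, by omega⟩
lemma bx_bd (μ lam γ : ℝ) (hl0 : 0 ≤ lam) (h1 : lam ≤ 1) (N : ℕ) (hN : 8 ≤ N) : ∃ C ≥ 1, ∀ (M E : ℝ) (ψ : Fn), Hyp μ lam γ M N ψ E → 4 * E ≤ 1 → ∀ t : ℝ, 1 ≤ t → ∀ (x : E3) (z s : ℝ), 0 ≤ z → 0 ≤ s → ∀ d : Wd, d.length ≤ N → (∀ c : Wd, c.length ≤ d.length → ∀ α β, |Dop α (Dop β (DWord c ψ)) (t, x)| ≤ z) → (∀ c : Wd, c.length + 4 ≤ d.length → ∀ α β, |Dop α (Dop β (DWord c ψ)) (t, x)| ≤ s) → |bx (DWord d ψ) (t, x)| ≤ C * (√(er N lam ψ (t, x)) + E * z + Wt lam (t, x) * √(YG2 N ψ (t, x)) * s) := by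
  obtain ⟨C1, hC1, k1⟩ := int_nl μ lam γ hl0 h1 N (N - 2) (by omega)
  obtain ⟨C2, hC2, k2⟩ := lin_bd μ lam hl0 h1 N
  obtain ⟨C3, hC3, k3⟩ := quad_bd lam (2 * lam) μ h1 N (N - 2)
  refine ⟨64 * C1 + 3 * C2 + 3 * C3, by linarith, fun M E ψ h hE t ht x z s hz hs d hd hzc hsc => ?_⟩
  have ht0 : 0 < t := by linarith
  have P := h.PH1 hE ht0 x
  have a1 := k1 ψ (t, x) (4 * E) _ z s h.sm P hz hs d hd hzc hsc
  have a2 := k2 ψ (t, x) _ h.sm ht0 P.Y0 P.b3 d hd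
  have a3 := k3 ψ (t, x) (4 * E) 1 _ h.sm P d hd
  have r1 := er_1 N lam ψ (t, x)
  have r2 := er_2 N lam ψ (t, x)
  rw [← Wt_neg] at a2 a3
  have hB := P.Y0
  set B := √(YG2 N ψ (t, x))
  set ρ := √(er N lam ψ (t, x))
  have hE0 := h.E0
  have hw := Wt_pos lam (t, x)
  have hw' := Wt_pos (-lam) (t, x)
  have hρ : 0 ≤ ρ := Real.sqrt_nonneg _
  set w := Wt lam (t, x)
  set w' := Wt (-lam) (t, x)
  have hw2 : Wt (-2) (t, x) ≤ w' ^ 2 := by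
    rw [sq, Wt_mul]; exact Wt_mono (by linarith) ht0.le
  have hw1 : w' ≤ 1 := Wt_le_one (by linarith) ht0
  have hl : lam * (1 - lam) ≤ 1 := by nlinarith
  have hl' : 0 ≤ lam * (1 - lam) := by nlinarith
  have b3 : lam * (1 - lam) * Wt (-2) (t, x) * (B + |ψ (t, x)|) ≤ 2 * ρ := by
    have c0 := Wt_pos (-2) (t, x)
    calc lam * (1 - lam) * Wt (-2) (t, x) * (B + |ψ (t, x)|) ≤ 1 * w' ^ 2 * (B + |ψ (t, x)|) := by gcongr
      _ = w' * (w' * B) + w' ^ 2 * |ψ (t, x)| := by ring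
      _ ≤ 1 * (w' * B) + w' ^ 2 * |ψ (t, x)| := by gcongr
      _ ≤ _ := by linarith
  have A1 : |∑ α, ∑ β, DWord d (fun p => gab μ lam γ ψ α β p * Dop α (Dop β ψ) p) (t, x)| ≤ 16 * (C1 * (4 * E * z + w * B * s)) := by
    refine (Finset.abs_sum_le_sum_abs _ _).trans ((Finset.sum_le_sum fun α _ => (Finset.abs_sum_le_sum_abs _ _).trans (Finset.sum_le_sum fun β _ => a1 α β)).trans ?_)
    simp only [Finset.sum_const, Finset.card_univ, Fintype.card_fin, nsmul_eq_mul]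
    apply le_of_eq; push_cast; ring
  have A3 : |∑ i : Fin 3, DWord d (fun p => mc lam (2 * lam) μ p * (Ds i ψ p * Ds i ψ p)) (t, x)| ≤ 3 * (C3 * ρ) := by
    refine (Finset.abs_sum_le_sum_abs _ _).trans ((Finset.sum_le_sum fun i _ => (a3 i.succ).trans (mll (?_ : _ ≤ ρ) (by linarith))).trans ?_)
    · calc 4 * E * w' * B ≤ 1 * w' * B := by gcongr
        _ ≤ ρ := by linarith
    · simp
  have A2 : C2 * (w' * B) ≤ C2 * ρ := by gcongr
  have A4 : C2 * (lam * (1 - lam) * Wt (-2) (t, x) * (B + |ψ (t, x)|)) ≤ C2 * (2 * ρ) := by gcongr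
  unfold bx
  rw [eqU_word h.sm h.eq d (t, x) ht0]
  refine (abs_add_le _ _).trans ?_
  refine (add_le_add ((abs_add_three _ _ _)) le_rfl).trans ?_
  rw [abs_mul (-1) (DWord d _ _), abs_mul (-1) (∑ i : Fin 3, _), abs_neg, abs_one, one_mul, one_mul]
  have n1 : 0 ≤ E * z := by positivity
  have n2 : 0 ≤ w * B * s := by positivity
  have m1 : 0 ≤ C1 * ρ := by positivity
  have m2 : 0 ≤ C2 * (E * z) := by positivity
  have m3 : 0 ≤ C3 * (E * z) := by positivity
  have m4 : 0 ≤ C2 * (w * B * s) := by positivity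
  have m5 : 0 ≤ C3 * (w * B * s) := by positivity
  have m6 : 0 ≤ C1 * (w * B * s) := by positivity
  nlinarith [a2.2.1, a2.2.2]
lemma sup_bd {C : ℝ} (hζ : Cut C t ζ) (hC : 1 ≤ C) (h : Hyp μ lam γ M N ψ E) (ht : 1 ≤ t) {R : ℕ} (hR : R + 1 ≤ N) (d : Wd) (hd : d.length + 3 ≤ R) (α β : Fin 4) (x : E3) : (ζ (t, x) * Dop α (Dop β (DWord d ψ)) (t, x)) ^ 2 ≤ 8 * (512 * C ^ 2 * ∫ x : E3, (ζ (t, x) ^ 2 * z2 R ψ (t, x) + er N lam ψ (t, x))) := by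
  have ht0 : 0 < t := by linarith
  have ti := inv_le_one_of_one_le₀ ht
  have ti0 := inv_pos.2 ht0
  have sv := ((h.sm.W d).D β).D α
  have spv := ((h.sp.W d).D β).D α
  have sΦ : Sm (fun p => 512 * C ^ 2 * (ζ p ^ 2 * z2 R ψ p + er N lam ψ p)) := contDiff_const.mul (((hζ.sm.pow 2).mul (z2_sm h.sm)).add (er_sm h.sm))
  have pΦ : Sp M (fun p => 512 * C ^ 2 * (ζ p ^ 2 * z2 R ψ p + er N lam ψ p)) := (((z2_sp h.sp).mul' _).add (er_sp h.sp)).mul' _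
  rw [← integral_const_mul]
  refine sob_flat (f := fun p => ζ p * Dop α (Dop β (DWord d ψ)) p) ht0 (hζ.sm.mul sv) (spv.mul' ζ) (slice_cont sΦ t) (slice_cs pΦ ht0) (fun c hc y => ?_) x
  have hB := Real.sqrt_nonneg (YG2 N ψ (t, y))
  have e1 := h.tB ht y
  have r2 := er_sq N lam ψ (t, y)
  have r0 := er_nonneg N lam ψ (t, y)
  have ew : ∀ c : Wd, DWord c (Dop α (Dop β (DWord d ψ))) = Dop α (Dop β (DWord (c ++ d) ψ)) := fun c => by
    rw [W_D ((h.sm.W d).D β), W_D (h.sm.W d), W_append]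
  have L := leib' c hζ.sm sv (t, y) (C * (t⁻¹ * √(YG2 N ψ (t, y)))) (by positivity) (fun b c' hb hbc => by
    rw [ew, ← mul_assoc]
    refine mul_le_mul ((hζ.b b (by omega) y).trans ?_) ?_ (abs_nonneg _) (by positivity)
    · have : t⁻¹ ^ b.length ≤ t⁻¹ ^ 1 := pow_le_pow_of_le_one ti0.le ti hb
      rw [pow_one] at this
      gcongr
    · exact W_abs_YG (N := N) (t, y) (α :: β :: (c' ++ d)) (by simp) (by simp; omega))
  have hz := le_z2 (R := R) ψ (t, y) (c ++ d) (by simp; omega) α β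
  rw [ew] at L
  have p8 : (2:ℝ) ^ c.length ≤ 8 := by
    calc (2:ℝ) ^ c.length ≤ 2 ^ 3 := pow_le_pow_right₀ (by norm_num) hc
      _ = 8 := by norm_num
  set X := DWord c (fun p => ζ p * Dop α (Dop β (DWord d ψ)) p) (t, y)
  set V := Dop α (Dop β (DWord (c ++ d) ψ)) (t, y)
  set ρ := √(er N lam ψ (t, y))
  have L2 : |X - ζ (t, y) * V| ≤ 16 * C * ρ := by
    refine L.trans ?_
    calc (2:ℝ) ^ c.length * (C * (t⁻¹ * √(YG2 N ψ (t, y)))) ≤ 8 * (C * (2 * ρ)) := by gcongr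
      _ = _ := by ring
  have L3 := sq_le_sq' (by linarith [abs_nonneg (X - ζ (t, y) * V)]) L2
  rw [sq_abs, mul_pow, r2] at L3
  have hC2 : 1 ≤ C ^ 2 := one_le_pow₀ hC
  have hzz : ζ (t, y) ^ 2 * V ^ 2 ≤ ζ (t, y) ^ 2 * z2 R ψ (t, y) := by gcongr
  have hz0 : 0 ≤ ζ (t, y) ^ 2 * z2 R ψ (t, y) := mul_nonneg (sq_nonneg _) (z2_nonneg _ _ _)
  have hz1 := mlr hC2 hz0
  nlinarith [sq_nonneg (X - 2 * (ζ (t, y) * V))]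
end
set_option maxHeartbeats 1000000 in
lemma Z_bd (μ lam γ : ℝ) (hl0 : 0 ≤ lam) (h1 : lam ≤ 1) (N R : ℕ) (hN : 8 ≤ N) (hR : R + 1 ≤ N) (C : ℝ) (hC : 1 ≤ C) : ∃ C' ≥ 1, ∃ δ > 0, ∀ (M E : ℝ) (ψ : Fn), Hyp μ lam γ M N ψ E → E ≤ δ → ∀ (t : ℝ) (ζ : Fn), 1 ≤ t → Cut C t ζ → ∫ x : E3, (ζ (t, x) ^ 2 * z2 R ψ (t, x) + er N lam ψ (t, x)) ≤ C' * ∫ x : E3, er N lam ψ (t, x) := by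
  obtain ⟨C1, hC1, k1⟩ := bx_bd μ lam γ hl0 h1 N hN
  obtain ⟨n, hn⟩ : ∃ n, n = wsum R (fun _ : Wd => (1:ℝ)) := ⟨_, rfl⟩
  have hn0 := hn ▸ wsum_nonneg fun _ => zero_le_one
  obtain ⟨K, hK⟩ : ∃ K, K = n * (100000 * C ^ 2 * (1 + 3 * C1 ^ 2 * (1 + 4096 * C ^ 2))) := ⟨_, rfl⟩
  have hK0 : 0 ≤ K := by rw [hK]; positivity
  have hC12 : 1 ≤ C1 ^ 2 := one_le_pow₀ hC1
  have hC2 : 1 ≤ C ^ 2 := one_le_pow₀ hC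
  refine ⟨2 * K + 1, by linarith, 1 / (4 * (K + 1)), by positivity, fun M E ψ h hE t ζ ht hζ => ?_⟩
  have ht0 : 0 < t := by linarith
  have hE0 := h.E0
  have hE1 : 4 * (K + 1) * E ≤ 1 := by
    have := mll hE (by positivity : 0 ≤ 4 * (K + 1))
    rwa [mul_one_div_cancel (by positivity)] at this
  have hE4 : 4 * E ≤ 1 := by nlinarith
  have hKE : K * E ^ 2 ≤ 1 / 4 := by nlinarith
  have Iz : Integrable (fun x : E3 => ζ (t, x) ^ 2 * z2 R ψ (t, x)) := slice_int (f := fun p => ζ p ^ 2 * z2 R ψ p) ((hζ.sm.pow 2).mul (z2_sm h.sm)).continuous ((z2_sp h.sp).mul' _) ht0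
  have Ie : Integrable (fun x : E3 => er N lam ψ (t, x)) := slice_int (er_sm h.sm).continuous (er_sp h.sp) ht0
  have IY : Integrable (fun x : E3 => YG2 N ψ (t, x)) := slice_int (YG2_sm h.sm).continuous (YG2_sp h.sp) ht0
  set e := ∫ x : E3, er N lam ψ (t, x) with he
  set Z := ∫ x : E3, ζ (t, x) ^ 2 * z2 R ψ (t, x) with hZ
  have he0 : 0 ≤ e := integral_nonneg fun _ => er_nonneg _ _ _ _
  have hZ0 : 0 ≤ Z := integral_nonneg fun _ => mul_nonneg (sq_nonneg _) (z2_nonneg _ _ _)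
  have eS := integral_add Iz Ie
  obtain ⟨S2, hS2⟩ : ∃ S2, S2 = 4096 * C ^ 2 * (Z + e) := ⟨_, rfl⟩
  have hS0 : 0 ≤ S2 := by rw [hS2]; positivity
  have sup : ∀ (d : Wd), d.length + 3 ≤ R → ∀ (α β : Fin 4) (x : E3), |ζ (t, x) * Dop α (Dop β (DWord d ψ)) (t, x)| ≤ √S2 := fun d hd α β x => by
    refine Real.abs_le_sqrt ((sup_bd hζ hC h ht hR d hd α β x).trans (le_of_eq ?_))
    rw [eS, hS2]; ring
  have W := h.W1 ht0
  have enY : (1 + t) ^ lam * (1 + t) ^ lam * ∫ x : E3, YG2 N ψ (t, x) ≤ E ^ 2 := by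
    have := h.en t ht0
    rw [div_pow, le_div_iff₀ (by positivity)] at this
    linarith
  have each : ∀ d : Wd, d.length ≤ R → ∫ x : E3, (∑ α, ∑ β, (ζ (t, x) * Dop α (Dop β (DWord d ψ)) (t, x)) ^ 2) ≤ 100000 * C ^ 2 * (3 * C1 ^ 2 * (e + E ^ 2 * Z + S2 * E ^ 2) + e) := fun d hd => by
    refine (cut_ell hζ hC h ht d (by omega)).trans ?_
    gcongr
    have pt : ∀ x : E3, (ζ (t, x) * bx (DWord d ψ) (t, x)) ^ 2 ≤ 3 * C1 ^ 2 * (er N lam ψ (t, x) + E ^ 2 * (ζ (t, x) ^ 2 * z2 R ψ (t, x)) + S2 * (1 + t) ^ lam * (1 + t) ^ lam * YG2 N ψ (t, x)) := by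
      intro x
      have r0 := er_nonneg N lam ψ (t, x)
      have y0 := YG2_nonneg N ψ (t, x)
      have zz0 := z2_nonneg R ψ (t, x)
      rcases (hζ.n0 (t, x)).eq_or_lt with h0 | h0
      · rw [← h0, zero_mul]
        have : (0:ℝ) ≤ 3 * C1 ^ 2 * (er N lam ψ (t, x) + E ^ 2 * (0 ^ 2 * z2 R ψ (t, x)) + S2 * (1 + t) ^ lam * (1 + t) ^ lam * YG2 N ψ (t, x)) := by positivity
        simpa using this
      · have b := k1 M E ψ h hE4 t ht x (√(z2 R ψ (t, x))) (√S2 / ζ (t, x)) (Real.sqrt_nonneg _) (by positivity) d (by omega) (fun c hc α β => Real.abs_le_sqrt (le_z2 ψ (t, x) c (by omega) α β)) (fun c hc α β => by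
            rw [le_div_iff₀ h0, mul_comm, ← abs_of_pos h0, ← abs_mul]
            exact sup c (by omega) α β x)
        rw [Wt_t ht0] at b
        have q1 := Real.sq_sqrt r0
        have q2 := Real.sq_sqrt y0
        have q3 := Real.sq_sqrt zz0
        have q4 := Real.sq_sqrt hS0
        set ρ := √(er N lam ψ (t, x))
        set B := √(YG2 N ψ (t, x))
        set z := √(z2 R ψ (t, x))
        set s := √S2
        set ζ0 := ζ (t, x)
        set w := (1 + t) ^ lam
        have b2 : |ζ0 * bx (DWord d ψ) (t, x)| ≤ C1 * (ρ + E * (ζ0 * z) + w * B * s) := by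
          rw [abs_mul, abs_of_pos h0]
          have := mll b h0.le
          have e1 : ζ0 * (C1 * (ρ + E * z + w * B * (s / ζ0))) = C1 * (ζ0 * ρ + E * (ζ0 * z) + w * B * s) := by field_simp
          rw [e1] at this
          refine this.trans ?_
          have : ζ0 * ρ ≤ 1 * ρ := mlr (hζ.n1 _) (Real.sqrt_nonneg _)
          rw [one_mul] at this
          gcongr
        have b3 := pow_le_pow_left₀ (abs_nonneg _) b2 2
        rw [sq_abs] at b3
        refine b3.trans ?_
        rw [mul_pow, mul_comm 3 (C1 ^ 2), mul_assoc (C1 ^ 2) 3]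
        refine mll ?_ (sq_nonneg C1)
        rw [← q1, ← q2, ← q3, ← q4]
        nlinarith [sq_nonneg (ρ - E * (ζ0 * z)), sq_nonneg (ρ - w * B * s), sq_nonneg (E * (ζ0 * z) - w * B * s)]
    have Ib : Integrable (fun x : E3 => (ζ (t, x) * bx (DWord d ψ) (t, x)) ^ 2) := slice_int (f := fun p => (ζ p * bx (DWord d ψ) p) ^ 2) ((hζ.sm.mul (bx_sm (h.sm.W d))).pow 2).continuous ((((((h.sp.W d).D _).D _).sub (Sp.sum _ fun i _ => ((h.sp.W d).D _).D _))).mul' _).sq ht0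
    rw [integral_add Ib Ie]
    have Iez : Integrable (fun x : E3 => er N lam ψ (t, x) + E ^ 2 * (ζ (t, x) ^ 2 * z2 R ψ (t, x))) := Ie.add (Iz.const_mul _)
    have := integral_mono Ib ((Iez.add (IY.const_mul (S2 * (1 + t) ^ lam * (1 + t) ^ lam))).const_mul (3 * C1 ^ 2)) pt
    simp only [Pi.add_apply] at this
    rw [integral_const_mul, integral_add Iez (IY.const_mul _), integral_add Ie (Iz.const_mul _), integral_const_mul, integral_const_mul] at this
    have k := mll enY hS0
    refine add_le_add (this.trans (mll ?_ (by positivity))) le_rfl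
    linarith
  have Zb : Z ≤ n * (100000 * C ^ 2 * (3 * C1 ^ 2 * (e + E ^ 2 * Z + S2 * E ^ 2) + e)) := by
    have ez : Z = wsum R (fun d : Wd => ∫ x : E3, (∑ α, ∑ β, (ζ (t, x) * Dop α (Dop β (DWord d ψ)) (t, x)) ^ 2)) := by
      rw [← wsum_int (F := fun (d : Wd) (x : E3) => ∑ α, ∑ β, (ζ (t, x) * Dop α (Dop β (DWord d ψ)) (t, x)) ^ 2)]
      · rw [hZ]
        congr 1; funext x
        unfold z2
        rw [← wsum_mul]
        congr 1; funext d
        rw [Finset.mul_sum]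
        refine Finset.sum_congr rfl fun α _ => ?_
        rw [Finset.mul_sum]
        exact Finset.sum_congr rfl fun β _ => by ring
      · intro d
        exact integrable_finset_sum _ fun α _ => integrable_finset_sum _ fun β _ =>
          slice_int (f := fun p => (ζ p * Dop α (Dop β (DWord d ψ)) p) ^ 2) ((hζ.sm.mul (((h.sm.W d).D β).D α)).pow 2).continuous ((((h.sp.W d).D _).D _).mul' _).sq ht0
    refine ez.le.trans ((wsum_le each).trans (le_of_eq ?_))
    rw [wsum_const, hn]
  rw [eS]
  have fin : Z ≤ K * (e + E ^ 2 * Z) := by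
    refine Zb.trans ?_
    rw [hK]
    simp only [mul_assoc n, mul_assoc (100000 * C ^ 2)]
    refine mll (mll ?_ (by positivity)) (by positivity)
    rw [hS2]
    have hE2 : E ^ 2 ≤ 1 := by nlinarith
    have a1 : 0 ≤ C ^ 2 * C1 ^ 2 * (e * (1 - E ^ 2)) := by
      have : 0 ≤ 1 - E ^ 2 := by linarith
      positivity
    have a2 : 0 ≤ E ^ 2 * Z := by positivity
    nlinarith
  nlinarith [mlr hKE hZ0]
lemma d2_int (μ lam γ : ℝ) (hl0 : 0 ≤ lam) (h1 : lam ≤ 1) (N L : ℕ) (hN : 8 ≤ N) (hL : L + 2 ≤ N) : ∃ C ≥ 1, ∃ δ > 0, ∀ (M E : ℝ) (ψ : Fn), Hyp μ lam γ M N ψ E → E ≤ δ → ∀ (t : ℝ) (x : E3), 1 ≤ t → (∀ k, |x k| < t / 8) → ∀ b : Wd, 2 ≤ b.length → b.length ≤ L → |DWord b ψ (t, x)| ≤ C * (E / (1 + t) ^ lam / (1 + t) ^ lam) := by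
  obtain ⟨C, hC, k⟩ := cut_ex
  obtain ⟨C', hC', δ, hδ, kZ⟩ := Z_bd μ lam γ hl0 h1 N (L + 1) hN (by omega) C hC
  have hC2 : 1 ≤ C ^ 2 := one_le_pow₀ hC
  refine ⟨8192 * C ^ 2 * C', by nlinarith, δ, hδ, fun M E ψ h hE t x ht hx b hb hb' => ?_⟩
  obtain ⟨ζ, z1, z2, z3, z4, z5⟩ := k t ht
  have hζ : Cut C t ζ := ⟨z1, fun p => (z2 p).1, fun p => (z2 p).2, z4, z5⟩
  have ht0 : 0 < t := by linarith
  have W := h.W1 ht0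
  match b, hb, hb' with
  | α :: β :: d, hb, hb' =>
    have s := sup_bd hζ hC h ht (R := L + 1) (by omega) d (by simp at hb'; omega) α β x
    rw [z3 x hx, one_mul] at s
    have Z := kZ M E ψ h hE t ζ ht hζ
    have er := h.er_int ht0
    rw [Real.rpow_neg (by linarith)] at er
    set w := ((1 + t) ^ lam)⁻¹ with hw
    have hw0 : 0 ≤ w := by positivity
    have hE0 := h.E0
    have e1 : E / (1 + t) ^ lam / (1 + t) ^ lam = E * w ^ 2 := by rw [div_eq_mul_inv, div_eq_mul_inv, ← hw]; ring
    rw [e1]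
    refine abs_le_of_sq_le_sq ?_ (by positivity)
    simp only [DWord]
    have A : 8 * (512 * C ^ 2 * (C' * (2 * (E * w ^ 2) ^ 2))) ≤ (8192 * C ^ 2 * C' * (E * w ^ 2)) ^ 2 := by
      have : 8192 * C ^ 2 * C' ≤ (8192 * C ^ 2 * C') ^ 2 := by
        have : 1 ≤ 8192 * C ^ 2 * C' := by nlinarith
        nlinarith
      calc _ = 8192 * C ^ 2 * C' * (E * w ^ 2) ^ 2 := by ring
        _ ≤ (8192 * C ^ 2 * C') ^ 2 * (E * w ^ 2) ^ 2 := mlr this (sq_nonneg _)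
        _ = _ := by ring
    refine s.trans (le_trans ?_ A)
    gcongr
    refine Z.trans ?_
    gcongr
lemma PH2 (μ lam γ M : ℝ) (hl0 : 0 < lam) (h1 : lam ≤ 1) (hM : 0 < M) (N : ℕ) (hN : 8 ≤ N) : ∃ C ≥ 1, ∃ δ > 0, ∀ (E : ℝ) (ψ : Fn), Hyp μ lam γ M N ψ E → E ≤ δ → ∀ p : Pt, 0 < p.1 → PH N (N - N/2 + 1) lam ψ p (C * E) (Wt lam p)⁻¹ (√(Y2 N ψ p)) := by
  obtain ⟨C1, hC1, k1⟩ := d2_ext M hM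
  obtain ⟨C2, hC2, δ, hδ, k2⟩ := d2_int μ lam γ hl0.le h1 N (N - N/2 + 1) hN (by omega)
  refine ⟨6 + C1 + C2, by linarith, min δ (1 / (6 + C1 + C2)), by positivity, fun E ψ h hE p hp => ?_⟩
  obtain ⟨t, x⟩ := p
  have ht0 := hp
  have hE0 := h.E0
  have W := h.W1 ht0
  have W0 : 0 < (1 + t) ^ lam := by linarith
  have q0 : 0 ≤ E / (1 + t) ^ lam := by positivity
  have q1 : 0 ≤ E / (1 + t) ^ lam / (1 + t) ^ lam := by positivity
  have eC : ∀ b : ℝ, (6 + C1 + C2) * E / Wt lam (t, x) * b = (6 + C1 + C2) * (E / (1 + t) ^ lam * b) := fun b => by rw [Wt_t ht0]; ring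
  refine ⟨hp, by positivity, ?_, le_rfl, by rw [Wt_t ht0]; exact inv_le_one_of_one_le₀ W, Real.sqrt_nonneg _, ?_, fun b hb hb' => ?_, fun b hb hb' => ?_, fun b hb hb' => Real.abs_le_sqrt (W_le_Y ψ _ b hb hb'), by omega, by omega⟩
  · have := mll (hE.trans (min_le_right _ _)) (by linarith : 0 ≤ 6 + C1 + C2)
    rwa [mul_one_div_cancel (by positivity)] at this
  · refine (h.d0 ht0 x).trans ?_; nlinarith
  · have := eC 1
    rw [mul_one, mul_one] at this
    rw [this]
    refine (h.d1 ht0 x b hb (by omega)).trans ?_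
    nlinarith
  · rw [eC, Wt_t ht0, ← div_eq_mul_inv]
    rcases le_or_gt 1 t with ht | ht
    · by_cases hx : ∀ k, |x k| < t / 8
      · refine (k2 M E ψ h (hE.trans (min_le_left _ _)) t x ht hx b hb hb').trans ?_
        gcongr; linarith
      · push Not at hx
        obtain ⟨k, hk⟩ := hx
        refine (k1 μ lam γ E N ψ h t ht x k hk b (by omega) (by omega)).trans ?_
        gcongr; linarith
    · refine (h.d1 ht0 x b (by omega) (by omega)).trans ?_
      have W2 := h.W2 ht0
      have : E / (1 + t) ^ lam ≤ 2 * (E / (1 + t) ^ lam / (1 + t) ^ lam) := by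
        rw [← mul_div_assoc, le_div_iff₀ W0]; nlinarith
      nlinarith
def Md (M : ℝ) (β ω : Fn) (K : ℝ) (F : Fn) : Prop := ∃ V : Fin 4 → Fn, (∀ k, Sm (V k)) ∧ (∀ k, Sp M (V k)) ∧ ∀ p : Pt, 0 < p.1 → |F p - ∑ k, Dop k (V k) p| ≤ K * β p ∧ |V 0 p| ≤ K * ω p
section
variable {β ω : Fn}
lemma Md.add {K1 K2 : ℝ} {G : Fn} (h1 : Md M β ω K1 F) (h2 : Md M β ω K2 G) : Md M β ω (K1 + K2) (fun p => F p + G p) := by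
  obtain ⟨V, s, sp, h⟩ := h1
  obtain ⟨V', s', sp', h'⟩ := h2
  refine ⟨fun k p => V k p + V' k p, fun k => (s k).add (s' k), fun k => (sp k).add (sp' k), fun p hp => ⟨?_, ?_⟩⟩
  · have e : ∑ k, Dop k (fun p => V k p + V' k p) p = ∑ k, Dop k (V k) p + ∑ k, Dop k (V' k) p := by
      rw [← Finset.sum_add_distrib]
      exact Finset.sum_congr rfl fun k _ => by rw [D_add (s k) (s' k)]
    rw [e, add_mul, show ∀ a b c d : ℝ, a + b - (c + d) = (a - c) + (b - d) from fun a b c d => by ring]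
    exact (abs_add_le _ _).trans (add_le_add (h p hp).1 (h' p hp).1)
  · rw [add_mul]
    exact (abs_add_le _ _).trans (add_le_add (h p hp).2 (h' p hp).2)
lemma Md.smul (h1 : Md M β ω K F) (c : ℝ) : Md M β ω (|c| * K) (fun p => c * F p) := by
  obtain ⟨V, s, sp, h⟩ := h1
  refine ⟨fun k p => c * V k p, fun k => contDiff_const.mul (s k), fun k => (sp k).mul' _, fun p hp => ⟨?_, ?_⟩⟩
  · have e : ∑ k, Dop k (fun p => c * V k p) p = c * ∑ k, Dop k (V k) p := by
      rw [Finset.mul_sum]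
      exact Finset.sum_congr rfl fun k _ => by rw [D_cmul (s k)]
    rw [e, ← mul_sub, abs_mul, mul_assoc]
    exact mll (h p hp).1 (abs_nonneg _)
  · rw [abs_mul, mul_assoc]
    exact mll (h p hp).2 (abs_nonneg _)
lemma Md.congr {G : Fn} (h1 : Md M β ω K F) (e : ∀ p : Pt, 0 < p.1 → G p = F p) : Md M β ω K G := by
  obtain ⟨V, s, sp, h⟩ := h1
  exact ⟨V, s, sp, fun p hp => by rw [e p hp]; exact h p hp⟩
lemma Md.mono (hβ : ∀ p : Pt, 0 < p.1 → 0 ≤ β p) (hω : ∀ p : Pt, 0 < p.1 → 0 ≤ ω p) {K' : ℝ} (h1 : Md M β ω K F) (hK : K ≤ K') : Md M β ω K' F := by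
  obtain ⟨V, s, sp, h⟩ := h1
  exact ⟨V, s, sp, fun p hp => ⟨(h p hp).1.trans (mlr hK (hβ p hp)), (h p hp).2.trans (mlr hK (hω p hp))⟩⟩
lemma Md.direct (hω : ∀ p : Pt, 0 < p.1 → 0 ≤ ω p) (hK : 0 ≤ K) (h : ∀ p : Pt, 0 < p.1 → |F p| ≤ K * β p) : Md M β ω K F := ⟨fun _ _ => 0, fun _ => contDiff_const, fun _ _ _ _ => rfl, fun p hp => ⟨by simpa [D_const] using h p hp, by
    simpa using mul_nonneg hK (hω p hp)⟩⟩
lemma Md.sum {ι : Type*} [Fintype ι] {F : ι → Fn} (h : ∀ i, Md M β ω K (F i)) : Md M β ω (Fintype.card ι * K) (fun p => ∑ i, F i p) := by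
  choose V s sp h using h
  refine ⟨fun k p => ∑ i, V i k p, fun k => ContDiff.sum fun i _ => s i k, fun k => Sp.sum _ fun i _ => sp i k, fun p hp => ⟨?_, ?_⟩⟩
  · have e : ∑ k, Dop k (fun p => ∑ i, V i k p) p = ∑ i, ∑ k, Dop k (V i k) p := by
      rw [Finset.sum_comm]
      exact Finset.sum_congr rfl fun k _ => by rw [D_sum _ fun i _ => s i k]
    rw [e, ← Finset.sum_sub_distrib]
    refine (Finset.abs_sum_le_sum_abs _ _).trans ((Finset.sum_le_sum fun i _ => (h i p hp).1).trans (le_of_eq ?_))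
    simp [mul_assoc]
  · refine (Finset.abs_sum_le_sum_abs _ _).trans ((Finset.sum_le_sum fun i _ => (h i p hp).2).trans (le_of_eq ?_))
    simp [mul_assoc]
lemma Md.div (hβ : ∀ p : Pt, 0 < p.1 → 0 ≤ β p) (hω : ∀ p : Pt, 0 < p.1 → 0 ≤ ω p) (hK : 0 ≤ K) (hf : Sm f) (hs : Sp M f) (k : Fin 4) (h : k = 0 → ∀ p : Pt, 0 < p.1 → |f p| ≤ K * ω p) : Md M β ω K (Dop k f) := by
  refine ⟨fun j p => (if j = k then 1 else 0) * f p, fun j => contDiff_const.mul hf, fun j => hs.mul' _, fun p hp => ⟨?_, ?_⟩⟩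
  · have : ∑ j, Dop j (fun p => (if j = k then (1:ℝ) else 0) * f p) p = Dop k f p := by
      simp only [D_cmul hf]
      simp
    rw [this, sub_self, abs_zero]
    exact mul_nonneg hK (hβ p hp)
  · by_cases h0 : k = 0
    · simpa [h0] using h h0 p hp
    · change |(if (0 : Fin 4) = k then (1:ℝ) else 0) * f p| ≤ _
      rw [if_neg (Ne.symm h0), zero_mul, abs_zero]
      exact mul_nonneg hK (hω p hp)
lemma tri_bd {a b c y x : ℝ} (hb : |b| ≤ y) (hc : |c| ≤ y) (h : |a| * y ^ 2 ≤ K * x) : |a * (b * c)| ≤ K * x := by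
  rw [abs_mul, abs_mul]
  refine le_trans (mll ?_ (abs_nonneg a)) h
  rw [sq]
  exact mul_le_mul hb hc (abs_nonneg _) ((abs_nonneg _).trans hb)
lemma nl1 (hβ : ∀ p : Pt, 0 < p.1 → 0 ≤ β p) (hω : ∀ p : Pt, 0 < p.1 → 0 ≤ ω p) {h Y : Fn} (hK : 0 ≤ K) (hh : Sm h) (hu : Sm u) (su : Sp M u) (hY : ∀ p : Pt, 0 < p.1 → ∀ k, |Dop k u p| ≤ Y p) (b0 : ∀ p : Pt, 0 < p.1 → |h p| * Y p ^ 2 ≤ K * ω p) (b1 : ∀ p : Pt, 0 < p.1 → ∀ k, |Dop k h p| * Y p ^ 2 ≤ K * β p) (α γ : Fin 4) : Md M β ω (6 * K) (fun p => 2 * (h p * (Dop 0 u p * Dop α (Dop γ u) p))) := by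
  have T : ∀ j k : Fin 4, Sm (fun p => h p * (Dop j u p * Dop k u p)) := fun j k => hh.mul ((hu.D j).mul (hu.D k))
  have d : ∀ i j k : Fin 4, Md M β ω K (Dop i (fun p => h p * (Dop j u p * Dop k u p))) := fun i j k =>
    Md.div hβ hω hK (T j k) (((su.D j).mul _).mul' _) i fun _ p hp => tri_bd (hY p hp j) (hY p hp k) (b0 p hp)
  have r : ∀ i j k : Fin 4, Md M β ω K (fun p => Dop i h p * (Dop j u p * Dop k u p)) := fun i j k =>
    Md.direct hω hK fun p hp => tri_bd (hY p hp j) (hY p hp k) (b1 p hp i)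
  have := ((((d α 0 γ).add (d γ 0 α)).add ((d 0 α γ).smul (-1))).add (((r α 0 γ).add (r γ 0 α)).smul (-1))).add (r 0 α γ)
  refine (this.congr fun p hp => ?_).mono hβ hω (by norm_num; linarith)
  have e : ∀ i j k : Fin 4, Dop i (fun p => h p * (Dop j u p * Dop k u p)) p = Dop i h p * (Dop j u p * Dop k u p) + h p * (Dop i (Dop j u) p * Dop k u p + Dop j u p * Dop i (Dop k u) p) := fun i j k => by
    rw [D_mul hh ((hu.D j).mul (hu.D k)), D_mul (hu.D j) (hu.D k)]
  rw [e, e, e, D_comm hu 0 α, D_comm hu 0 γ, D_comm hu γ α]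
  ring
lemma nl2 (hβ : ∀ p : Pt, 0 < p.1 → 0 ≤ β p) (hω : ∀ p : Pt, 0 < p.1 → 0 ≤ ω p) {h Y : Fn} (hK : 0 ≤ K) (hh : Sm h) (hu : Sm u) (su : Sp M u) (hY : ∀ p : Pt, 0 < p.1 → ∀ k, |Dop k u p| ≤ Y p) (hY' : ∀ p : Pt, 0 < p.1 → |u p| ≤ Y p) (b0 : ∀ p : Pt, 0 < p.1 → |h p| * Y p ^ 2 ≤ K * ω p) (b0' : ∀ p : Pt, 0 < p.1 → |h p| * Y p ^ 2 ≤ K * β p) (b1 : ∀ p : Pt, 0 < p.1 → ∀ k, |Dop k h p| * Y p ^ 2 ≤ K * β p) (α γ : Fin 4) : Md M β ω (3 * K) (fun p => h p * (u p * Dop α (Dop γ u) p)) := by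
  have d := Md.div hβ hω hK (hh.mul (hu.mul (hu.D γ))) ((su.mul _).mul' _) α fun _ p hp => tri_bd (hY' p hp) (hY p hp γ) (b0 p hp)
  have r1 : Md M β ω K (fun p => Dop α h p * (u p * Dop γ u p)) := Md.direct hω hK fun p hp => tri_bd (hY' p hp) (hY p hp γ) (b1 p hp α)
  have r2 : Md M β ω K (fun p => h p * (Dop α u p * Dop γ u p)) := Md.direct hω hK fun p hp => tri_bd (hY p hp α) (hY p hp γ) (b0' p hp)
  refine ((d.add ((r1.add r2).smul (-1))).congr fun p hp => ?_).mono hβ hω (by norm_num; linarith)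
  rw [D_mul hh (hu.mul (hu.D γ)), D_mul hu (hu.D γ)]
  ring
end
structure Pk (M lam : ℝ) (N : ℕ) (ψ : Fn) (e : ℝ) : Prop where
  sm : Sm ψ
  sp : Sp M ψ
  l0 : 0 < lam
  l1 : lam ≤ 1
  hN : 8 ≤ N
  e0 : 0 ≤ e
  ph : ∀ p : Pt, 0 < p.1 → PH N (N - N/2 + 1) lam ψ p e (Wt lam p)⁻¹ (√(Y2 N ψ p))
def A0 (lam : ℝ) (p : Pt) : ℝ := Wt (-1 - lam) p + Wt (-2) p + lam * (1 - lam) * Wt (lam - 2) p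
def xx (lam : ℝ) (N : ℕ) (ψ : Fn) (p : Pt) : ℝ := Vt lam p * Y2 N ψ p + ψ p ^ 2
def om (e lam : ℝ) (N : ℕ) (ψ : Fn) (p : Pt) : ℝ := e * (Vt lam p * Y2 N ψ p)
def bt (e lam : ℝ) (N : ℕ) (ψ : Fn) (p : Pt) : ℝ := e * (Wt lam p * Y2 N ψ p) + A0 lam p * xx lam N ψ p
lemma A0_nonneg (h0 : 0 ≤ lam) (h1 : lam ≤ 1) (p : Pt) : 0 ≤ A0 lam p := by
  have := Wt_pos (-1 - lam) p
  have := Wt_pos (-2) p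
  have := Wt_pos (lam - 2) p
  have : 0 ≤ 1 - lam := by linarith
  unfold A0; positivity
lemma xx_nonneg (lam : ℝ) (N : ℕ) (ψ : Fn) (p : Pt) : 0 ≤ xx lam N ψ p := by
  have := Wt_pos (2 * lam) p
  have := Y2_nonneg N ψ p
  unfold xx; positivity
lemma om_nonneg {e : ℝ} (he : 0 ≤ e) (lam : ℝ) (N : ℕ) (ψ : Fn) (p : Pt) : 0 ≤ om e lam N ψ p := by
  have := Wt_pos (2 * lam) p
  have := Y2_nonneg N ψ p
  unfold om; positivity
lemma bt1 {e : ℝ} (h0 : 0 ≤ lam) (h1 : lam ≤ 1) (N : ℕ) (ψ : Fn) (p : Pt) : e * (Wt lam p * Y2 N ψ p) ≤ bt e lam N ψ p := by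
  have := mul_nonneg (A0_nonneg h0 h1 p) (xx_nonneg lam N ψ p)
  unfold bt; linarith
lemma bt_nonneg {e : ℝ} (he : 0 ≤ e) (h0 : 0 ≤ lam) (h1 : lam ≤ 1) (N : ℕ) (ψ : Fn) (p : Pt) : 0 ≤ bt e lam N ψ p := by
  have := Wt_pos lam p
  have := Y2_nonneg N ψ p
  exact le_trans (by positivity) (bt1 h0 h1 N ψ p)
lemma Wt_sq (lam : ℝ) (p : Pt) : Vt lam p = Wt lam p * Wt lam p := by rw [Wt_mul]; ring_nf
lemma D_Wt_bd {a : ℝ} (ha : 0 ≤ a) (k : Fin 4) (hp : 0 < p.1) : |Dop k (Wt a) p| ≤ a * Wt (a - 1) p := by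
  have := Wt_pos (a - 1) p
  refine Fin.cases ?_ (fun i => ?_) k
  · rw [D0_Wt a p hp, abs_of_nonneg (by positivity)]
  · rw [Di_Wt]; simp; positivity
lemma D_Wl (h0 : 0 ≤ lam) (h1 : lam ≤ 1) (k : Fin 4) (hp : 0 < p.1) : |Dop k (Wt lam) p| ≤ 1 := by
  refine (D_Wt_bd h0 k hp).trans ?_
  have := Wt_le_one (by linarith : lam - 1 ≤ 0) hp
  have := Wt_pos (lam - 1) p
  nlinarith
lemma D_W2 (h0 : 0 ≤ lam) (h1 : lam ≤ 1) (k : Fin 4) (hp : 0 < p.1) : |Dop k (Vt lam) p| ≤ 2 * Wt lam p := by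
  refine (D_Wt_bd (by linarith) k hp).trans ?_
  have := Wt_mono (by linarith : 2 * lam - 1 ≤ lam) hp.le
  have := Wt_pos (2 * lam - 1) p
  nlinarith
section
variable {e : ℝ}
lemma Pk.hβ (h : Pk M lam N ψ e) : ∀ p : Pt, 0 < p.1 → 0 ≤ bt e lam N ψ p := fun p _ => bt_nonneg h.e0 h.l0.le h.l1 N ψ p
lemma Pk.hω (h : Pk M lam N ψ e) : ∀ p : Pt, 0 < p.1 → 0 ≤ om e lam N ψ p := fun p _ => om_nonneg h.e0 lam N ψ p
lemma Pk.hY (h : Pk M lam N ψ e) (a : Wd) (ha : a.length ≤ N) (p : Pt) (hp : 0 < p.1) (k : Fin 4) : |Dop k (DWord a ψ) p| ≤ √(Y2 N ψ p) := (h.ph p hp).b3 (k :: a) (by simp) (by simpa using ha)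
lemma Pk.toβ (h : Pk M lam N ψ e) {z : ℝ} (hK : 0 ≤ K) (hz : z ≤ K * (e * Wt lam p)) : z * √(Y2 N ψ p) ^ 2 ≤ K * bt e lam N ψ p := by
  have y := Y2_nonneg N ψ p
  rw [Real.sq_sqrt y]
  have b := mll (bt1 (e := e) h.l0.le h.l1 N ψ p) hK
  refine le_trans (le_trans (mlr hz y) (le_of_eq (by ring))) b
lemma Pk.toω {z : ℝ} (hz : z ≤ K * (e * Vt lam p)) : z * √(Y2 N ψ p) ^ 2 ≤ K * om e lam N ψ p := by
  have y := Y2_nonneg N ψ p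
  rw [Real.sq_sqrt y]
  refine le_trans (mlr hz y) (le_of_eq (by unfold om; ring))
end
lemma gab_bd (μ lam γ : ℝ) (hl0 : 0 ≤ lam) (h1 : lam ≤ 1) (N : ℕ) : ∃ C ≥ 1, ∀ (M : ℝ) (ψ : Fn) (e : ℝ), Pk M lam N ψ e → ∀ α β, ∀ p : Pt, 0 < p.1 → |Vt lam p * gab μ lam γ ψ α β p| ≤ C * (e * Vt lam p) ∧ |Wt lam p * gab μ lam γ ψ α β p| ≤ C * (e * Wt lam p) ∧ (∀ k, |Dop k (fun p => Vt lam p * gab μ lam γ ψ α β p) p| ≤ C * (e * Wt lam p)) ∧ (∀ k, |Dop k (fun p => Wt lam p * gab μ lam γ ψ α β p) p| ≤ C * (e * Wt lam p)) := by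
  obtain ⟨C, hC, h⟩ := cl_gab μ lam γ hl0 h1 N (N - N/2 + 1)
  refine ⟨3 * C, by linarith, fun M ψ e P α β p hp => ?_⟩
  have H := h ψ p e _ _ P.sm (P.ph p hp) α β
  have he := P.e0
  have hN := P.hN
  have w := Wt_pos lam p
  have w1 := one_le_Wt hl0 hp
  have w2 := Wt_pos (2 * lam) p
  have d : ∀ k, |Dop k (gab μ lam γ ψ α β) p| ≤ C * (e * (Wt lam p)⁻¹) := fun k => H.c1 [k] (by simp) (by simp; omega)
  have c0 := H.c0
  have hC0 : 0 ≤ C := by linarith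
  have hCe : 0 ≤ C * e := by positivity
  refine ⟨?_, ?_, fun k => ?_, fun k => ?_⟩
  · rw [abs_mul, abs_of_pos w2]
    nlinarith [mll c0 w2.le, mul_nonneg hCe w2.le]
  · rw [abs_mul, abs_of_pos w]
    nlinarith [mll c0 w.le, mul_nonneg hCe w.le]
  · rw [D_mul (Wt_sm _) H.sm]
    refine (abs_add_le _ _).trans ?_
    rw [abs_mul, abs_mul, abs_of_pos w2, Wt_sq]
    have t1 := mul_le_mul (D_W2 hl0 h1 k hp) c0 (abs_nonneg _) (by positivity)
    have t2 := mll (d k) (mul_pos w w).le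
    have : Wt lam p * Wt lam p * (C * (e * (Wt lam p)⁻¹)) = C * (e * Wt lam p) := by field_simp
    linarith
  · rw [D_mul (Wt_sm _) H.sm]
    refine (abs_add_le _ _).trans ?_
    rw [abs_mul, abs_mul, abs_of_pos w]
    have t1 := mul_le_mul (D_Wl hl0 h1 k hp) c0 (abs_nonneg _) (by positivity)
    have t2 := mll (d k) w.le
    have : Wt lam p * (C * (e * (Wt lam p)⁻¹)) = C * e := by field_simp
    nlinarith
lemma nlT (μ lam γ : ℝ) (hl0 : 0 ≤ lam) (h1 : lam ≤ 1) (N : ℕ) : ∃ K ≥ 0, ∀ (M : ℝ) (ψ : Fn) (e : ℝ), Pk M lam N ψ e → ∀ a : Wd, a.length ≤ N → Md M (bt e lam N ψ) (om e lam N ψ) K (fun p =>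
      2 * (Vt lam p * Dop 0 (DWord a ψ) p) * ∑ α, ∑ β, gab μ lam γ ψ α β p * Dop α (Dop β (DWord a ψ)) p) := by
  obtain ⟨C, hC, h⟩ := gab_bd μ lam γ hl0 h1 N
  have hC0 : 0 ≤ C := by linarith
  refine ⟨4 * (4 * (6 * C)), by positivity, fun M ψ e P a ha => ?_⟩
  have := Md.sum fun α => Md.sum fun β => nl1 (M := M) P.hβ P.hω hC0 ((Wt_sm (2 * lam)).mul (gab_sm (μ := μ) (lam := lam) (γ := γ) P.sm α β)) (P.sm.W a) (P.sp.W a) (P.hY a ha) (fun p hp => Pk.toω (h M ψ e P α β p hp).1) (fun p hp k => P.toβ hC0 ((h M ψ e P α β p hp).2.2.1 k)) α β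
  refine (this.congr fun p hp => ?_).mono P.hβ P.hω (by simp)
  rw [Finset.mul_sum]
  refine Finset.sum_congr rfl fun α _ => ?_
  rw [Finset.mul_sum]
  exact Finset.sum_congr rfl fun β _ => by ring
lemma nlZ (μ lam γ : ℝ) (hl0 : 0 ≤ lam) (h1 : lam ≤ 1) (N : ℕ) : ∃ K ≥ 0, ∀ (M : ℝ) (ψ : Fn) (e : ℝ), Pk M lam N ψ e → ∀ a : Wd, 1 ≤ a.length → a.length ≤ N → Md M (bt e lam N ψ) (om e lam N ψ) K (fun p =>
      (Wt lam p * DWord a ψ p) * ∑ α, ∑ β, gab μ lam γ ψ α β p * Dop α (Dop β (DWord a ψ)) p) := by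
  obtain ⟨C, hC, h⟩ := gab_bd μ lam γ hl0 h1 N
  have hC0 : 0 ≤ C := by linarith
  refine ⟨4 * (4 * (3 * C)), by positivity, fun M ψ e P a ha1 ha => ?_⟩
  have := Md.sum fun α => Md.sum fun β => nl2 (M := M) P.hβ P.hω hC0 ((Wt_sm lam).mul (gab_sm (μ := μ) (lam := lam) (γ := γ) P.sm α β)) (P.sm.W a) (P.sp.W a) (P.hY a ha) (fun p hp => (P.ph p hp).b3 a ha1 (by omega)) (fun p hp => Pk.toω (((h M ψ e P α β p hp).2.1).trans (mll (mll (Wt_mono (by linarith) hp.le) P.e0) hC0))) (fun p hp => P.toβ hC0 ((h M ψ e P α β p hp).2.1)) (fun p hp k => P.toβ hC0 ((h M ψ e P α β p hp).2.2.2 k)) α β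
  refine (this.congr fun p hp => ?_).mono P.hβ P.hω (by simp)
  rw [Finset.mul_sum]
  refine Finset.sum_congr rfl fun α _ => ?_
  rw [Finset.mul_sum]
  exact Finset.sum_congr rfl fun β _ => by ring
section
variable {e : ℝ}
lemma Pk.h0 (P : Pk M lam N ψ e) (p : Pt) (hp : 0 < p.1) : |Vt lam p * ψ p| ≤ 1 * (e * Vt lam p) := by
  have w2 := Wt_pos (2 * lam) p
  rw [abs_mul, abs_of_pos w2]
  nlinarith [mll (P.ph p hp).b0 w2.le]
lemma Pk.h1 (P : Pk M lam N ψ e) (p : Pt) (hp : 0 < p.1) (k : Fin 4) : |Dop k (fun p => Vt lam p * ψ p) p| ≤ 3 * (e * Wt lam p) := by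
  have w := Wt_pos lam p
  have hN := P.hN
  have he := P.e0
  have d : |Dop k ψ p| ≤ e / Wt lam p := (P.ph p hp).b1 [k] (by simp) (by simp)
  rw [D_mul (Wt_sm _) P.sm]
  refine (abs_add_le _ _).trans ?_
  rw [abs_mul, abs_mul, abs_of_pos (Wt_pos (2 * lam) p), Wt_sq]
  have t1 := mul_le_mul (D_W2 P.l0.le P.l1 k hp) (P.ph p hp).b0 (abs_nonneg _) (by positivity)
  have t2 := mll d (mul_pos w w).le
  have : Wt lam p * Wt lam p * (e / Wt lam p) = e * Wt lam p := by field_simp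
  linarith
lemma Pk.hY0 (P : Pk M lam N ψ e) (p : Pt) (hp : 0 < p.1) (k : Fin 4) : |Dop k ψ p| ≤ √(Y2 N ψ p) := P.hY [] (by simp) p hp k
lemma zA (P : Pk M lam N ψ e) (i : Fin 4) : Md M (bt e lam N ψ) (om e lam N ψ) 3 (fun p =>
    (Vt lam p * ψ p) * (Dop i ψ p * Dop i (Dop 0 ψ) p)) := by
  have hs : Sm (fun p => Vt lam p * ψ p) := (Wt_sm _).mul P.sm
  have d := Md.div P.hβ P.hω zero_le_one (hs.mul ((P.sm.D i).mul (P.sm.D i))) (((P.sp.D i).mul _).mul' _) 0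
      fun _ p hp => tri_bd (P.hY0 p hp i) (P.hY0 p hp i) (Pk.toω (P.h0 p hp))
  have r : Md M (bt e lam N ψ) (om e lam N ψ) 3 (fun p => Dop 0 (fun p => Vt lam p * ψ p) p * (Dop i ψ p * Dop i ψ p)) := Md.direct P.hω (by norm_num) fun p hp => tri_bd (P.hY0 p hp i) (P.hY0 p hp i) (P.toβ (by norm_num) (P.h1 p hp 0))
  refine (((d.add (r.smul (-1))).smul (1/2)).congr fun p hp => ?_).mono P.hβ P.hω (by norm_num [abs_of_pos])
  rw [D_mul hs ((P.sm.D i).mul (P.sm.D i)), D_mul (P.sm.D i) (P.sm.D i), D_comm P.sm 0 i]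
  ring
lemma zB (P : Pk M lam N ψ e) (i : Fin 3) : Md M (bt e lam N ψ) (om e lam N ψ) 10 (fun p =>
    (Vt lam p * ψ p) * (Dop 0 ψ p * Ds i (Ds i ψ) p)) := by
  have hs : Sm (fun p => Vt lam p * ψ p) := (Wt_sm _).mul P.sm
  have d : Md M (bt e lam N ψ) (om e lam N ψ) 1 (Ds i (fun p => (Vt lam p * ψ p) * (Dop 0 ψ p * Ds i ψ p))) := Md.div P.hβ P.hω zero_le_one (hs.mul ((P.sm.D 0).mul (P.sm.D i.succ))) (((P.sp.D 0).mul _).mul' _) _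
      fun _ p hp => tri_bd (P.hY0 p hp 0) (P.hY0 p hp i.succ) (Pk.toω (P.h0 p hp))
  have r : Md M (bt e lam N ψ) (om e lam N ψ) 3 (fun p => Ds i (fun p => Vt lam p * ψ p) p * (Dop 0 ψ p * Ds i ψ p)) := Md.direct P.hω (by norm_num) fun p hp => tri_bd (P.hY0 p hp 0) (P.hY0 p hp i.succ) (P.toβ (by norm_num) (P.h1 p hp i.succ))
  refine (((d.add (r.smul (-1))).add ((zA P i.succ).smul (-1))).congr fun p hp => ?_).mono P.hβ P.hω (by norm_num)
  rw [D_mul hs ((P.sm.D 0).mul (P.sm.D i.succ)), D_mul (P.sm.D 0) (P.sm.D i.succ)]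
  ring
lemma zC (P : Pk M lam N ψ e) (c μ C : ℝ) (hC : 0 ≤ C) (hm : ∀ p : Pt, 0 < p.1 → |mc lam c μ p| ≤ C) (i : Fin 3) : Md M (bt e lam N ψ) (om e lam N ψ) (2 * C) (fun p =>
    (Wt lam p * mc lam c μ p) * (ψ p * (ψ p * Ds i (Ds i ψ) p))) := by
  have hs : Sm (fun p => Wt lam p * mc lam c μ p) := (Wt_sm _).mul (mc_sm _ _ _)
  have hd : Ds i (fun p => Wt lam p * mc lam c μ p) = fun _ => 0 := by
    have : Ds i (mc lam c μ) = fun _ => 0 := by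
      unfold mc
      rw [D_add (contDiff_const.mul (Wt_sm _)) contDiff_const, D_cmul (Wt_sm _), Di_Wt, D_const]; simp
    rw [D_mul (Wt_sm _) (mc_sm _ _ _), Di_Wt, this]; simp
  have d := Md.div P.hβ P.hω le_rfl (hs.mul (P.sm.mul (P.sm.mul (P.sm.D i.succ)))) (((P.sp.mul _)).mul' _) _
      fun h => absurd h (Fin.succ_ne_zero i)
  have r : Md M (bt e lam N ψ) (om e lam N ψ) C (fun p => ((Wt lam p * mc lam c μ p) * ψ p) * (Ds i ψ p * Ds i ψ p)) := Md.direct P.hω hC fun p hp => tri_bd (P.hY0 p hp i.succ) (P.hY0 p hp i.succ) (P.toβ hC (by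
      have w := Wt_pos lam p
      rw [abs_mul, abs_mul, abs_of_pos w]
      have := mul_le_mul (hm p hp) (P.ph p hp).b0 (abs_nonneg _) hC
      nlinarith))
  refine ((d.add (r.smul (-2))).congr fun p hp => ?_).mono P.hβ P.hω (by norm_num)
  rw [D_mul hs (P.sm.mul (P.sm.mul (P.sm.D i.succ))), hd, D_mul P.sm (P.sm.mul (P.sm.D _)), D_mul P.sm (P.sm.D i.succ)]
  ring
lemma zD (P : Pk M lam N ψ e) (j k α β : Fin 4) : Md M (bt e lam N ψ) (om e lam N ψ) 1 (fun p =>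
    ((Wt lam p * Wt lam p * Wt lam p) * (ψ p * Dop α (Dop β ψ) p)) * (Dop j ψ p * Dop k ψ p)) := by
  refine Md.direct P.hω zero_le_one fun p hp => tri_bd (P.hY0 p hp j) (P.hY0 p hp k) (P.toβ zero_le_one ?_)
  have w := Wt_pos lam p
  have hN := P.hN
  have he := P.e0
  have he1 := (P.ph p hp).e1
  have d := (P.ph p hp).b2 [α, β] (by simp) (by simp; omega)
  rw [abs_mul, abs_of_pos (by positivity : 0 < Wt lam p * Wt lam p * Wt lam p), abs_mul]
  have t := mul_le_mul (P.ph p hp).b0 d (abs_nonneg _) he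
  have t2 := mll t (by positivity : 0 ≤ Wt lam p * Wt lam p * Wt lam p)
  refine t2.trans ?_
  have : Wt lam p * Wt lam p * Wt lam p * (e * (e / Wt lam p * (Wt lam p)⁻¹)) = e * (e * Wt lam p) := by field_simp
  rw [this]
  exact mlr he1 (by positivity)
end
lemma nlZ0 (μ lam γ : ℝ) (h1 : lam ≤ 1) (N : ℕ) : ∃ K ≥ 0, ∀ (M : ℝ) (ψ : Fn) (e : ℝ), Pk M lam N ψ e → Md M (bt e lam N ψ) (om e lam N ψ) K (fun p =>
      (Wt lam p * ψ p) * ∑ α, ∑ β, gab μ lam γ ψ α β p * Dop α (Dop β ψ) p) := by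
  obtain ⟨C, hC, h⟩ := mc_bound lam lam μ h1 0
  have hC0 : 0 ≤ C := by linarith
  have hm : ∀ p : Pt, 0 < p.1 → |mc lam lam μ p| ≤ C := fun p hp => (h [] (by simp) p hp).1
  obtain ⟨K, hK⟩ : ∃ K, K = 7 + |γ - 1| * (10 + 2 * C + 3) := ⟨_, rfl⟩
  have hg := abs_nonneg (γ - 1)
  have hg2 : 0 ≤ |γ - 1| * (10 + 2 * C + 3) := by positivity
  refine ⟨4 * (4 * K), by rw [hK]; positivity, fun M ψ e P => ?_⟩
  have key : ∀ α β, Md M (bt e lam N ψ) (om e lam N ψ) K (fun p => (Wt lam p * ψ p) * (gab μ lam γ ψ α β p * Dop α (Dop β ψ) p)) := by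
    intro α β
    refine Fin.cases ?_ (fun i => ?_) α
    · refine (Md.direct P.hω (K := 0) (F := fun _ => 0) le_rfl (by simp)).congr (fun p hp => ?_) |>.mono P.hβ P.hω (by rw [hK]; positivity)
      simp [gab]
    · refine Fin.cases ?_ (fun j => ?_) β
      · refine ((zA P i.succ).smul (-2)).congr (fun p hp => ?_) |>.mono P.hβ P.hω ?_
        · simp only [gab, Fin.cases_zero, Fin.cases_succ, gi, gA]
          rw [Wt_sq]; ring
        · norm_num; linarith
      · by_cases hij : i = j
        · subst hij
          have := ((((zB P i).add (zC P lam μ C hC0 hm i)).add (((zD P 1 1 i.succ i.succ).add ((zD P 2 2 i.succ i.succ).add (zD P 3 3 i.succ i.succ))).smul (1/2))).smul (-(γ - 1))).add ((zD P i.succ i.succ i.succ i.succ).smul (-1))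
          refine this.congr (fun p hp => ?_) |>.mono P.hβ P.hω ?_
          · simp only [gab, Fin.cases_succ, gij, g0, gA, if_true]
            simp only [show (Fin.succ 0 : Fin 4) = 1 from rfl, show (Fin.succ 1 : Fin 4) = 2 from rfl, show (Fin.succ 2 : Fin 4) = 3 from rfl]
            rw [Wt_sq]; ring
          · rw [hK, abs_neg, abs_neg, abs_one, abs_of_pos (by norm_num : (0:ℝ) < 1 / 2)]
            nlinarith
        · refine ((zD P i.succ j.succ i.succ j.succ).smul (-1)).congr (fun p hp => ?_) |>.mono P.hβ P.hω ?_
          · simp only [gab, Fin.cases_succ, gij, gA, if_neg hij]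
            ring
          · norm_num; linarith
  have := Md.sum fun α => Md.sum fun β => key α β
  refine (this.congr fun p hp => ?_).mono P.hβ P.hω (by simp)
  rw [Finset.mul_sum]
  refine Finset.sum_congr rfl fun α _ => ?_
  rw [Finset.mul_sum]
def mult (lam κ : ℝ) (u : Fn) (p : Pt) : ℝ := 2 * (Vt lam p * Dop 0 u p) + κ * (Wt lam p * u p)
def lin (μ lam : ℝ) (u : Fn) (p : Pt) : ℝ := Dop 0 (Dop 0 u) p - ∑ i : Fin 3, Ds i (Ds i u) p + cf μ lam p * Dop 0 u p
lemma W2m2 (lam : ℝ) (p : Pt) : Vt lam p * Wt (-2) p = Wt lam p * Wt (lam - 2) p := by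
  rw [Wt_mul, Wt_mul]; ring_nf
lemma czb {y z : ℝ} (h0 : 0 ≤ lam) (h1 : lam ≤ 1) (hy : 0 ≤ y) (N : ℕ) (ψ : Fn) (p : Pt) (hw : 1 ≤ Wt lam p) (hY : y ^ 2 = Y2 N ψ p) (hz : z = |ψ p|) : Vt lam p * y * (lam * (1 - lam) * Wt (-2) p * (y + z)) ≤ 2 * (A0 lam p * xx lam N ψ p) := by
  have e : Vt lam p * y * (lam * (1 - lam) * Wt (-2) p * (y + z)) = lam * (1 - lam) * Wt (lam - 2) p * (Wt lam p * y * (y + z)) := by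
    have := W2m2 lam p
    linear_combination (y * lam * (1 - lam) * (y + z)) * this
  rw [e]
  have w := Wt_pos lam p
  have w1 := Wt_pos (-1 - lam) p
  have w2 := Wt_pos (-2) p
  have w3 := Wt_pos (lam - 2) p
  have hx := xx_nonneg lam N ψ p
  have hx2 : Wt lam p * y * (y + z) ≤ 2 * xx lam N ψ p := by
    have zz : z ^ 2 = ψ p ^ 2 := by rw [hz, sq_abs]
    unfold xx
    rw [Wt_sq, ← hY, ← zz]
    have t1 : Wt lam p * y ^ 2 ≤ Wt lam p * Wt lam p * y ^ 2 := by
      have : Wt lam p ≤ Wt lam p * Wt lam p := by nlinarith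
      exact mlr this (sq_nonneg y)
    nlinarith [sq_nonneg (Wt lam p * y - z), sq_nonneg z]
  have hl : 0 ≤ lam * (1 - lam) * Wt (lam - 2) p := by
    have : 0 ≤ 1 - lam := by linarith
    positivity
  have hA : lam * (1 - lam) * Wt (lam - 2) p ≤ A0 lam p := by unfold A0; linarith
  calc _ ≤ lam * (1 - lam) * Wt (lam - 2) p * (2 * xx lam N ψ p) := mll hx2 hl
    _ ≤ A0 lam p * (2 * xx lam N ψ p) := mlr hA (by linarith)
    _ = _ := by ring
lemma remA (μ lam γ κ : ℝ) (hκ : 0 ≤ κ) (hl0 : 0 ≤ lam) (h1 : lam ≤ 1) (N : ℕ) : ∃ K ≥ 0, ∀ (M : ℝ) (ψ : Fn) (e : ℝ), Pk M lam N ψ e → EqU μ lam γ ψ → ∀ a : Wd, 1 ≤ a.length → a.length ≤ N → ∀ p : Pt, 0 < p.1 → |mult lam κ (DWord a ψ) p * (lin μ lam (DWord a ψ) p - ∑ α, ∑ β, gab μ lam γ ψ α β p * Dop α (Dop β (DWord a ψ)) p)| ≤ K * bt e lam N ψ p := by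
  obtain ⟨C1, hC1, k1⟩ := comm_nl μ lam γ hl0 h1 N
  obtain ⟨C2, hC2, k2⟩ := lin_bd μ lam hl0 h1 N
  obtain ⟨C3, hC3, k3⟩ := quad_bd lam (2 * lam) μ h1 N (N - N/2 + 1)
  refine ⟨(2 + κ) * (16 * C1 + 3 * C3 + 3 * C2), by positivity, fun M ψ e P hE a ha1 ha p hp => ?_⟩
  have H := P.ph p hp
  have w := Wt_pos lam p
  have w1 : 1 ≤ Wt lam p := one_le_Wt hl0 hp
  have he := P.e0
  have b1 := fun α β => k1 ψ p e _ P.sm H a ha α β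
  obtain ⟨b2, -, b2'⟩ := k2 ψ p _ P.sm hp H.Y0 H.b3 a ha
  have b3 := fun i : Fin 3 => k3 ψ p e _ _ P.sm H a ha i.succ
  have hY := Real.sq_sqrt (Y2_nonneg N ψ p)
  have eqn := eqU_word P.sm hE a p hp
  have m0 := P.hY a ha p hp 0
  have m1 := H.b3 a ha1 (by omega)
  have hczb := czb hl0 h1 H.Y0 N ψ p w1 hY rfl
  set y := √(Y2 N ψ p) with hy
  have y0 := H.Y0
  have mb : |mult lam κ (DWord a ψ) p| ≤ (2 + κ) * (Vt lam p * y) := by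
    unfold mult
    rw [Wt_sq]
    refine (abs_add_le _ _).trans ?_
    rw [abs_mul 2, abs_mul κ, abs_mul (Wt lam p * Wt lam p), abs_of_pos (mul_pos w w), abs_mul (Wt lam p), abs_of_pos w, abs_of_nonneg hκ, abs_two]
    have t1 := mll m0 (mul_pos w w).le
    have t2 := mll m1 w.le
    have t3 : Wt lam p * y ≤ Wt lam p * Wt lam p * y := mlr (by nlinarith) y0
    nlinarith [mll (t2.trans t3) hκ]
  have rb : |lin μ lam (DWord a ψ) p - ∑ α, ∑ β, gab μ lam γ ψ α β p * Dop α (Dop β (DWord a ψ)) p| ≤ (16 * C1 + 3 * C3) * (e * (Wt lam p)⁻¹ * y) + C2 * ((Wt (-1 - lam) p + Wt (-2) p) * y) + C2 * (lam * (1 - lam) * Wt (-2) p * (y + |ψ p|)) := by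
    have e1 : lin μ lam (DWord a ψ) p - ∑ α, ∑ β, gab μ lam γ ψ α β p * Dop α (Dop β (DWord a ψ)) p = (∑ α, ∑ β, (DWord a (fun p => gab μ lam γ ψ α β p * Dop α (Dop β ψ) p) p - gab μ lam γ ψ α β p * Dop α (Dop β (DWord a ψ)) p))
      - (DWord a (fun p => cf μ lam p * Dop 0 ψ p) p - cf μ lam p * Dop 0 (DWord a ψ) p) + DWord a (fun p => cz lam p * ψ p) p
      - (∑ i : Fin 3, DWord a (fun p => mc lam (2 * lam) μ p * (Ds i ψ p * Ds i ψ p)) p) := by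
      simp only [Finset.sum_sub_distrib]
      unfold lin
      linarith
    rw [e1]
    have s1 : |∑ α, ∑ β, (DWord a (fun p => gab μ lam γ ψ α β p * Dop α (Dop β ψ) p) p - gab μ lam γ ψ α β p * Dop α (Dop β (DWord a ψ)) p)| ≤ 16 * (C1 * (e * (Wt lam p)⁻¹ * y)) := by
      refine (Finset.abs_sum_le_sum_abs _ _).trans ?_
      refine (Finset.sum_le_sum fun α _ => (Finset.abs_sum_le_sum_abs _ _).trans (Finset.sum_le_sum fun β _ => b1 α β)).trans (le_of_eq ?_)
      simp; ring
    have s2 : |∑ i : Fin 3, DWord a (fun p => mc lam (2 * lam) μ p * (Ds i ψ p * Ds i ψ p)) p| ≤ 3 * (C3 * (e * (Wt lam p)⁻¹ * y)) := by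
      refine (Finset.abs_sum_le_sum_abs _ _).trans ((Finset.sum_le_sum fun i _ => b3 i).trans (le_of_eq ?_))
      simp
    refine (abs_sub _ _).trans ?_
    refine (add_le_add ((abs_add_le _ _).trans (add_le_add ((abs_sub _ _).trans (add_le_add s1 b2)) b2')) s2).trans (le_of_eq (by ring))
  rw [abs_mul]
  refine (mul_le_mul mb rb (abs_nonneg _) (by have := Wt_pos (2 * lam) p; positivity)).trans ?_
  rw [mul_assoc (2 + κ), mul_assoc (2 + κ)]
  refine mll ?_ (by linarith)
  have A0b : (Wt (-1 - lam) p + Wt (-2) p) * (Vt lam p * y ^ 2) ≤ A0 lam p * xx lam N ψ p := by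
    have : 0 ≤ 1 - lam := by linarith
    have w3 := Wt_pos (lam - 2) p
    have w4 := Wt_pos (2 * lam) p
    refine mul_le_mul ?_ ?_ (by positivity) (A0_nonneg hl0 h1 p)
    · unfold A0
      have : 0 ≤ lam * (1 - lam) * Wt (lam - 2) p := by positivity
      linarith
    · unfold xx; rw [hY]; nlinarith [sq_nonneg (ψ p)]
  have e2 : Vt lam p * y * (e * (Wt lam p)⁻¹ * y) = e * (Wt lam p * Y2 N ψ p) := by
    rw [Wt_sq, ← hY]; field_simp
  have z1 : 0 ≤ A0 lam p * xx lam N ψ p := mul_nonneg (A0_nonneg hl0 h1 p) (xx_nonneg _ _ _ _)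
  have z2 : 0 ≤ e * (Wt lam p * Y2 N ψ p) := by have := Y2_nonneg N ψ p; positivity
  unfold bt
  calc _ = (16 * C1 + 3 * C3) * (Vt lam p * y * (e * (Wt lam p)⁻¹ * y)) + C2 * ((Wt (-1 - lam) p + Wt (-2) p) * (Vt lam p * y ^ 2))
        + C2 * (Vt lam p * y * (lam * (1 - lam) * Wt (-2) p * (y + |ψ p|))) := by ring
    _ ≤ (16 * C1 + 3 * C3) * (e * (Wt lam p * Y2 N ψ p)) + C2 * (A0 lam p * xx lam N ψ p) + C2 * (2 * (A0 lam p * xx lam N ψ p)) := by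
      rw [e2]
      gcongr
    _ ≤ _ := by
      have : 0 ≤ C1 * (A0 lam p * xx lam N ψ p) := by positivity
      have : 0 ≤ C3 * (A0 lam p * xx lam N ψ p) := by positivity
      have : 0 ≤ C2 * (e * (Wt lam p * Y2 N ψ p)) := by positivity
      nlinarith
lemma rem0 (μ lam γ κ : ℝ) (hκ : 0 ≤ κ) (hl0 : 0 ≤ lam) (h1 : lam ≤ 1) (N : ℕ) : ∃ K ≥ 0, ∀ (M : ℝ) (ψ : Fn) (e : ℝ), Pk M lam N ψ e → EqU μ lam γ ψ → ∀ p : Pt, 0 < p.1 → |mult lam κ ψ p * (lin μ lam ψ p - ∑ α, ∑ β, gab μ lam γ ψ α β p * Dop α (Dop β ψ) p)| ≤ K * bt e lam N ψ p := by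
  obtain ⟨C, hC, k⟩ := mc_bound lam (2 * lam) μ h1 0
  refine ⟨(2 + κ) * (2 + 3 * C), by positivity, fun M ψ e P hE p hp => ?_⟩
  have hm := (k [] (by simp) p hp).1
  have H := P.ph p hp
  have w := Wt_pos lam p
  have w1 := one_le_Wt hl0 hp
  have he := P.e0
  have hY := Real.sq_sqrt (Y2_nonneg N ψ p)
  have d0 : |Dop 0 ψ p| ≤ e / Wt lam p := H.b1 [0] (by simp) (by simp)
  have dY := fun k => P.hY0 p hp k
  have hczb := czb hl0 h1 H.Y0 N ψ p w1 hY rfl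
  set y := √(Y2 N ψ p) with hy
  have y0 := H.Y0
  have e1 : lin μ lam ψ p - ∑ α, ∑ β, gab μ lam γ ψ α β p * Dop α (Dop β ψ) p = cz lam p * ψ p + (-1) * (∑ i : Fin 3, mc lam (2 * lam) μ p * (Ds i ψ p * Ds i ψ p)) := by
    have := hE p hp
    unfold lin; linarith
  rw [e1, mul_add]
  refine (abs_add_le _ _).trans ?_
  have s2 : |(-1) * ∑ i : Fin 3, mc lam (2 * lam) μ p * (Ds i ψ p * Ds i ψ p)| ≤ 3 * C * y ^ 2 := by
    rw [abs_mul, abs_neg, abs_one, one_mul]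
    refine (Finset.abs_sum_le_sum_abs _ _).trans ((Finset.sum_le_sum (g := fun _ => C * y ^ 2) fun i _ => ?_).trans (le_of_eq ?_))
    · exact tri_bd (dY _) (dY _) (mlr hm (sq_nonneg y))
    · simp; ring
  have mb1 : |mult lam κ ψ p| ≤ (2 + κ) * (e * Wt lam p) := by
    unfold mult
    rw [Wt_sq]
    refine (abs_add_le _ _).trans ?_
    rw [abs_mul 2, abs_mul κ, abs_mul (Wt lam p * Wt lam p), abs_of_pos (mul_pos w w), abs_mul (Wt lam p), abs_of_pos w, abs_of_nonneg hκ, abs_two]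
    have t1 := mll d0 (mul_pos w w).le
    have t2 := mll H.b0 w.le
    have t3 : Wt lam p * Wt lam p * (e / Wt lam p) = e * Wt lam p := by field_simp
    nlinarith [mll t2 hκ]
  have mb2 : |mult lam κ ψ p| ≤ 2 * (Vt lam p * y) + κ * (Wt lam p * |ψ p|) := by
    unfold mult
    refine (abs_add_le _ _).trans ?_
    rw [abs_mul, abs_mul, abs_mul, abs_mul, abs_of_pos (Wt_pos _ p), abs_of_pos w, abs_of_nonneg hκ, abs_two]
    have t1 := mll (dY 0) (Wt_pos (2 * lam) p).le
    linarith
  have wm := Wt_pos (-2) p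
  have hl2 : 0 ≤ lam * (1 - lam) := mul_nonneg hl0 (by linarith)
  have q1 : |mult lam κ ψ p * (cz lam p * ψ p)| ≤ (2 + κ) * (2 * (A0 lam p * xx lam N ψ p)) := by
    have ec : |cz lam p * ψ p| = lam * (1 - lam) * Wt (-2) p * |ψ p| := by
      unfold cz
      rw [abs_mul, abs_of_nonneg (by positivity)]
    rw [abs_mul, ec]
    have t := mlr mb2 (by positivity : 0 ≤ lam * (1 - lam) * Wt (-2) p * |ψ p|)
    refine t.trans ?_
    have t1 : Vt lam p * y * (lam * (1 - lam) * Wt (-2) p * |ψ p|) ≤ 2 * (A0 lam p * xx lam N ψ p) := by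
      refine le_trans ?_ hczb
      have := Wt_pos (2 * lam) p
      gcongr
      linarith
    have t2 : Wt lam p * |ψ p| * (lam * (1 - lam) * Wt (-2) p * |ψ p|) ≤ A0 lam p * xx lam N ψ p := by
      have e3 : Wt lam p * |ψ p| * (lam * (1 - lam) * Wt (-2) p * |ψ p|) = (lam * (1 - lam) * Wt (lam - 2) p) * ψ p ^ 2 := by
        have : Wt lam p * Wt (-2) p = Wt (lam - 2) p := by rw [Wt_mul]; ring_nf
        rw [← this, ← sq_abs (ψ p)]; ring
      rw [e3]
      have := Wt_pos (2 * lam) p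
      have := Wt_pos (-1 - lam) p
      have := Y2_nonneg N ψ p
      refine mul_le_mul ?_ ?_ (sq_nonneg _) (A0_nonneg hl0 h1 p)
      · unfold A0; linarith
      · unfold xx
        have : 0 ≤ Vt lam p * Y2 N ψ p := by positivity
        linarith
    have z1 : 0 ≤ A0 lam p * xx lam N ψ p := mul_nonneg (A0_nonneg hl0 h1 p) (xx_nonneg _ _ _ _)
    nlinarith [mll t2 hκ, mul_nonneg hκ z1]
  have q2 : |mult lam κ ψ p * ((-1) * ∑ i : Fin 3, mc lam (2 * lam) μ p * (Ds i ψ p * Ds i ψ p))| ≤ (2 + κ) * (3 * C * (e * (Wt lam p * Y2 N ψ p))) := by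
    rw [abs_mul]
    refine (mul_le_mul mb1 s2 (abs_nonneg _) (by positivity)).trans (le_of_eq ?_)
    rw [hY]; ring
  refine (add_le_add q1 q2).trans ?_
  have z1 : 0 ≤ A0 lam p * xx lam N ψ p := mul_nonneg (A0_nonneg hl0 h1 p) (xx_nonneg _ _ _ _)
  have z2 : 0 ≤ e * (Wt lam p * Y2 N ψ p) := by have := Y2_nonneg N ψ p; positivity
  rw [← mul_add, mul_assoc (2 + κ)]
  refine mll ?_ (by linarith)
  unfold bt
  have : 0 ≤ C * (A0 lam p * xx lam N ψ p) := by positivity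
  nlinarith
lemma mdF (μ lam γ κ : ℝ) (hκ : 0 ≤ κ) (hl0 : 0 ≤ lam) (h1 : lam ≤ 1) (N : ℕ) : ∃ K ≥ 0, ∀ (M : ℝ) (ψ : Fn) (e : ℝ), Pk M lam N ψ e → EqU μ lam γ ψ → ∀ a : Wd, a.length ≤ N → Md M (bt e lam N ψ) (om e lam N ψ) K (fun p => mult lam κ (DWord a ψ) p * lin μ lam (DWord a ψ) p) := by
  obtain ⟨K1, hK1, k1⟩ := remA μ lam γ κ hκ hl0 h1 N
  obtain ⟨K2, hK2, k2⟩ := rem0 μ lam γ κ hκ hl0 h1 N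
  obtain ⟨K3, hK3, k3⟩ := nlT μ lam γ hl0 h1 N
  obtain ⟨K4, hK4, k4⟩ := nlZ μ lam γ hl0 h1 N
  obtain ⟨K5, hK5, k5⟩ := nlZ0 μ lam γ h1 N
  refine ⟨(K1 + K2) + (K3 + |κ| * (K4 + K5)), by positivity, fun M ψ e P hE a ha => ?_⟩
  have r : Md M (bt e lam N ψ) (om e lam N ψ) (K1 + K2) (fun p => mult lam κ (DWord a ψ) p * (lin μ lam (DWord a ψ) p - ∑ α, ∑ β, gab μ lam γ ψ α β p * Dop α (Dop β (DWord a ψ)) p)) := by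
    by_cases h : a = []
    · subst h
      exact (Md.direct P.hω hK2 (k2 M ψ e P hE)).mono P.hβ P.hω (by linarith)
    · exact (Md.direct P.hω hK1 (k1 M ψ e P hE a (by have := List.length_pos_iff.2 h; omega) ha)).mono P.hβ P.hω (by linarith)
  have z : Md M (bt e lam N ψ) (om e lam N ψ) (K4 + K5) (fun p => (Wt lam p * DWord a ψ p) * ∑ α, ∑ β, gab μ lam γ ψ α β p * Dop α (Dop β (DWord a ψ)) p) := by
    by_cases h : a = []
    · subst h
      exact (k5 M ψ e P).mono P.hβ P.hω (by linarith)
    · exact (k4 M ψ e P a (by have := List.length_pos_iff.2 h; omega) ha).mono P.hβ P.hω (by linarith)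
  refine (r.add ((k3 M ψ e P a ha).add (z.smul κ))).congr fun p hp => ?_
  unfold mult; ring
lemma D_tri {h : Fn} (hh : Sm h) (hf : Sm f) (hg : Sm g) (k : Fin 4) (p : Pt) : Dop k (fun p => h p * (f p * g p)) p = Dop k h p * (f p * g p) + h p * (Dop k f p * g p + f p * Dop k g p) := by
  rw [D_mul hh (hf.mul hg), D_mul hf hg]
def eng (μ lam κ : ℝ) (u : Fn) (p : Pt) : ℝ := Vt lam p * (Dop 0 u p * Dop 0 u p) + (∑ i : Fin 3, Vt lam p * (Ds i u p * Ds i u p)) + κ * (Wt lam p * (u p * Dop 0 u p)) + (κ * μ / 2) * (1 * (u p * u p)) + (κ * lam / 2) * (Wt (lam - 1) p * (u p * u p))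
def flx (lam κ : ℝ) (u : Fn) (i : Fin 3) (p : Pt) : ℝ := 2 * (Vt lam p * (Dop 0 u p * Ds i u p)) + κ * (Wt lam p * (u p * Ds i u p))
lemma eng_sm (μ lam κ : ℝ) (hu : Sm u) : Sm (eng μ lam κ u) := by
  have h0 := hu.D 0
  have w := Wt_sm (2 * lam)
  have w1 := Wt_sm lam
  have w2 := Wt_sm (lam - 1)
  have s : Sm (fun p => ∑ i : Fin 3, Vt lam p * (Ds i u p * Ds i u p)) := ContDiff.sum fun i _ => w.mul ((hu.D _).mul (hu.D _))
  exact ((((w.mul (h0.mul h0)).add s).add (contDiff_const.mul (w1.mul (hu.mul h0)))).add (contDiff_const.mul (contDiff_const.mul (hu.mul hu)))).add (contDiff_const.mul (w2.mul (hu.mul hu)))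
lemma flx_sm (lam κ : ℝ) (hu : Sm u) (i : Fin 3) : Sm (flx lam κ u i) := (contDiff_const.mul ((Wt_sm _).mul ((hu.D _).mul (hu.D _)))).add (contDiff_const.mul ((Wt_sm _).mul (hu.mul (hu.D _))))
lemma eng_sp (μ lam κ : ℝ) (hu : Sp M u) : Sp M (eng μ lam κ u) := ((((((hu.D 0).mul _).mul' _).add (Sp.sum _ fun i _ => ((hu.D _).mul _).mul' _)).add (((hu.mul _).mul' _).mul' (fun _ => κ))).add (((hu.mul _).mul' (fun _ => 1)).mul' (fun _ => κ * μ / 2))).add (((hu.mul _).mul' _).mul' (fun _ => κ * lam / 2))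
lemma flx_sp (lam κ : ℝ) (hu : Sp M u) (i : Fin 3) : Sp M (flx lam κ u i) := ((((hu.D 0).mul _).mul' _).mul' (fun _ => 2)).add (((hu.mul _).mul' _).mul' (fun _ => κ))
lemma D_eng (μ lam κ : ℝ) (hu : Sm u) (p : Pt) : Dop 0 (eng μ lam κ u) p = (Dop 0 (Vt lam) p * (Dop 0 u p * Dop 0 u p) + Vt lam p * (Dop 0 (Dop 0 u) p * Dop 0 u p + Dop 0 u p * Dop 0 (Dop 0 u) p)) + (∑ i : Fin 3, (Dop 0 (Vt lam) p * (Ds i u p * Ds i u p) + Vt lam p * (Dop 0 (Ds i u) p * Ds i u p + Ds i u p * Dop 0 (Ds i u) p))) + κ * (Dop 0 (Wt lam) p * (u p * Dop 0 u p) + Wt lam p * (Dop 0 u p * Dop 0 u p + u p * Dop 0 (Dop 0 u) p)) + (κ * μ / 2) * (Dop 0 u p * u p + u p * Dop 0 u p) + (κ * lam / 2) * (Dop 0 (Wt (lam - 1)) p * (u p * u p) + Wt (lam - 1) p * (Dop 0 u p * u p + u p * Dop 0 u p)) := by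
  have h0 := hu.D 0
  have w := Wt_sm (2 * lam)
  have w1 := Wt_sm lam
  have w2 := Wt_sm (lam - 1)
  have c1 : Sm (fun _ => 1) := contDiff_const
  have a1 : Sm (fun p => Vt lam p * (Dop 0 u p * Dop 0 u p)) := w.mul (h0.mul h0)
  have a2 : ∀ i : Fin 3, Sm (fun p => Vt lam p * (Ds i u p * Ds i u p)) := fun i => w.mul ((hu.D _).mul (hu.D _))
  have a2s : Sm (fun p => ∑ i : Fin 3, Vt lam p * (Ds i u p * Ds i u p)) := ContDiff.sum fun i _ => a2 i
  have a3 := w1.mul (hu.mul h0)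
  have a4 : Sm (fun p => 1 * (u p * u p)) := contDiff_const.mul (hu.mul hu)
  have a5 := w2.mul (hu.mul hu)
  have a3' : Sm (fun p => κ * (Wt lam p * (u p * Dop 0 u p))) := contDiff_const.mul a3
  have a4' : Sm (fun p => (κ * μ / 2) * (1 * (u p * u p))) := contDiff_const.mul a4
  have a5' : Sm (fun p => (κ * lam / 2) * (Wt (lam - 1) p * (u p * u p))) := contDiff_const.mul a5
  have e : eng μ lam κ u = fun p => Vt lam p * (Dop 0 u p * Dop 0 u p) + (∑ i : Fin 3, Vt lam p * (Ds i u p * Ds i u p)) + κ * (Wt lam p * (u p * Dop 0 u p)) + (κ * μ / 2) * (1 * (u p * u p)) + (κ * lam / 2) * (Wt (lam - 1) p * (u p * u p)) := rfl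
  rw [e, D_add (((a1.add a2s).add a3').add a4') a5', D_add ((a1.add a2s).add a3') a4', D_add (a1.add a2s) a3', D_add a1 a2s, D_sum _ (fun i _ => a2 i), D_cmul a3, D_cmul a4, D_cmul a5]
  simp only [D_tri w h0 h0, D_tri w1 hu h0, D_tri w2 hu hu, D_tri c1 hu hu, D_const]
  simp only [fun i : Fin 3 => D_tri w (hu.D i.succ) (hu.D i.succ) 0]
  ring
lemma D_flx (lam κ : ℝ) (hu : Sm u) (i : Fin 3) (p : Pt) : Ds i (flx lam κ u i) p = 2 * (Vt lam p * (Dop 0 (Ds i u) p * Ds i u p + Dop 0 u p * Ds i (Ds i u) p)) + κ * (Wt lam p * (Ds i u p * Ds i u p + u p * Ds i (Ds i u) p)) := by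
  have h0 := hu.D 0
  have hi := hu.D i.succ
  have w := Wt_sm (2 * lam)
  have w1 := Wt_sm lam
  have a1 := w.mul (h0.mul hi)
  have a2 := w1.mul (hu.mul hi)
  have a1' : Sm (fun p => 2 * (Vt lam p * (Dop 0 u p * Ds i u p))) := contDiff_const.mul a1
  have a2' : Sm (fun p => κ * (Wt lam p * (u p * Ds i u p))) := contDiff_const.mul a2
  have e : flx lam κ u i = fun p => 2 * (Vt lam p * (Dop 0 u p * Ds i u p)) + κ * (Wt lam p * (u p * Ds i u p)) := rfl
  rw [e, D_add a1' a2', D_cmul a1, D_cmul a2]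
  simp only [D_tri w h0 hi, D_tri w1 hu hi, Di_Wt, D_comm hu i.succ 0]
  ring
def Qf (μ lam κ : ℝ) (u : Fn) (p : Pt) : ℝ := (2 * μ * Wt lam p + 2 * lam * Wt (2 * lam - 1) p - κ * Wt lam p) * Dop 0 u p ^ 2 + (κ * Wt lam p - 2 * lam * Wt (2 * lam - 1) p) * (∑ i : Fin 3, Ds i u p ^ 2) + κ * lam * (1 - lam) / 2 * Wt (lam - 2) p * u p ^ 2
lemma lin_id (μ lam κ : ℝ) (hu : Sm u) (hp : 0 < p.1) : mult lam κ u p * lin μ lam u p = Dop 0 (eng μ lam κ u) p - (∑ i : Fin 3, Ds i (flx lam κ u i) p) + Qf μ lam κ u p := by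
  rw [D_eng μ lam κ hu]
  simp only [D_flx lam κ hu]
  rw [D0_Wt _ p hp, D0_Wt _ p hp, D0_Wt _ p hp]
  have e1 : Vt lam p * Wt (-lam) p = Wt lam p := by rw [Wt_mul]; ring_nf
  have e2 : Vt lam p * Wt (-1) p = Wt (2 * lam - 1) p := by rw [Wt_mul]; ring_nf
  have e3 : Wt lam p * Wt (-lam) p = 1 := by rw [Wt_mul, add_neg_cancel, Wt_zero]
  have e4 : Wt lam p * Wt (-1) p = Wt (lam - 1) p := by rw [Wt_mul]; ring_nf
  have e5 : Wt (lam - 1 - 1) p = Wt (lam - 2) p := by ring_nf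
  rw [e5]
  simp only [mult, lin, cf, Qf, Fin.sum_univ_three]
  set a := Dop 0 u p
  linear_combination (2 * μ * a ^ 2) * e1 + (4 * lam * a ^ 2) * e2 + (κ * μ * u p * a) * e3 + (2 * κ * lam * u p * a) * e4
lemma kap (hμ : 0 < μ) (hl : 0 < lam) (h1 : lam ≤ 1) : ∃ κ > 0, ∃ K1 ≥ 0, ∀ s : ℝ, 1 ≤ s → κ ≤ μ + 2 * lam * s ^ (lam - 1) ∧ μ / 2 - K1 * s ^ (-1 : ℝ) ≤ κ - 2 * lam * s ^ (lam - 1) := by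
  rcases eq_or_lt_of_le h1 with rfl | h
  · refine ⟨μ + 2, by linarith, 0, le_rfl, fun s hs => ?_⟩
    simp; linarith
  · have hm : 0 < 1 - lam := by linarith
    obtain ⟨s0, hs0, hb⟩ : ∃ s0 > 0, ∀ s : ℝ, 0 < s → s ≤ s0 → 2 * s ^ (1 - lam) ≤ μ / 2 := by
      refine ⟨(μ / 4) ^ (1 / (1 - lam)), by positivity, fun s hs h2 => ?_⟩
      have := Real.rpow_le_rpow hs.le h2 hm.le
      rw [← Real.rpow_mul (by positivity), one_div, inv_mul_cancel₀ hm.ne', Real.rpow_one] at this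
      linarith
    refine ⟨μ, hμ, 2 / s0, by positivity, fun s hs => ?_⟩
    have sp : 0 < s := by linarith
    have p1 : 0 < s ^ (lam - 1) := Real.rpow_pos_of_pos sp _
    refine ⟨by nlinarith [mul_pos hl p1], ?_⟩
    suffices h3 : 2 * lam * s ^ (lam - 1) ≤ μ / 2 + 2 / s0 * s ^ (-1 : ℝ) by linarith
    have l1 : 2 * lam * s ^ (lam - 1) ≤ 2 * s ^ (lam - 1) := by nlinarith
    refine l1.trans ?_
    rw [Real.rpow_neg_one]
    rcases le_total s⁻¹ s0 with h4 | h4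
    · have := hb s⁻¹ (by positivity) h4
      rw [Real.inv_rpow sp.le, ← Real.rpow_neg sp.le, neg_sub] at this
      have : 0 ≤ 2 / s0 * s⁻¹ := by positivity
      linarith
    · have : s ^ (lam - 1) ≤ 1 := Real.rpow_le_one_of_one_le_of_nonpos hs (by linarith)
      have : 2 ≤ 2 / s0 * s⁻¹ := by rw [div_mul_eq_mul_div, le_div_iff₀ hs0]; linarith
      linarith
lemma pos_q {κ s u d : ℝ} (hκ : 0 < κ) (hμ : 0 < μ) (hd : κ * (κ + μ) / 4 ≤ d) : (μ / 2) / (κ + μ / 2) * s ^ 2 + κ * μ / 8 * u ^ 2 ≤ s ^ 2 + κ * (s * u) + d * u ^ 2 := by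
  have h : 0 < κ + μ / 2 := by linarith
  have e : (μ / 2) / (κ + μ / 2) * s ^ 2 = s ^ 2 - κ / (κ + μ / 2) * s ^ 2 := by field_simp; ring
  have e2 : κ / (κ + μ / 2) * s ^ 2 + κ * (s * u) + κ * (κ + μ / 2) / 4 * u ^ 2 = κ / (κ + μ / 2) * (s + (κ + μ / 2) / 2 * u) ^ 2 := by
    field_simp; ring
  have e3 : 0 ≤ κ / (κ + μ / 2) * (s + (κ + μ / 2) / 2 * u) ^ 2 := by positivity
  nlinarith
lemma eng_lo {κ : ℝ} (hμ : 0 < μ) (hl : 0 < lam) (hκ : 0 < κ) (hp : 0 < p.1) (hk : κ ≤ μ + 2 * lam * Wt (lam - 1) p) : ∃ c > 0, c = min ((μ / 2) / (κ + μ / 2)) (κ * μ / 8) ∧ ∀ u : Fn, c * (Vt lam p * (∑ α, Dop α u p ^ 2) + u p ^ 2) ≤ eng μ lam κ u p := by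
  refine ⟨_, by positivity, rfl, fun u => ?_⟩
  set c := min ((μ / 2) / (κ + μ / 2)) (κ * μ / 8) with hc
  have c1 : c ≤ (μ / 2) / (κ + μ / 2) := min_le_left _ _
  have c2 : c ≤ κ * μ / 8 := min_le_right _ _
  have c3 : (μ / 2) / (κ + μ / 2) ≤ 1 := by rw [div_le_one (by linarith)]; linarith
  have := pos_q (s := Wt lam p * Dop 0 u p) (u := u p) (d := κ / 2 * (μ + lam * Wt (lam - 1) p)) hκ hμ (by nlinarith)
  rw [Fin.sum_univ_succ]
  have q1 : 0 ≤ Vt lam p * ∑ i : Fin 3, Ds i u p ^ 2 := mul_nonneg (Wt_pos _ p).le (Finset.sum_nonneg fun _ _ => sq_nonneg _)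
  have q2 : 0 ≤ (Wt lam p * Dop 0 u p) ^ 2 := sq_nonneg _
  have q3 := sq_nonneg (u p)
  have e : eng μ lam κ u p = (Wt lam p * Dop 0 u p) ^ 2 + Vt lam p * (∑ i : Fin 3, Ds i u p ^ 2) + κ * (Wt lam p * Dop 0 u p * u p) + κ / 2 * (μ + lam * Wt (lam - 1) p) * u p ^ 2 := by
    rw [Finset.mul_sum]
    simp only [eng, Wt_sq, Fin.sum_univ_three]; ring
  rw [e]
  have e2 : Vt lam p * (Dop 0 u p ^ 2 + ∑ i : Fin 3, Ds i u p ^ 2) = (Wt lam p * Dop 0 u p) ^ 2 + Vt lam p * ∑ i : Fin 3, Ds i u p ^ 2 := by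
    rw [Wt_sq]; ring
  rw [e2]
  have := mlr c1 q2
  have := mlr c2 q3
  have := mlr (c1.trans c3) q1
  linarith
lemma eng_hi {κ : ℝ} (hμ : 0 < μ) (hl : 0 < lam) (h1 : lam ≤ 1) (hκ : 0 < κ) (hp : 0 < p.1) (u : Fn) : eng μ lam κ u p ≤ (1 + κ + κ * μ) * (Vt lam p * (∑ α, Dop α u p ^ 2) + u p ^ 2) := by
  have q1 : 0 ≤ Vt lam p * ∑ i : Fin 3, Ds i u p ^ 2 := mul_nonneg (Wt_pos _ p).le (Finset.sum_nonneg fun _ _ => sq_nonneg _)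
  have q3 := sq_nonneg (u p)
  have e : eng μ lam κ u p = (Wt lam p * Dop 0 u p) ^ 2 + Vt lam p * (∑ i : Fin 3, Ds i u p ^ 2) + κ * (Wt lam p * Dop 0 u p * u p) + κ / 2 * (μ + lam * Wt (lam - 1) p) * u p ^ 2 := by
    rw [Finset.mul_sum]
    simp only [eng, Wt_sq, Fin.sum_univ_three]; ring
  have e2 : Vt lam p * (Dop 0 u p ^ 2 + ∑ i : Fin 3, Ds i u p ^ 2) = (Wt lam p * Dop 0 u p) ^ 2 + Vt lam p * ∑ i : Fin 3, Ds i u p ^ 2 := by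
    rw [Wt_sq]; ring
  rw [Fin.sum_univ_succ, e, e2]
  set s := Wt lam p * Dop 0 u p
  have hw := Wt_le_one (a := lam - 1) (by linarith) hp
  have hw0 := Wt_pos (lam - 1) p
  have b1 : lam * Wt (lam - 1) p ≤ 1 := by nlinarith
  have b2 : κ / 2 * (μ + lam * Wt (lam - 1) p) * u p ^ 2 ≤ κ / 2 * (μ + 1) * u p ^ 2 := by gcongr
  have b3 : κ * (s * u p) ≤ κ * ((s ^ 2 + u p ^ 2) / 2) := mll (by nlinarith [sq_nonneg (s - u p)]) hκ.le
  have s0 := sq_nonneg s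
  have k1 : 0 ≤ κ * s ^ 2 := by positivity
  have k2 : 0 ≤ κ * u p ^ 2 := by positivity
  have k3 : 0 ≤ κ * μ * u p ^ 2 := by positivity
  have k4 : 0 ≤ κ * μ * s ^ 2 := by positivity
  have k5 : 0 ≤ (κ + κ * μ) * (Vt lam p * ∑ i : Fin 3, Ds i u p ^ 2) := by positivity
  nlinarith
lemma Qf_lo {κ K1 : ℝ} (hμ : 0 < μ) (hl : 0 < lam) (h1 : lam ≤ 1) (hκ : 0 < κ) (hK : 0 ≤ K1) (hp : 0 < p.1) (hk : κ ≤ μ + 2 * lam * Wt (lam - 1) p) (hk2 : μ / 2 - K1 * Wt (-1) p ≤ κ - 2 * lam * Wt (lam - 1) p) (u : Fn) : μ / 2 * (Wt lam p * ∑ α, Dop α u p ^ 2) - K1 * (Wt (-1 - lam) p * (Vt lam p * ∑ α, Dop α u p ^ 2)) ≤ Qf μ lam κ u p := by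
  have e1 : Wt (2 * lam - 1) p = Wt lam p * Wt (lam - 1) p := by rw [Wt_mul]; ring_nf
  have e2 : Wt (-1 - lam) p * Vt lam p = Wt lam p * Wt (-1) p := by rw [Wt_mul, Wt_mul]; ring_nf
  rw [← mul_assoc (Wt (-1 - lam) p), e2]
  unfold Qf
  rw [Fin.sum_univ_succ, e1]
  set S := ∑ i : Fin 3, Ds i u p ^ 2 with hS
  have S0 : 0 ≤ S := Finset.sum_nonneg fun _ _ => sq_nonneg _
  have w := Wt_pos lam p
  have w1 := Wt_pos (-1) p
  have a0 := sq_nonneg (Dop 0 u p)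
  have r : 0 ≤ κ * lam * (1 - lam) / 2 * Wt (lam - 2) p * u p ^ 2 := by
    have := Wt_pos (lam - 2) p
    have : 0 ≤ 1 - lam := by linarith
    positivity
  have x1 := mlr hk2 (mul_nonneg w.le S0)
  have x2 := mlr hk (mul_nonneg w.le a0)
  have x3 : 0 ≤ K1 * (Wt lam p * Wt (-1) p * Dop 0 u p ^ 2) := by positivity
  have x4 : 0 ≤ μ * (Wt lam p * Dop 0 u p ^ 2) := by positivity
  nlinarith
lemma D_wsum {n : ℕ} {F : Wd → Fn} (h : ∀ l, Sm (F l)) (k : Fin 4) (p : Pt) : Dop k (fun p => wsum n (fun l => F l p)) p = wsum n (fun l => Dop k (F l) p) := by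
  unfold wsum
  rw [D_sum _ (fun m _ => ContDiff.sum fun a _ => h _)]
  refine Finset.sum_congr rfl fun m _ => ?_
  rw [D_sum _ (fun a _ => h _)]
lemma wsum_sum3 {n : ℕ} (F : Fin 3 → Wd → ℝ) : ∑ i, wsum n (F i) = wsum n (fun l => ∑ i, F i l) := by
  simp only [Fin.sum_univ_three, wsum_add]
lemma Wrt {s : ℝ} (p : Pt) (hp : 0 < p.1) : Wt s p = (1 + p.1) ^ s := Wt_eq s hp.le
lemma enPt (μ lam γ : ℝ) (hμ : 0 < μ) (hl : 0 < lam) (h1 : lam ≤ 1) (N : ℕ) : ∃ c > 0, ∃ C ≥ 1, ∃ δ > 0, ∀ (M : ℝ) (ψ : Fn) (e : ℝ), Pk M lam N ψ e → EqU μ lam γ ψ → e ≤ δ → ∃ G : Fn, Sm G ∧ Sp M G ∧ ∃ V : Fin 3 → Fn, (∀ i, Sm (V i)) ∧ (∀ i, Sp M (V i)) ∧ ∀ p : Pt, 0 < p.1 → c * xx lam N ψ p ≤ G p ∧ G p ≤ C * xx lam N ψ p ∧ Dop 0 G p + ∑ i : Fin 3, Ds i (V i) p ≤ - c * (Wt lam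 p * Y2 N ψ p) + C * (A0 lam p * xx lam N ψ p) := by
  obtain ⟨κ, hκ, K1, hK1, hk⟩ := kap hμ hl h1
  obtain ⟨K, hK, hm⟩ := mdF μ lam γ κ hκ.le hl.le h1 N
  obtain ⟨c0, hc0, hc0e⟩ : ∃ c > 0, c = min ((μ / 2) / (κ + μ / 2)) (κ * μ / 8) := ⟨_, by positivity, rfl⟩
  set n := wsum N (fun _ : Wd => 1) with hn
  have n0 : 0 ≤ n := wsum_nonneg fun _ => zero_le_one
  have nK : 0 ≤ n * K := by positivity
  refine ⟨min (c0 / 2) (μ / 4), by positivity, 1 + (1 + κ + κ * μ) * (1 + n) + c0 + n * K + K1, ?_, min (c0 / 2) (μ / 4) / (n * K + 1), by positivity, fun M ψ e P hE he => ?_⟩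
  · have : 0 ≤ (1 + κ + κ * μ) * (1 + n) := by positivity
    linarith
  have e0 := P.e0
  set c := min (c0 / 2) (μ / 4) with hc
  have hc_pos : 0 < c := by positivity
  have c1 : c ≤ c0 / 2 := min_le_left _ _
  have c2 : c ≤ μ / 4 := min_le_right _ _
  have nKe : n * K * e ≤ c := by
    rw [le_div_iff₀ (by positivity)] at he
    nlinarith
  have hV : ∀ a : Wd, ∃ V : Fin 4 → Fn, (∀ k, Sm (V k)) ∧ (∀ k, Sp M (V k)) ∧ (a.length ≤ N → ∀ p, 0 < p.1 → |mult lam κ (DWord a ψ) p * lin μ lam (DWord a ψ) p - ∑ k, Dop k (V k) p| ≤ K * bt e lam N ψ p ∧ |V 0 p| ≤ K * om e lam N ψ p) := by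
    intro a
    by_cases ha : a.length ≤ N
    · obtain ⟨V, h1, h2, h3⟩ := hm M ψ e P hE a ha
      exact ⟨V, h1, h2, fun _ => h3⟩
    · exact ⟨fun _ _ => 0, fun _ => contDiff_const, fun _ _ _ _ => rfl, fun h => absurd h ha⟩
  choose V Vs Vp Vb using hV
  have us : ∀ a, Sm (DWord a ψ) := fun a => P.sm.W a
  have up : ∀ a, Sp M (DWord a ψ) := fun a => P.sp.W a
  have g1 : ∀ a, Sm (fun p => eng μ lam κ (DWord a ψ) p - V a 0 p) := fun a => (eng_sm μ lam κ (us a)).sub (Vs a 0)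
  have g2 : ∀ i a, Sm (fun p => (-1) * flx lam κ (DWord a ψ) i p - V a i.succ p) := fun i a => (contDiff_const.mul (flx_sm lam κ (us a) i)).sub (Vs a _)
  refine ⟨fun p => wsum N fun a => eng μ lam κ (DWord a ψ) p - V a 0 p, wsum_sm g1, wsum_sp fun a => (eng_sp μ lam κ (up a)).sub (Vp a 0), fun i p => wsum N fun a => (-1) * flx lam κ (DWord a ψ) i p - V a i.succ p, fun i => wsum_sm (g2 i), fun i => wsum_sp fun a => ((flx_sp lam κ (up a) i).mul' (fun _ => -1)).sub (Vp a _), fun p hp => ?_⟩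
  have hs := hk (1 + p.1) (by linarith)
  rw [← Wrt p hp, ← Wrt p hp] at hs
  have X0 := xx_nonneg lam N ψ p
  have Y0 := Y2_nonneg N ψ p
  have W2 := Wt_pos (2 * lam) p
  have W21 := one_le_Wt (a := 2 * lam) (by linarith) hp
  have WY : 0 ≤ Vt lam p * Y2 N ψ p := by positivity
  have WYx : Vt lam p * Y2 N ψ p ≤ xx lam N ψ p := by unfold xx; nlinarith [sq_nonneg (ψ p)]
  have sY : wsum N (fun a : Wd => Vt lam p * ∑ α, Dop α (DWord a ψ) p ^ 2) = Vt lam p * Y2 N ψ p := wsum_mul _ _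
  refine ⟨?_, ?_, ?_⟩
  · have lo : wsum N (fun a => c0 * (Vt lam p * (∑ α, Dop α (DWord a ψ) p ^ 2) + DWord a ψ p ^ 2) + (-1) * (K * om e lam N ψ p)) ≤ wsum N (fun a => eng μ lam κ (DWord a ψ) p - V a 0 p) := wsum_le fun a ha => by
      have := (abs_le.1 (Vb a ha p hp).2).2
      obtain ⟨c', _, hc', h⟩ := eng_lo hμ hl hκ hp hs.1
      rw [hc', ← hc0e] at h
      have := h (DWord a ψ)
      linarith
    refine le_trans ?_ lo
    rw [wsum_add, wsum_mul, wsum_add, sY, wsum_const, ← hn]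
    have : ψ p ^ 2 ≤ wsum N (fun a => DWord a ψ p ^ 2) := le_wsum (F := fun a => DWord a ψ p ^ 2) (fun _ => sq_nonneg _) [] (by simp)
    have a1 : c0 * xx lam N ψ p ≤ c0 * (Vt lam p * Y2 N ψ p + wsum N (fun a => DWord a ψ p ^ 2)) := by
      unfold xx; gcongr
    have a2 : n * (K * om e lam N ψ p) ≤ c * xx lam N ψ p := by
      have : n * (K * om e lam N ψ p) = n * K * e * (Vt lam p * Y2 N ψ p) := by unfold om; ring
      rw [this]
      exact mul_le_mul nKe WYx WY hc_pos.le
    have a3 : c * xx lam N ψ p ≤ c0 / 2 * xx lam N ψ p := by gcongr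
    linarith
  · have hi : wsum N (fun a => eng μ lam κ (DWord a ψ) p - V a 0 p) ≤ wsum N (fun a => (1 + κ + κ * μ) * (Vt lam p * (∑ α, Dop α (DWord a ψ) p ^ 2) + xx lam N ψ p) + K * om e lam N ψ p) := wsum_le fun a ha => by
      have := (abs_le.1 (Vb a ha p hp).2).1
      have h2 := eng_hi hμ hl h1 hκ hp (DWord a ψ)
      have h3 : DWord a ψ p ^ 2 ≤ xx lam N ψ p := by
        cases a with
        | nil => show ψ p ^ 2 ≤ _; unfold xx; linarith
        | cons k l =>
          refine (W_le_Y (N := N) ψ p (k :: l) (by simp) (by omega)).trans ?_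
          refine le_trans ?_ WYx
          nlinarith
      have : (1 + κ + κ * μ) * (Vt lam p * (∑ α, Dop α (DWord a ψ) p ^ 2) + DWord a ψ p ^ 2) ≤ (1 + κ + κ * μ) * (Vt lam p * (∑ α, Dop α (DWord a ψ) p ^ 2) + xx lam N ψ p) := by gcongr
      linarith
    refine hi.trans ?_
    rw [wsum_add, wsum_mul, wsum_add, sY, wsum_const (xx lam N ψ p), wsum_const (K * om e lam N ψ p), ← hn]
    have a2 : n * (K * om e lam N ψ p) ≤ c * xx lam N ψ p := by
      have : n * (K * om e lam N ψ p) = n * K * e * (Vt lam p * Y2 N ψ p) := by unfold om; ring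
      rw [this]
      exact mul_le_mul nKe WYx WY hc_pos.le
    have a3 : c * xx lam N ψ p ≤ c0 * xx lam N ψ p := mlr (by linarith) X0
    have a4 : (1 + κ + κ * μ) * (Vt lam p * Y2 N ψ p + n * xx lam N ψ p) ≤ (1 + κ + κ * μ) * (xx lam N ψ p + n * xx lam N ψ p) := by gcongr
    have a5 : 0 ≤ (n * K + K1) * xx lam N ψ p := by positivity
    linarith
  · rw [D_wsum g1]
    simp only [D_wsum (g2 _)]
    rw [wsum_sum3, ← wsum_add]
    have hi : wsum N (fun a => Dop 0 (fun p => eng μ lam κ (DWord a ψ) p - V a 0 p) p + ∑ i : Fin 3, Ds i (fun p => (-1) * flx lam κ (DWord a ψ) i p - V a i.succ p) p) ≤ wsum N (fun a => K * bt e lam N ψ p + ((-(μ / 2) * Wt lam p + K1 * Wt (-1 - lam) p * Vt lam p) * ∑ α, Dop α (DWord a ψ) p ^ 2)) := wsum_le fun a ha => by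
      have q1 := (abs_le.1 (Vb a ha p hp).1).2
      have q2 := Qf_lo hμ hl h1 hκ hK1 hp hs.1 hs.2 (DWord a ψ)
      have q3 := lin_id μ lam κ (us a) hp
      have q4 : ∀ i : Fin 3, Ds i (fun p => (-1) * flx lam κ (DWord a ψ) i p - V a i.succ p) p = (-1) * Ds i (flx lam κ (DWord a ψ) i) p - Ds i (V a i.succ) p := fun i => by
        rw [D_sub (contDiff_const.mul (flx_sm lam κ (us a) i)) (Vs a _), D_cmul (flx_sm lam κ (us a) i)]
      rw [D_sub (eng_sm μ lam κ (us a)) (Vs a 0)]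
      simp only [q4, Finset.sum_sub_distrib, ← Finset.mul_sum]
      rw [Fin.sum_univ_succ (n := 3)] at q1
      linarith
    refine hi.trans ?_
    rw [wsum_add, wsum_const, ← hn, wsum_mul]
    change n * (K * bt e lam N ψ p) + (-(μ / 2) * Wt lam p + K1 * Wt (-1 - lam) p * Vt lam p) * Y2 N ψ p ≤ _
    have eb : n * (K * bt e lam N ψ p) = n * K * e * (Wt lam p * Y2 N ψ p) + n * K * (A0 lam p * xx lam N ψ p) := by unfold bt; ring
    have wY : 0 ≤ Wt lam p * Y2 N ψ p := mul_nonneg (Wt_pos _ _).le Y0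
    have a1 := mlr (nKe.trans c2) wY
    have a2 := mlr c2 wY
    have A00 := A0_nonneg hl.le h1 p
    have AX := mul_nonneg A00 X0
    have a3 : Wt (-1 - lam) p * (Vt lam p * Y2 N ψ p) ≤ A0 lam p * xx lam N ψ p := by
      refine mul_le_mul ?_ WYx WY A00
      unfold A0
      have := Wt_pos (-2) p
      have : 0 ≤ lam * (1 - lam) * Wt (lam - 2) p := mul_nonneg (mul_nonneg hl.le (by linarith)) (Wt_pos _ p).le
      linarith
    have a4 := mll a3 hK1
    have a5 : 0 ≤ (1 + (1 + κ + κ * μ) * (1 + n) + c0) * (A0 lam p * xx lam N ψ p) := by positivity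
    linarith
lemma it_cont (hf : Sm f) (h : Sp M f) : ContinuousOn (fun s => ∫ x : E3, f (s, x)) (Ioi 0) := fun _ ht => (int_dt hf h ht).continuousAt.continuousWithinAt
def a0 (lam t : ℝ) : ℝ := (1 + t) ^ (-1 - lam) + (1 + t) ^ (-2 : ℝ) + lam * (1 - lam) * (1 + t) ^ (lam - 2)
def xt (lam : ℝ) (N : ℕ) (ψ : Fn) (t : ℝ) : ℝ := ∫ x : E3, xx lam N ψ (t, x)
def ddt (lam : ℝ) (N : ℕ) (ψ : Fn) (t : ℝ) : ℝ := ∫ x : E3, Wt lam (t, x) * Y2 N ψ (t, x)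
lemma xx_sm (lam : ℝ) (N : ℕ) (h : Sm ψ) : Sm (xx lam N ψ) := ((Wt_sm _).mul (Y2_sm h)).add (h.pow 2)
lemma xx_sp (lam : ℝ) (N : ℕ) (h : Sp M ψ) : Sp M (xx lam N ψ) := ((Y2_sp h).mul' _).add h.sq
lemma dd_sm (lam : ℝ) (N : ℕ) (h : Sm ψ) : Sm (fun p => Wt lam p * Y2 N ψ p) := (Wt_sm _).mul (Y2_sm h)
lemma dd_sp (lam : ℝ) (N : ℕ) (h : Sp M ψ) : Sp M (fun p => Wt lam p * Y2 N ψ p) := (Y2_sp h).mul' _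
lemma a0_cont (lam : ℝ) : ContinuousOn (a0 lam) (Ici 0) := by
  have : ∀ b : ℝ, ContinuousOn (fun t : ℝ => (1 + t) ^ b) (Ici 0) := fun b =>
    ContinuousOn.rpow_const (by fun_prop) fun t ht => Or.inl (by have : (0:ℝ) ≤ t := ht; linarith)
  exact ((this _).add (this _)).add (continuousOn_const.mul (this _))
lemma enInt (μ lam γ M : ℝ) (hμ : 0 < μ) (hl : 0 < lam) (h1 : lam ≤ 1) (hM : 0 < M) (N : ℕ) (hN : 8 ≤ N) : ∃ C ≥ 1, ∃ δ > 0, ∀ (E : ℝ) (ψ : Fn), Hyp μ lam γ M N ψ E → E ≤ δ → ∀ s t : ℝ, 0 < s → s ≤ t → xt lam N ψ t + ∫ r in s..t, ddt lam N ψ r ≤ C * xt lam N ψ s + C * ∫ r in s..t, a0 lam r * xt lam N ψ r := by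
  obtain ⟨c, hc, C, hC, δ, hδ, H⟩ := enPt μ lam γ hμ hl h1 N
  obtain ⟨C', hC', δ', hδ', H'⟩ := PH2 μ lam γ M hl h1 hM N hN
  refine ⟨max 1 (C / c), le_max_left _ _, min δ' (δ / C'), by positivity, fun E ψ h hE s t hs hst => ?_⟩
  have hE0 := h.E0
  have P : Pk M lam N ψ (C' * E) := ⟨h.sm, h.sp, hl, h1, hN, by positivity, H' E ψ h (hE.trans (min_le_left _ _))⟩
  obtain ⟨G, Gs, Gp, V, Vs, Vp, b⟩ := H M ψ _ P h.eq (by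
    have := hE.trans (min_le_right _ _)
    rw [le_div_iff₀ (by linarith)] at this; linarith)
  have xs := xx_sm lam N h.sm
  have xp := xx_sp lam N h.sp
  have ds := dd_sm lam N h.sm
  have dp := dd_sp lam N h.sp
  have sub : uIcc s t ⊆ Ioi 0 := by rw [uIcc_of_le hst]; exact fun r hr => lt_of_lt_of_le hs hr.1
  have xI : ∀ r, 0 < r → Integrable (fun x : E3 => xx lam N ψ (r, x)) := fun r hr => slice_int xs.continuous xp hr
  have dI : ∀ r, 0 < r → Integrable (fun x : E3 => Wt lam (r, x) * Y2 N ψ (r, x)) := fun r hr => slice_int ds.continuous dp hr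
  have GI : ∀ r, 0 < r → Integrable (fun x : E3 => G (r, x)) := fun r hr => slice_int Gs.continuous Gp hr
  have cx := it_cont xs xp
  have cd := it_cont ds dp
  have cG := it_cont (Gs.D 0) (Gp.D 0)
  have ca := ((a0_cont lam).mono Ioi_subset_Ici_self).mul cx
  have lo : c * xt lam N ψ t ≤ ∫ x : E3, G (t, x) := by
    unfold xt; rw [← integral_const_mul]
    exact integral_mono ((xI t (hs.trans_le hst)).const_mul c) (GI t (hs.trans_le hst)) fun x => (b (t, x) (hs.trans_le hst)).1
  have hi : ∫ x : E3, G (s, x) ≤ C * xt lam N ψ s := by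
    unfold xt; rw [← integral_const_mul]
    exact integral_mono (GI s hs) ((xI s hs).const_mul C) fun x => (b (s, x) hs).2.1
  have ftc := intervalIntegral.integral_eq_sub_of_hasDerivAt (fun r hr => int_dt Gs Gp (sub hr)) (cG.mono sub).intervalIntegrable
  have i1 : IntervalIntegrable (fun r => -c * ddt lam N ψ r) volume s t := ((cd.mono sub).intervalIntegrable).const_mul _
  have i2 : IntervalIntegrable (fun r => C * (a0 lam r * xt lam N ψ r)) volume s t := ((ca.mono sub).intervalIntegrable).const_mul _
  have mono : ∫ r in s..t, (∫ x : E3, Dop 0 G (r, x)) ≤ ∫ r in s..t, (-c * ddt lam N ψ r + C * (a0 lam r * xt lam N ψ r)) := by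
    refine intervalIntegral.integral_mono_on hst (cG.mono sub).intervalIntegrable (i1.add i2) fun r hr => ?_
    have r0 := hs.trans_le hr.1
    have z : ∫ x : E3, ∑ i : Fin 3, Ds i (V i) (r, x) = 0 := by
      rw [integral_finset_sum _ fun i _ => slice_int ((Vs i).D _).continuous ((Vp i).D _) r0]
      exact Finset.sum_eq_zero fun i _ => int_dx (Vs i) (Vp i) r0 i
    have zI : Integrable (fun x : E3 => ∑ i : Fin 3, Ds i (V i) (r, x)) := integrable_finset_sum _ fun i _ => slice_int ((Vs i).D _).continuous ((Vp i).D _) r0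
    have DI : Integrable (fun x : E3 => Dop 0 G (r, x)) := slice_int (Gs.D 0).continuous (Gp.D 0) r0
    calc ∫ x : E3, Dop 0 G (r, x) = ∫ x : E3, (Dop 0 G (r, x) + ∑ i : Fin 3, Ds i (V i) (r, x)) := by
          rw [integral_add DI zI, z, add_zero]
      _ ≤ ∫ x : E3, (-c * (Wt lam (r, x) * Y2 N ψ (r, x)) + C * (a0 lam r * xx lam N ψ (r, x))) := by
          refine integral_mono (DI.add zI) (((dI r r0).const_mul _).add (((xI r r0).const_mul _).const_mul _)) fun x => ?_
          have := (b (r, x) r0).2.2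
          simp only [A0, Wt_t r0] at this
          simpa only [a0, Wt_t r0] using this
      _ = _ := by
          rw [integral_add ((dI r r0).const_mul _) (((xI r r0).const_mul _).const_mul _), integral_const_mul, integral_const_mul, integral_const_mul]
          rfl
  rw [intervalIntegral.integral_add i1 i2, intervalIntegral.integral_const_mul, intervalIntegral.integral_const_mul, ftc] at mono
  have key : c * (xt lam N ψ t + ∫ r in s..t, ddt lam N ψ r) ≤ C * (xt lam N ψ s + ∫ r in s..t, a0 lam r * xt lam N ψ r) := by linarith
  have xn : ∀ r, 0 ≤ xt lam N ψ r := fun r => integral_nonneg fun x => xx_nonneg _ _ _ _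
  have an : 0 ≤ ∫ r in s..t, a0 lam r * xt lam N ψ r := by
    refine intervalIntegral.integral_nonneg hst fun r hr => mul_nonneg ?_ (xn r)
    have r0 : 0 < 1 + r := by linarith [hr.1]
    have : 0 ≤ 1 - lam := by linarith
    unfold a0; positivity
  have : xt lam N ψ t + ∫ r in s..t, ddt lam N ψ r ≤ C / c * (xt lam N ψ s + ∫ r in s..t, a0 lam r * xt lam N ψ r) := by
    rw [div_mul_eq_mul_div, le_div_iff₀ hc]; linarith
  rw [← mul_add]
  exact this.trans (mlr (le_max_right _ _) (add_nonneg (xn s) an))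
lemma Sp.zero {M : ℝ} {f : Fn} (hf : Continuous f) (h : Sp M f) {t : ℝ} (ht : 0 ≤ t) {x : E3} (hx : t + M < ‖x‖) : f (t, x) = 0 := by
  rcases ht.eq_or_lt with rfl | ht
  · have c : Continuous (fun s : ℝ => f (s, x)) := hf.comp (by fun_prop)
    have t1 : Filter.Tendsto (fun s : ℝ => f (s, x)) (nhdsWithin 0 (Ioi 0)) (nhds (f (0, x))) := (c.tendsto 0).mono_left nhdsWithin_le_nhds
    have t2 : Filter.Tendsto (fun s : ℝ => f (s, x)) (nhdsWithin 0 (Ioi 0)) (nhds 0) := by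
      refine tendsto_const_nhds.congr' ?_
      filter_upwards [Ioo_mem_nhdsGT (show (0:ℝ) < ‖x‖ - M by linarith)] with s hs
      exact (h (s, x) hs.1 (by show s + M < ‖x‖; linarith [hs.2])).symm
    exact tendsto_nhds_unique t1 t2
  · exact h (t, x) ht hx
lemma sint (hf : Continuous f) (h : Sp M f) (ht : 0 ≤ t) : Integrable (fun x : E3 => f (t, x)) := by
  refine (hf.comp (by fun_prop : Continuous fun x : E3 => ((t, x) : Pt))).integrable_of_hasCompactSupport ?_
  apply HasCompactSupport.of_support_subset_isCompact (isCompact_closedBall (0 : E3) (t + M))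
  intro x hx
  simp only [Function.mem_support] at hx
  rw [mem_closedBall_zero_iff]
  by_contra hc
  exact hx (h.zero hf ht (not_le.mp hc))
lemma icont (hf : Continuous f) (h : Sp M f) : ContinuousOn (fun s => ∫ x : E3, f (s, x)) (Ici 0) := by
  intro s hs
  have : ContinuousOn (fun s => ∫ x : E3, f (s, x)) (Icc 0 (s + 1)) := by
    refine continuousOn_integral_of_compact_support (f := fun (s : ℝ) (x : E3) => f (s, x)) (isCompact_closedBall (0 : E3) (s + 1 + M)) ?_ ?_
    · exact (hf.comp (by fun_prop : Continuous fun q : ℝ × E3 => ((q.1, q.2) : Pt))).continuousOn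
    · intro r x hr hx
      rw [mem_closedBall_zero_iff, not_le] at hx
      exact h.zero hf hr.1 (by linarith [hr.2])
  have s0 := hs
  refine (this s ⟨s0, by linarith⟩).mono_of_mem_nhdsWithin ?_
  rw [← Ici_inter_Iic]
  exact Filter.inter_mem self_mem_nhdsWithin (mem_nhdsWithin_of_mem_nhds (Iic_mem_nhds (by linarith)))
lemma Y2_YG {N : ℕ} (ψ : Fn) (p : Pt) : Y2 N ψ p ≤ 4 * wsum N (fun _ : Wd => 1) * YG2 N ψ p := by
  have : Y2 N ψ p ≤ wsum N (fun _ : Wd => 4 * YG2 N ψ p) := by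
    refine wsum_le fun l hl => ?_
    refine (Finset.sum_le_sum (g := fun _ => YG2 N ψ p) fun α _ => ?_).trans (le_of_eq (by simp))
    exact W_le_YG ψ p (α :: l) (by simp) (by simp; omega)
  rw [wsum_const] at this
  linarith
lemma en_eq (lam : ℝ) (N : ℕ) (hs : Sm ψ) (hp : Sp M ψ) (ht : 0 ≤ t) : energy lam N ψ t = (1 + t) ^ (2 * lam) * (∫ x : E3, YG2 N ψ (t, x)) + wsum N (fun a : List (Fin 8) => ∫ x : E3, GamWord a ψ (t, x) ^ 2) := by
  have i1 : ∀ a : List (Fin 8), Integrable (fun x : E3 => ∑ α, Dop α (GamWord a ψ) (t, x) ^ 2) := fun a =>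
    sint (f := fun p => ∑ α, Dop α (GamWord a ψ) p ^ 2) (ContDiff.sum (n := ((⊤ : ℕ∞) : WithTop ℕ∞)) fun α _ => ((hs.GW a).D α).pow 2).continuous (Sp.sum _ fun α _ => ((hp.GW a).D α).sq) ht
  have i2 : ∀ a : List (Fin 8), Integrable (fun x : E3 => GamWord a ψ (t, x) ^ 2) := fun a =>
    sint (f := fun p => GamWord a ψ p ^ 2) ((hs.GW a).pow 2).continuous (hp.GW a).sq ht
  have : ∫ x : E3, YG2 N ψ (t, x) = wsum N (fun a => ∫ x : E3, ∑ α, Dop α (GamWord a ψ) (t, x) ^ 2) := wsum_int i1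
  rw [this, ← wsum_mul, ← wsum_add]
  change wsum N (fun a : List (Fin 8) => ∫ x : E3, ((1 + t) ^ (2 * lam) * ∑ α : Fin 4, (Dop α (GamWord a ψ) (t, x)) ^ 2 + (GamWord a ψ (t, x)) ^ 2)) = _
  congr 1; funext a
  rw [integral_add ((i1 a).const_mul _) (i2 a), integral_const_mul]
lemma psi_le_en (ψ : Fn) (t : ℝ) : ∫ x : E3, ψ (t, x) ^ 2 ≤ wsum N (fun a : List (Fin 8) => ∫ x : E3, GamWord a ψ (t, x) ^ 2) := le_wsum (F := fun a : List (Fin 8) => ∫ x : E3, GamWord a ψ (t, x) ^ 2) (fun a => integral_nonneg fun x => sq_nonneg _) [] (by simp)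
lemma mkHyp {ε : ℝ} (hl : 0 < lam) (h1 : lam ≤ 1) (hM : 0 < M) (hN : 8 ≤ N) (hs : Sm ψ) (hp : Sp M ψ) (he : psiEq μ lam γ ψ) (hK : 0 < K) (hε : 0 < ε) (hb : ∀ t : ℝ, 0 ≤ t → energy lam N ψ t ≤ K ^ 2 * ε ^ 2) : Hyp μ lam γ M N ψ (K * ε) := by
  have ps := fun t : ℝ => psi_le_en (N := N) ψ t
  have p0 : ∀ t : ℝ, 0 ≤ ∫ x : E3, ψ (t, x) ^ 2 := fun t => integral_nonneg fun x => sq_nonneg _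
  have y0 : ∀ t : ℝ, 0 ≤ ∫ x : E3, YG2 N ψ (t, x) := fun t => integral_nonneg fun x => YG2_nonneg _ _ _
  refine ⟨hs, hp, eqU_of hs he, by positivity, hl, h1, hM, hN, fun t ht => ?_, fun t ht => ?_⟩
  · have h2 := hb t ht.le
    rw [en_eq lam N hs hp ht.le] at h2
    have w : 0 < (1 + t) ^ lam := Real.rpow_pos_of_pos (by linarith) _
    have e : (1 + t) ^ (2 * lam) = ((1 + t) ^ lam) ^ 2 := by
      rw [two_mul, Real.rpow_add (by linarith)]; ring
    rw [e] at h2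
    rw [div_pow, le_div_iff₀ (by positivity)]
    nlinarith [ps t, p0 t]
  · have h2 := hb t ht.le
    rw [en_eq lam N hs hp ht.le] at h2
    have w : 0 ≤ (1 + t) ^ (2 * lam) := Real.rpow_nonneg (by linarith) _
    have := mul_nonneg w (y0 t)
    nlinarith [ps t]
lemma xt0 (hs : Sm ψ) (hp : Sp M ψ) : xt lam N ψ 0 ≤ (1 + 4 * wsum N (fun _ : Wd => 1)) * energy lam N ψ 0 := by
  set n := wsum N (fun _ : Wd => 1) with hn
  have n0 : 0 ≤ n := wsum_nonneg fun _ => zero_le_one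
  have i1 := sint (YG2_sm (N := N) hs).continuous (YG2_sp hp) (le_refl (0:ℝ))
  have i2 := sint (hs.pow 2).continuous hp.sq (le_refl (0:ℝ))
  have h1 : xt lam N ψ 0 ≤ ∫ x : E3, (4 * n * YG2 N ψ (0, x) + ψ (0, x) ^ 2) := by
    refine integral_mono (sint (xx_sm lam N hs).continuous (xx_sp lam N hp) le_rfl) ((i1.const_mul _).add i2) fun x => ?_
    simp only [xx]
    rw [Wt_eq _ (p := ((0, x) : Pt)) le_rfl]
    have := Y2_YG (N := N) ψ (0, x)
    simp only [add_zero, Real.one_rpow, one_mul]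
    linarith
  rw [integral_add (i1.const_mul _) i2, integral_const_mul] at h1
  have ps := psi_le_en (N := N) ψ 0
  have p0 : 0 ≤ ∫ x : E3, ψ (0, x) ^ 2 := integral_nonneg fun x => sq_nonneg _
  have y0 : 0 ≤ ∫ x : E3, YG2 N ψ (0, x) := integral_nonneg fun x => YG2_nonneg _ _ _
  rw [en_eq lam N hs hp le_rfl]
  simp only [add_zero, Real.one_rpow, one_mul]
  have := mll (p0.trans ps) n0
  nlinarith
lemma a0_nn (hl : 0 < lam) (h1 : lam ≤ 1) {s : ℝ} (hs : 0 ≤ s) : 0 ≤ a0 lam s := by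
  have : 0 < 1 + s := by linarith
  have : 0 ≤ 1 - lam := by linarith
  unfold a0; positivity
lemma a0_quarter (hl : 0 < lam) (h1 : lam ≤ 1) {s : ℝ} (hs : 0 ≤ s) (hs1 : s ≤ 1) : 1 ≤ 4 * a0 lam s := by
  have p : 0 < 1 + s := by linarith
  have : 0 ≤ 1 - lam := by linarith
  have q : 0 ≤ (1 + s) ^ (-1 - lam) + lam * (1 - lam) * (1 + s) ^ (lam - 2) := by positivity
  have r : (1:ℝ) / 4 ≤ (1 + s) ^ (-2 : ℝ) := by
    rw [Real.rpow_neg p.le, ← one_div]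
    refine one_div_le_one_div_of_le (by positivity) ?_
    rw [Real.rpow_two]; nlinarith
  unfold a0; linarith
lemma a0_int (hl : 0 < lam) (h1 : lam ≤ 1) : IntegrableOn (a0 lam) (Ioi 0) := by
  have i : ∀ b : ℝ, b < -1 → IntegrableOn (fun t : ℝ => (1 + t) ^ b) (Ioi 0) := fun b hb => by
    have := integrableOn_add_rpow_Ioi_of_lt (a := b) (c := 0) (m := 1) hb (by norm_num)
    simpa only [add_comm] using this
  have i3 : IntegrableOn (fun t : ℝ => lam * (1 - lam) * (1 + t) ^ (lam - 2)) (Ioi 0) := by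
    rcases h1.eq_or_lt with rfl | h
    · simp
    · exact (i _ (by linarith)).const_mul _
  exact ((i _ (by linarith)).add (i _ (by norm_num))).add i3
lemma fin_real {C1 n B C K0 X : ℝ} {x d : ℝ → ℝ} (hl : 0 < lam) (h1 : lam ≤ 1) (hC1 : 1 ≤ C1) (hn : 1 ≤ n) (hB : B = n * C1 + 4 * (C1 + 1)) (hK0 : 0 ≤ K0) (hC : C = n * C1 * K0 + n) (cx : ContinuousOn x (Ici 0)) (cd : ContinuousOn d (Ici 0)) (x0 : ∀ s, 0 ≤ s → 0 ≤ x s) (d0 : ∀ s, 0 ≤ s → 0 ≤ d s) (dx : ∀ s, 0 ≤ s → d s ≤ x s) (H : ∀ s t, 0 < s → s ≤ t → x t + ∫ r in s..t, d r ≤ C1 * x s + C1 * ∫ r in s..t, a0 lam r * x r) {ε : ℝ} (ht : 0 < t) (hx0 : x 0 ≤ K0 * ε ^ 2) (hX : X ≤ n * x t) : X + C * ∫ r in 0..t, d r ≤ C * ε ^ 2 + C * ∫ r in 0..t, B * (a0 lam r * x r) := by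
  have cax := (a0_cont lam).mul cx
  have sub : ∀ {a b : ℝ}, 0 ≤ a → 0 ≤ b → uIcc a b ⊆ Ici 0 := fun ha hb r hr => (le_min ha hb).trans hr.1
  have id : ∀ {a b : ℝ}, 0 ≤ a → 0 ≤ b → IntervalIntegrable d volume a b := fun ha hb => (cd.mono (sub ha hb)).intervalIntegrable
  have ix : ∀ {a b : ℝ}, 0 ≤ a → 0 ≤ b → IntervalIntegrable x volume a b := fun ha hb => (cx.mono (sub ha hb)).intervalIntegrable
  have ia : ∀ {a b : ℝ}, 0 ≤ a → 0 ≤ b → IntervalIntegrable (fun r => a0 lam r * x r) volume a b := fun ha hb => (cax.mono (sub ha hb)).intervalIntegrable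
  have H0 : ∀ s t, 0 ≤ s → s ≤ t → 0 < t → x t + ∫ r in s..t, d r ≤ C1 * x s + C1 * ∫ r in s..t, a0 lam r * x r := by
    intro s t hs hst ht
    rcases hs.eq_or_lt with rfl | hs
    swap
    · exact H s t hs hst
    have ne : Ioc 0 t ⊆ Icc 0 t := Ioc_subset_Icc_self
    have z : (0:ℝ) ∈ Icc 0 t := ⟨le_rfl, ht.le⟩
    have k1 : ContinuousOn (fun s => ∫ r in s..t, d r) (Icc 0 t) := by
      have := intervalIntegral.continuousOn_primitive_interval_left (μ := volume) (f := d) (a := 0) (b := t) ((cd.mono (sub le_rfl ht.le)).integrableOn_compact isCompact_uIcc)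
      rwa [uIcc_of_le ht.le] at this
    have k2 : ContinuousOn (fun s => ∫ r in s..t, a0 lam r * x r) (Icc 0 t) := by
      have := intervalIntegral.continuousOn_primitive_interval_left (μ := volume) (f := fun r => a0 lam r * x r) (a := 0) (b := t) ((cax.mono (sub le_rfl ht.le)).integrableOn_compact isCompact_uIcc)
      rwa [uIcc_of_le ht.le] at this
    have k3 : ContinuousOn x (Icc 0 t) := cx.mono Icc_subset_Ici_self
    have l1 : ContinuousOn (fun s => x t + ∫ r in s..t, d r) (Icc 0 t) := continuousOn_const.add k1
    have l2 : ContinuousOn (fun s => C1 * x s + C1 * ∫ r in s..t, a0 lam r * x r) (Icc 0 t) := (continuousOn_const.mul k3).add (continuousOn_const.mul k2)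
    have t1 := (l1 0 z).mono ne
    have t2 := (l2 0 z).mono ne
    have nb : (nhdsWithin (0:ℝ) (Ioc 0 t)).NeBot := by rw [nhdsWithin_Ioc_eq_nhdsGT ht]; infer_instance
    refine le_of_tendsto_of_tendsto t1 t2 ?_
    filter_upwards [self_mem_nhdsWithin] with s hs
    exact H s t hs.1 hs.2
  have hC0 : n ≤ C := by rw [hC]; nlinarith [mul_nonneg (mul_nonneg (by linarith : 0 ≤ n) (by linarith : 0 ≤ C1)) hK0]
  have Cp : 0 < C := by linarith
  have anx : ∀ r, 0 ≤ r → 0 ≤ a0 lam r * x r := fun r hr => mul_nonneg (a0_nn hl h1 hr) (x0 r hr)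
  have q : ∀ T, 0 ≤ T → T ≤ 1 → ∫ r in 0..T, x r ≤ 4 * ∫ r in 0..T, a0 lam r * x r := fun T hT hT1 => by
    rw [← intervalIntegral.integral_const_mul]
    refine intervalIntegral.integral_mono_on hT (ix le_rfl hT) ((ia le_rfl hT).const_mul _) fun r hr => ?_
    have := mlr (a0_quarter hl h1 hr.1 (hr.2.trans hT1)) (x0 r hr.1)
    linarith
  have dxi : ∀ T, 0 ≤ T → ∫ r in 0..T, d r ≤ ∫ r in 0..T, x r := fun T hT =>
    intervalIntegral.integral_mono_on hT (id le_rfl hT) (ix le_rfl hT) fun r hr => dx r hr.1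
  have J0 : 0 ≤ ∫ r in 0..t, a0 lam r * x r := intervalIntegral.integral_nonneg ht.le fun r hr => anx r hr.1
  rw [intervalIntegral.integral_const_mul]
  set J := ∫ r in 0..t, a0 lam r * x r with hJ
  rcases le_total t 1 with h | h
  · have e1 := H0 0 t le_rfl ht.le ht
    have e2 := q t ht.le h
    have e3 := dxi t ht.le
    have dn : 0 ≤ ∫ r in 0..t, d r := intervalIntegral.integral_nonneg ht.le fun r hr => d0 r hr.1
    have e4 : x t ≤ C1 * x 0 + C1 * J := by linarith
    have e5 : n * x t ≤ n * (C1 * x 0 + C1 * J) := mll e4 (by linarith)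
    have e6 : n * C1 * x 0 ≤ n * C1 * (K0 * ε ^ 2) := mll hx0 (mul_nonneg (by linarith) (by linarith))
    have e7 := mll (e3.trans e2) Cp.le
    have e8 : n * C1 * J ≤ C * (n * C1 * J) := by
      have : 0 ≤ n * C1 * J := mul_nonneg (mul_nonneg (by linarith) (by linarith)) J0
      nlinarith
    have e9 : 0 ≤ C * (C1 * J) := mul_nonneg Cp.le (mul_nonneg (by linarith) J0)
    have e10 : 0 ≤ n * ε ^ 2 := mul_nonneg (by linarith) (sq_nonneg _)
    have e11 : C * ε ^ 2 = n * C1 * (K0 * ε ^ 2) + n * ε ^ 2 := by rw [hC]; ring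
    rw [e11, hB]
    linarith
  · obtain ⟨s0, hs0, hm⟩ := isCompact_Icc.exists_isMinOn (nonempty_Icc.2 (zero_le_one' ℝ)) (cx.mono (Icc_subset_Ici_self : Icc (0:ℝ) 1 ⊆ Ici 0))
    have m1 : x s0 ≤ ∫ r in (0:ℝ)..1, x r := by
      have := intervalIntegral.integral_mono_on zero_le_one (by simp) (ix le_rfl zero_le_one) fun r hr => hm hr
      simpa using this
    have e1 := H0 s0 t hs0.1 (hs0.2.trans h) ht
    have e2 := q 1 zero_le_one le_rfl
    have sp1 := intervalIntegral.integral_add_adjacent_intervals (id le_rfl hs0.1) (id hs0.1 ht.le)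
    have sp2 := intervalIntegral.integral_add_adjacent_intervals (ia le_rfl hs0.1) (ia hs0.1 ht.le)
    have sp3 := intervalIntegral.integral_add_adjacent_intervals (ia le_rfl zero_le_one) (ia zero_le_one ht.le)
    have sp4 := intervalIntegral.integral_add_adjacent_intervals (ia le_rfl hs0.1) (ia hs0.1 zero_le_one)
    have g1 : 0 ≤ ∫ r in 0..s0, a0 lam r * x r := intervalIntegral.integral_nonneg hs0.1 fun r hr => anx r hr.1
    have g2 : 0 ≤ ∫ r in (1:ℝ)..t, a0 lam r * x r := intervalIntegral.integral_nonneg h fun r hr => anx r (zero_le_one.trans hr.1)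
    have g3 : 0 ≤ ∫ r in s0..1, a0 lam r * x r := intervalIntegral.integral_nonneg hs0.2 fun r hr => anx r (hs0.1.trans hr.1)
    have e3 := (dxi s0 hs0.1).trans (q s0 hs0.1 hs0.2)
    have e4 : C1 * x s0 ≤ C1 * (4 * J) := mll (by linarith) (by linarith)
    have e5 : C1 * ∫ r in s0..t, a0 lam r * x r ≤ C1 * J := mll (by linarith) (by linarith)
    have e5' : C1 * J ≤ n * C1 * J := mlr (by nlinarith) J0
    have e6 : x t + ∫ r in 0..t, d r ≤ B * J := by rw [hB]; linarith
    have e7 := mll e6 Cp.le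
    have e8 : n * x t ≤ C * x t := mlr hC0 (x0 t ht.le)
    have e9 : 0 ≤ C * ε ^ 2 := mul_nonneg Cp.le (sq_nonneg _)
    linarith
lemma lhs_x (hs : Sm ψ) (hp : Sp M ψ) (ht : 0 ≤ t) : (∑ n ∈ Finset.range (N + 1), ∑ a : Fin n → Fin 4, ∫ x : E3, ((1 + t) ^ (2 * lam) * (∑ α : Fin 4, (Dop α (DWord (List.ofFn a) ψ) (t, x)) ^ 2) + (ψ (t, x)) ^ 2)) = ∫ x : E3, (Vt lam (t, x) * Y2 N ψ (t, x) + wsum N (fun _ : Wd => 1) * ψ (t, x) ^ 2) := by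
  change wsum N (fun a : Wd => ∫ x : E3, ((1 + t) ^ (2 * lam) * (∑ α : Fin 4, (Dop α (DWord a ψ) (t, x)) ^ 2) + (ψ (t, x)) ^ 2)) = _
  rw [← wsum_int]
  · congr 1; funext x
    rw [wsum_add, wsum_mul, wsum_const (ψ (t, x) ^ 2), Wt_eq _ (p := (t, x)) ht]; rfl
  · intro a
    have i1 := sint (f := fun p => ∑ α, Dop α (DWord a ψ) p ^ 2) (ContDiff.sum (n := ((⊤ : ℕ∞) : WithTop ℕ∞)) fun α _ => ((hs.W a).D α).pow 2).continuous (Sp.sum _ fun α _ => ((hp.W a).D α).sq) ht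
    exact (i1.const_mul _).add (sint (hs.pow 2).continuous hp.sq ht)
lemma lhs_d (hs : Sm ψ) (hp : Sp M ψ) (ht : 0 ≤ t) : (∑ n ∈ Finset.range (N + 1), ∑ a : Fin n → Fin 4, ∫ τ in (0 : ℝ)..t, ∫ x : E3, (1 + τ) ^ lam * ∑ α : Fin 4, (Dop α (DWord (List.ofFn a) ψ) (τ, x)) ^ 2) = ∫ τ in (0 : ℝ)..t, ddt lam N ψ τ := by
  change wsum N (fun a : Wd => ∫ τ in (0 : ℝ)..t, ∫ x : E3, (1 + τ) ^ lam * ∑ α : Fin 4, (Dop α (DWord a ψ) (τ, x)) ^ 2) = _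
  have s1 : ∀ a, Continuous (fun p => Wt lam p * ∑ α : Fin 4, (Dop α (DWord a ψ) p) ^ 2) := fun a =>
    ((Wt_sm lam).mul (ContDiff.sum (n := ((⊤ : ℕ∞) : WithTop ℕ∞)) fun α _ => ((hs.W a).D α).pow 2)).continuous
  have s2 : ∀ a, Sp M (fun p => Wt lam p * ∑ α : Fin 4, (Dop α (DWord a ψ) p) ^ 2) := fun a => (Sp.sum _ fun α _ => ((hp.W a).D α).sq).mul' _
  have e : ∀ a : Wd, ∫ τ in (0 : ℝ)..t, ∫ x : E3, (1 + τ) ^ lam * ∑ α : Fin 4, (Dop α (DWord a ψ) (τ, x)) ^ 2 = ∫ τ in Ioc (0:ℝ) t, ∫ x : E3, Wt lam (τ, x) * ∑ α : Fin 4, (Dop α (DWord a ψ) (τ, x)) ^ 2 := fun a => by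
    rw [intervalIntegral.integral_of_le ht]
    refine setIntegral_congr_fun measurableSet_Ioc fun τ hτ => ?_
    simp only [Wt_t hτ.1]
  simp only [e]
  rw [← wsum_int, intervalIntegral.integral_of_le ht]
  · refine setIntegral_congr_fun measurableSet_Ioc fun τ hτ => ?_
    simp only [ddt]
    rw [← wsum_int fun a => sint (s1 a) (s2 a) hτ.1.le]
    congr 1; funext x
    rw [wsum_mul]; rfl
  · intro a
    have := ((icont (s1 a) (s2 a)).mono (Icc_subset_Ici_self : Icc 0 t ⊆ Ici 0)).integrableOn_compact (μ := volume) isCompact_Icc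
    exact this.mono_set Ioc_subset_Icc_self
theorem energy_estimate_pure_derivatives (μ lam γ M : ℝ) (N : ℕ) (hμ : 0 < μ) (hlam0 : 0 < lam) (hlam1 : lam ≤ 1) (hγ : 1 < γ) (hM : 0 < M) (hN : 8 ≤ N) : ∃ C > 0, ∃ δ > 0, ∃ A : ℝ → ℝ, (∀ s : ℝ, 0 ≤ A s) ∧ IntegrableOn A (Ioi 0) ∧ ∀ (ψ : Pt → ℝ) (K ε : ℝ), ContDiff ℝ (⊤ : ℕ∞) ψ → (∀ t : ℝ, 0 ≤ t → ∀ x : E3, t + M < ‖x‖ → ψ (t, x) = 0) → psiEq μ lam γ ψ → 0 < K → 0 < ε → energy lam N ψ 0 ≤ ε ^ 2 → (∀ t : ℝ, 0 ≤ t → energy lam N ψ t ≤ K ^ 2 * ε ^ 2) → K * ε ≤ δ → ∀ t : ℝ, 0 < t → (∑ n ∈ Finset.range (N + 1), ∑ a : Fin n → Fin 4, ∫ x : E3, ((1 + t) ^ (2 * lam) * (∑ α : Fin 4, (Dop α (DWord (List.ofFn a) ψ) (t, x)) ^ 2) + (ψ (t, x)) ^ 2)) + C * ∑ n ∈ Finset.range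 (N + 1), ∑ a : Fin n → Fin 4, ∫ τ in (0 : ℝ)..t, ∫ x : E3, (1 + τ) ^ lam * ∑ α : Fin 4, (Dop α (DWord (List.ofFn a) ψ) (τ, x)) ^ 2 ≤ C * ε ^ 2 + C * (1 + K * ε) * ∫ τ in (0 : ℝ)..t, A τ * ∑ n ∈ Finset.range (N + 1), ∑ a : Fin n → Fin 4, ∫ x : E3, ((1 + τ) ^ (2 * lam) * (∑ α : Fin 4, (Dop α (DWord (List.ofFn a) ψ) (τ, x)) ^ 2) + (ψ (τ, x)) ^ 2) := by
  obtain ⟨C1, hC1, δ, hδ, H⟩ := enInt μ lam γ M hμ hlam0 hlam1 hM N hN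
  have n1 : 1 ≤ wsum N (fun _ : Wd => 1) := le_wsum (F := fun _ : Wd => (1:ℝ)) (fun _ => zero_le_one) [] (by simp)
  set n := wsum N (fun _ : Wd => 1) with hn
  set B := n * C1 + 4 * (C1 + 1) with hB
  set C := n * C1 * (1 + 4 * n) + n with hC
  have B0 : 0 < B := by positivity
  have C0 : 0 < C := by positivity
  refine ⟨C, C0, δ, hδ, fun s => B * a0 lam |s|, fun s => mul_nonneg B0.le (a0_nn hlam0 hlam1 (abs_nonneg s)), ?_, ?_⟩
  · have i0 : IntegrableOn (fun s => B * a0 lam s) (Ioi 0) := (a0_int hlam0 hlam1).const_mul B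
    refine i0.congr_fun (fun s hs => ?_) measurableSet_Ioi
    simp only [abs_of_pos (show (0:ℝ) < s from hs)]
  intro ψ K ε hs hp0 heq hK hε hE0 hE hKε t ht
  have hp : Sp M ψ := fun p h1 h2 => hp0 p.1 h1.le p.2 h2
  have hH := mkHyp hlam0 hlam1 hM hN hs hp heq hK hε hE
  have xI : ∀ s, 0 ≤ s → Integrable (fun x : E3 => xx lam N ψ (s, x)) := fun s h => sint (xx_sm lam N hs).continuous (xx_sp lam N hp) h
  have dI : ∀ s, 0 ≤ s → Integrable (fun x : E3 => Wt lam (s, x) * Y2 N ψ (s, x)) := fun s h => sint (dd_sm lam N hs).continuous (dd_sp lam N hp) h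
  have zs : Sm (fun p => Vt lam p * Y2 N ψ p + n * ψ p ^ 2) := ((Wt_sm _).mul (Y2_sm hs)).add (contDiff_const.mul (hs.pow 2))
  have zp : Sp M (fun p => Vt lam p * Y2 N ψ p + n * ψ p ^ 2) := ((Y2_sp hp).mul' _).add (hp.sq.mul' (fun _ => n))
  have zI : ∀ s, 0 ≤ s → Integrable (fun x : E3 => Vt lam (s, x) * Y2 N ψ (s, x) + n * ψ (s, x) ^ 2) := fun s h => sint zs.continuous zp h
  have x0 : ∀ s, 0 ≤ s → 0 ≤ xt lam N ψ s := fun s _ => integral_nonneg fun x => xx_nonneg _ _ _ _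
  have cx : ContinuousOn (xt lam N ψ) (Ici 0) := icont (xx_sm lam N hs).continuous (xx_sp lam N hp)
  have cd : ContinuousOn (ddt lam N ψ) (Ici 0) := icont (dd_sm lam N hs).continuous (dd_sp lam N hp)
  have cz : ContinuousOn (fun s => ∫ x : E3, (Vt lam (s, x) * Y2 N ψ (s, x) + n * ψ (s, x) ^ 2)) (Ici 0) := icont zs.continuous zp
  have xz : ∀ s, 0 ≤ s → xt lam N ψ s ≤ ∫ x : E3, (Vt lam (s, x) * Y2 N ψ (s, x) + n * ψ (s, x) ^ 2) := fun s h =>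
    integral_mono (xI s h) (zI s h) fun x => by
      simp only [xx]
      nlinarith [sq_nonneg (ψ (s, x))]
  have zx : ∀ s, 0 ≤ s → ∫ x : E3, (Vt lam (s, x) * Y2 N ψ (s, x) + n * ψ (s, x) ^ 2) ≤ n * xt lam N ψ s := fun s h => by
    unfold xt; rw [← integral_const_mul]
    refine integral_mono (zI s h) ((xI s h).const_mul n) fun x => ?_
    simp only [xx]
    have : 0 ≤ Vt lam (s, x) * Y2 N ψ (s, x) := mul_nonneg (Wt_pos _ _).le (Y2_nonneg _ _ _)
    nlinarith
  have dx : ∀ s, 0 ≤ s → ddt lam N ψ s ≤ xt lam N ψ s := fun s h =>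
    integral_mono (dI s h) (xI s h) fun x => by
      simp only [xx]
      have := mlr (Wt_mono (a := lam) (b := 2 * lam) (by linarith) (p := (s, x)) h) (Y2_nonneg N ψ (s, x))
      nlinarith [sq_nonneg (ψ (s, x))]
  have d0 : ∀ s, 0 ≤ s → 0 ≤ ddt lam N ψ s := fun s _ => integral_nonneg fun x => mul_nonneg (Wt_pos _ _).le (Y2_nonneg _ _ _)
  have fin := fin_real hlam0 hlam1 hC1 n1 hB (by linarith : 0 ≤ 1 + 4 * n) hC cx cd x0 d0 dx (H _ ψ hH hKε) (ε := ε) ht ((xt0 hs hp).trans (mll hE0 (by linarith))) (zx t ht.le)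
  rw [lhs_x hs hp ht.le, lhs_d hs hp ht.le]
  have sub : uIcc 0 t ⊆ Ici 0 := by rw [uIcc_of_le ht.le]; exact Icc_subset_Ici_self
  have r1 : (∫ τ in (0 : ℝ)..t, B * a0 lam |τ| * ∑ n ∈ Finset.range (N + 1), ∑ a : Fin n → Fin 4, ∫ x : E3, ((1 + τ) ^ (2 * lam) * (∑ α : Fin 4, (Dop α (DWord (List.ofFn a) ψ) (τ, x)) ^ 2) + (ψ (τ, x)) ^ 2)) = ∫ τ in (0 : ℝ)..t, B * (a0 lam τ * ∫ x : E3, (Vt lam (τ, x) * Y2 N ψ (τ, x) + n * ψ (τ, x) ^ 2)) := by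
    refine intervalIntegral.integral_congr fun τ hτ => ?_
    have h0 : 0 ≤ τ := sub hτ
    simp only [lhs_x hs hp h0, abs_of_nonneg h0, mul_assoc]
    rfl
  rw [r1]
  have r2 : ∫ r in 0..t, B * (a0 lam r * xt lam N ψ r) ≤ ∫ τ in (0 : ℝ)..t, B * (a0 lam τ * ∫ x : E3, (Vt lam (τ, x) * Y2 N ψ (τ, x) + n * ψ (τ, x) ^ 2)) := by
    refine intervalIntegral.integral_mono_on ht.le ?_ ?_ fun r hr => ?_
    · exact ((continuousOn_const.mul ((a0_cont lam).mul cx)).mono sub).intervalIntegrable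
    · exact ((continuousOn_const.mul ((a0_cont lam).mul cz)).mono sub).intervalIntegrable
    · exact mll (mll (xz r hr.1) (a0_nn hlam0 hlam1 hr.1)) B0.le
  have r3 : 0 ≤ ∫ r in 0..t, B * (a0 lam r * xt lam N ψ r) := intervalIntegral.integral_nonneg ht.le fun r hr => mul_nonneg B0.le (mul_nonneg (a0_nn hlam0 hlam1 hr.1) (x0 r hr.1))
  have r4 := r3.trans r2
  have r5 := mul_nonneg (mul_nonneg hK.le hε.le) (mul_nonneg C0.le r4)
  have r6 := mll r2 C0.le
  refine fin.trans ?_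
  nlinarith
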